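/- arXiv:2506.05905 — 9 statements merged into one kernel-verified Lean document; each statement's English description precedes it below -/
import Mathlib

section
/- Let d ≥ 1. Let V_π, V_{μ₀} : ℝ^d → ℝ be twice continuously differentiable, with ∇V_π L_π-Lipschitz and c_π-strongly monotone (⟨x−x', ∇V_π(x)−∇V_π(x')⟩ ≥ c_π‖x−x'‖²) and ∇V_{μ₀} L_{μ₀}-Lipschitz and c_{μ₀}-strongly monotone; let π ∝ exp(−V_π) be the associated probability density. Fix ε_π > 1/(2c_π), ε_{μ₀} > 1/(2c_{μ₀}) and set a_π = c_π − 1/(2ε_π), b_π = ε_π‖∇V_π(0)‖²/2, and analogously a_{μ₀}, b_{μ₀}. Let λ : [0,∞) → [0,1] be nondecreasing, let S > 0, and let (μ_t)_{t≥0} be a family of strictly positive continuously differentiable probability densities on ℝ^d such that: (i) ∫‖x‖²μ_t(x)dx ≤ S for all t; (ii) F(t) := ∫ μ_t log(μ_t/π) is finite and the map t ↦ F(t) has, at every t ≥ 0, derivative equal to −∫ μ_t(x)‖∇log(μ_t(x)/π(x))‖² dx + (1−λ(t))·∫ μ_t(x)[ΔV_{μ₀}(x) − ΔV_π(x) − ⟨∇V_π(x),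 ∇V_{μ₀}(x) − ∇V_π(x)⟩] dx (the energy–dissipation identity satisfied by solutions of the tempered Wasserstein flow ∂_tμ_t = ∇·(μ_t ∇log(μ_t/π_t)) with π_t ∝ π^{λ(t)} μ₀^{1−λ(t)}); (iii) the log-Sobolev inequality F(t) ≤ (1/(2c_π)) ∫ μ_t ‖∇log(μ_t/π)‖² holds for every t. Then for all t ≥ 0: F(t) ≤ e^{−2c_π t} F(0) + A·∫₀ᵗ e^{−2c_π(t−s)} (1−λ(s)) ds, where A = d(L_{μ₀} − c_π) + 4·max(L_π², L_{μ₀}²)·(S + max(b_π/a_π, b_{μ₀}/a_{μ₀})). -/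
open MeasureTheory
open scoped RealInnerProductSpace BigOperators

/-- The Laplacian of a function on Euclidean space, as the sum of the second
partial derivatives (trace of the Hessian), expressed via iterated gradients. -/
noncomputable def laplacian {d : ℕ} (V : EuclideanSpace ℝ (Fin d) → ℝ)
    (x : EuclideanSpace ℝ (Fin d)) : ℝ :=
  ∑ i : Fin d, gradient (fun y => gradient V y i) x i

abbrev EE (d : ℕ) := EuclideanSpace ℝ (Fin d)

lemma grad_contDiff {d : ℕ} {V : EE d → ℝ} (hV : ContDiff ℝ 2 V) :
    ContDiff ℝ 1 (gradient V) := by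
  have h : ContDiff ℝ 1 (fderiv ℝ V) := hV.fderiv_right (by norm_num)
  exact (InnerProductSpace.toDual ℝ (EE d)).symm.contDiff.comp h

lemma lap_term {d : ℕ} {V : EE d → ℝ} (hV : ContDiff ℝ 2 V) (x : EE d) (i : Fin d) :
    gradient (fun y => gradient V y i) x i
      = (fderiv ℝ (gradient V) x (EuclideanSpace.single i 1)) i := by
  have hG : DifferentiableAt ℝ (gradient V) x :=
    (grad_contDiff hV).differentiable (by norm_num) x
  have h1 : HasFDerivAt (fun y => gradient V y i)
      ((EuclideanSpace.proj i : EE d →L[ℝ] ℝ).comp (fderiv ℝ (gradient V) x)) x :=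
    (EuclideanSpace.proj i : EE d →L[ℝ] ℝ).hasFDerivAt.comp x hG.hasFDerivAt
  have h2 : gradient (fun y => gradient V y i) x i
      = ⟪gradient (fun y => gradient V y i) x, (EuclideanSpace.single i 1 : EE d)⟫ := by
    rw [EuclideanSpace.inner_single_right]; simp
  rw [h2, gradient, InnerProductSpace.toDual_symm_apply, h1.fderiv]
  simp

lemma lap_cont {d : ℕ} {V : EE d → ℝ} (hV : ContDiff ℝ 2 V) : Continuous (laplacian V) := by
  have : laplacian V = fun x => ∑ i : Fin d,
      (fderiv ℝ (gradient V) x (EuclideanSpace.single i 1)) i := by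
    funext x
    exact Finset.sum_congr rfl (fun i _ => lap_term hV x i)
  rw [this]
  have h : Continuous (fderiv ℝ (gradient V)) :=
    (grad_contDiff hV).continuous_fderiv (by norm_num)
  fun_prop

lemma lap_term_abs {d : ℕ} {V : EE d → ℝ} (hV : ContDiff ℝ 2 V) {L : ℝ} (hL : 0 < L)
    (hlip : ∀ x x', ‖gradient V x - gradient V x'‖ ≤ L * ‖x - x'‖) (x : EE d) (i : Fin d) :
    |gradient (fun y => gradient V y i) x i| ≤ L := by
  rw [lap_term hV]
  have h1 : ‖fderiv ℝ (gradient V) x‖ ≤ L :=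
    norm_fderiv_le_of_lip' ℝ hL.le (Filter.Eventually.of_forall fun y => hlip y x)
  have h2 := (fderiv ℝ (gradient V) x).le_opNorm (EuclideanSpace.single i 1)
  have h3 := PiLp.norm_apply_le (fderiv ℝ (gradient V) x (EuclideanSpace.single i 1)) i
  rw [Real.norm_eq_abs] at h3
  rw [PiLp.norm_single, norm_one, mul_one] at h2
  linarith

lemma lap_term_lower {d : ℕ} {V : EE d → ℝ} (hV : ContDiff ℝ 2 V) {c : ℝ}
    (hmono : ∀ x x', c * ‖x - x'‖ ^ 2 ≤ ⟪x - x', gradient V x - gradient V x'⟫)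
    (x : EE d) (i : Fin d) :
    c ≤ gradient (fun y => gradient V y i) x i := by
  rw [lap_term hV]
  set e : EE d := EuclideanSpace.single i 1 with he
  have hG : DifferentiableAt ℝ (gradient V) x :=
    (grad_contDiff hV).differentiable (by norm_num) x
  have hl : HasDerivAt (fun s : ℝ => x + s • e) e 0 := by
    simpa using ((hasDerivAt_id (0 : ℝ)).smul_const e).const_add x
  have hG' : HasFDerivAt (gradient V) (fderiv ℝ (gradient V) x) (x + (0 : ℝ) • e) := by
    simpa using hG.hasFDerivAt
  have h1 : HasDerivAt (fun s : ℝ => gradient V (x + s • e) i)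
      ((fderiv ℝ (gradient V) x e) i) 0 := by
    have h0 : HasDerivAt (fun s : ℝ => gradient V (x + s • e))
        (fderiv ℝ (gradient V) x e) 0 := by
      have h00 := HasFDerivAt.comp_hasDerivAt (f := fun s : ℝ => x + s • e) (0 : ℝ) hG' hl
      exact h00
    exact (EuclideanSpace.proj i : EE d →L[ℝ] ℝ).hasFDerivAt.comp_hasDerivAt (0 : ℝ) h0
  have h2 : HasDerivAt (fun s : ℝ => gradient V (x + s • e) i - s * c)
      ((fderiv ℝ (gradient V) x e) i - c) 0 := by
    exact (h1.sub ((hasDerivAt_id' (0 : ℝ)).mul_const c)).congr_deriv (by simp)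
  have hm : Monotone (fun s : ℝ => gradient V (x + s • e) i - s * c) := by
    intro s r hsr
    rcases hsr.eq_or_lt with rfl | hlt
    · exact le_rfl
    have h := hmono (x + r • e) (x + s • e)
    have h3 : (x + r • e) - (x + s • e) = (r - s) • e := by
      rw [sub_smul]; abel
    rw [h3, norm_smul, he, PiLp.norm_single, inner_smul_left,
      EuclideanSpace.inner_single_left] at h
    simp only [← he, norm_one, mul_one, Real.norm_eq_abs, sq_abs, map_one, one_mul,
      PiLp.sub_apply, conj_trivial] at h
    have h4 : 0 < r - s := sub_pos.2 hlt
    have h5 : (r - s) * (c * (r - s)) ≤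
      (r - s) * (gradient V (x + r • e) i - gradient V (x + s • e) i) := by
      nlinarith
    have h6 := le_of_mul_le_mul_left h5 h4
    show _ ≤ _
    dsimp only
    linarith
  have := h2.nonneg_of_monotone hm
  linarith

lemma lap_upper {d : ℕ} {V : EE d → ℝ} (hV : ContDiff ℝ 2 V) {L : ℝ} (hL : 0 < L)
    (hlip : ∀ x x', ‖gradient V x - gradient V x'‖ ≤ L * ‖x - x'‖) (x : EE d) :
    |laplacian V x| ≤ d * L := by
  unfold laplacian
  refine (Finset.abs_sum_le_sum_abs _ _).trans ?_
  refine (Finset.sum_le_sum fun i _ => lap_term_abs hV hL hlip x i).trans ?_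
  simp

lemma lap_lower {d : ℕ} {V : EE d → ℝ} (hV : ContDiff ℝ 2 V) {c : ℝ}
    (hmono : ∀ x x', c * ‖x - x'‖ ^ 2 ≤ ⟪x - x', gradient V x - gradient V x'⟫)
    (x : EE d) : d * c ≤ laplacian V x := by
  unfold laplacian
  refine le_trans ?_ (Finset.sum_le_sum fun i _ => lap_term_lower hV hmono x i)
  simp

lemma c_le_L {d : ℕ} (hd : 1 ≤ d) {V : EE d → ℝ} (hV : ContDiff ℝ 2 V) {L c : ℝ} (hL : 0 < L)
    (hlip : ∀ x x', ‖gradient V x - gradient V x'‖ ≤ L * ‖x - x'‖)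
    (hmono : ∀ x x', c * ‖x - x'‖ ^ 2 ≤ ⟪x - x', gradient V x - gradient V x'⟫) : c ≤ L :=
  (lap_term_lower hV hmono 0 ⟨0, hd⟩).trans
    ((le_abs_self _).trans (lap_term_abs hV hL hlip 0 ⟨0, hd⟩))

lemma grad_sq_le {d : ℕ} (hd : 1 ≤ d) {V : EE d → ℝ} (hV : ContDiff ℝ 2 V) {L c ε a b : ℝ}
    (hL : 0 < L) (hc : 0 < c)
    (hlip : ∀ x x', ‖gradient V x - gradient V x'‖ ≤ L * ‖x - x'‖)
    (hmono : ∀ x x', c * ‖x - x'‖ ^ 2 ≤ ⟪x - x', gradient V x - gradient V x'⟫)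
    (hε : 1 / (2 * c) < ε) (ha : a = c - 1 / (2 * ε)) (hb : b = ε * ‖gradient V 0‖ ^ 2 / 2)
    (x : EE d) : 0 ≤ b / a ∧ ‖gradient V x‖ ^ 2 ≤ 2 * L ^ 2 * (‖x‖ ^ 2 + b / a) := by
  have hcL := c_le_L hd hV hL hlip hmono
  have hε0 : 0 < ε := lt_trans (by positivity) hε
  have h1 : 1 < 2 * c * ε := by
    rw [div_lt_iff₀ (by positivity)] at hε; linarith
  have ha' : a * (2 * ε) = 2 * c * ε - 1 := by
    rw [ha]; field_simp
  have ha0 : 0 < a := by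
    by_contra hh
    nlinarith
  have hb0 : 0 ≤ b := by rw [hb]; positivity
  refine ⟨by positivity, ?_⟩
  have hg0 : ‖gradient V 0‖ ^ 2 ≤ L ^ 2 * (b / a) := by
    rw [← mul_div_assoc, le_div_iff₀ ha0, hb]
    have h2 : a ≤ L ^ 2 * ε / 2 := by
      have : a * (2 * ε) ≤ (L ^ 2 * ε / 2) * (2 * ε) := by
        rw [ha']
        nlinarith [sq_nonneg (L * ε - 1), mul_le_mul_of_nonneg_right hcL hε0.le]
      exact le_of_mul_le_mul_right this (by positivity)
    nlinarith [mul_le_mul_of_nonneg_left h2 (sq_nonneg ‖gradient V 0‖)]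
  have h3 := hlip x 0
  rw [sub_zero] at h3
  have h4 : ‖gradient V x‖ ≤ L * ‖x‖ + ‖gradient V 0‖ := by
    have := norm_le_norm_sub_add (gradient V x) (gradient V 0)
    linarith
  have h5 : ‖gradient V x‖ ^ 2 ≤ (L * ‖x‖ + ‖gradient V 0‖) ^ 2 :=
    pow_le_pow_left₀ (norm_nonneg _) h4 2
  nlinarith [sq_nonneg (L * ‖x‖ - ‖gradient V 0‖)]

lemma V_lower {d : ℕ} {V : EE d → ℝ} (hV : ContDiff ℝ 2 V) {c : ℝ}
    (hmono : ∀ x x', c * ‖x - x'‖ ^ 2 ≤ ⟪x - x', gradient V x - gradient V x'⟫)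
    (x : EE d) : V 0 + ⟪gradient V 0, x⟫ + c / 2 * ‖x‖ ^ 2 ≤ V x := by
  have hd : ∀ s : ℝ, HasDerivAt
      (fun s : ℝ => V (s • x) - s * ⟪gradient V 0, x⟫ - s ^ 2 * (c / 2 * ‖x‖ ^ 2))
      (⟪gradient V (s • x), x⟫ - ⟪gradient V 0, x⟫ - 2 * s * (c / 2 * ‖x‖ ^ 2)) s := by
    intro s
    have hl : HasDerivAt (fun s : ℝ => s • x) x s := by
      simpa using (hasDerivAt_id s).smul_const x
    have h1 : HasDerivAt (fun s : ℝ => V (s • x)) (⟪gradient V (s • x), x⟫) s := by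
      rw [gradient, InnerProductSpace.toDual_symm_apply]
      exact (hV.differentiable (by norm_num) (s • x)).hasFDerivAt.comp_hasDerivAt s hl
    have h2 := (hasDerivAt_id' s).mul_const (⟪gradient V 0, x⟫)
    have h3 := (hasDerivAt_pow 2 s).mul_const (c / 2 * ‖x‖ ^ 2)
    exact ((h1.sub h2).sub h3).congr_deriv (by simp)
  have hm := monotoneOn_of_deriv_nonneg (convex_Icc (0 : ℝ) 1)
    (fun s _ => (hd s).continuousAt.continuousWithinAt)
    (fun s _ => (hd s).differentiableAt.differentiableWithinAt)
    (by
      intro s hs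
      rw [interior_Icc] at hs
      rw [(hd s).deriv]
      have h := hmono (s • x) 0
      rw [sub_zero, norm_smul, inner_smul_left, inner_sub_right,
        real_inner_comm, real_inner_comm (gradient V 0)] at h
      simp only [Real.norm_eq_abs, mul_pow, sq_abs, conj_trivial] at h
      have h5 : s * (s * (c * ‖x‖ ^ 2)) ≤
        s * (⟪gradient V (s • x), x⟫ - ⟪gradient V 0, x⟫) := by
        linarith
      have h6 := le_of_mul_le_mul_left h5 hs.1
      linarith)
  have := hm (Set.left_mem_Icc.2 zero_le_one) (Set.right_mem_Icc.2 zero_le_one) zero_le_one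
  simp only [zero_smul, one_smul] at this
  linarith

lemma gauss_int {d : ℕ} {b : ℝ} (hb : 0 < b) :
    Integrable (fun x : EE d => Real.exp (-b * ‖x‖ ^ 2)) := by
  have h := (GaussianFourier.integrable_cexp_neg_mul_sq_norm_add (V := EE d) (b := (b : ℂ))
    (by simpa using hb) 0 0).norm
  refine h.congr (Filter.Eventually.of_forall fun x => ?_)
  simp only [Complex.norm_exp]
  congr 1
  simp [← Complex.ofReal_pow]

lemma exp_int {d : ℕ} {V : EE d → ℝ} (hV : ContDiff ℝ 2 V) {c : ℝ} (hc : 0 < c)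
    (hmono : ∀ x x', c * ‖x - x'‖ ^ 2 ≤ ⟪x - x', gradient V x - gradient V x'⟫) :
    Integrable (fun x => Real.exp (-V x + c / 4 * ‖x‖ ^ 2)) := by
  have hVc := hV.continuous
  refine Integrable.mono' ((gauss_int (d := d) (b := c / 8) (by positivity)).const_mul
    (Real.exp (-V 0 + 2 / c * ‖gradient V 0‖ ^ 2))) (by fun_prop)
    (Filter.Eventually.of_forall fun x => ?_)
  rw [Real.norm_eq_abs, Real.abs_exp, ← Real.exp_add, Real.exp_le_exp]
  have h1 := V_lower hV hmono x
  have h2 := neg_le_of_abs_le (abs_real_inner_le_norm (gradient V 0) x)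
  have h3 : ‖gradient V 0‖ * ‖x‖ ≤ 2 / c * ‖gradient V 0‖ ^ 2 + c / 8 * ‖x‖ ^ 2 := by
    have : 2 / c * ‖gradient V 0‖ ^ 2 + c / 8 * ‖x‖ ^ 2 - ‖gradient V 0‖ * ‖x‖
      = 2 / c * (‖gradient V 0‖ - c / 4 * ‖x‖) ^ 2 := by
      field_simp; ring
    have : 0 ≤ 2 / c * (‖gradient V 0‖ - c / 4 * ‖x‖) ^ 2 := by positivity
    linarith
  linarith

lemma mom_int {d : ℕ} {V : EE d → ℝ} (hV : ContDiff ℝ 2 V) {c : ℝ} (hc : 0 < c)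
    (hmono : ∀ x x', c * ‖x - x'‖ ^ 2 ≤ ⟪x - x', gradient V x - gradient V x'⟫)
    {p m : EE d → ℝ} {Z : ℝ} (hZ : 0 < Z) (hp : ∀ x, p x = Real.exp (-V x) / Z)
    (hm0 : ∀ x, 0 < m x) (hmc : Continuous m) (hmi : Integrable m)
    (hent : Integrable (fun x => m x * Real.log (m x / p x))) :
    Integrable (fun x => ‖x‖ ^ 2 * m x) := by
  have h1 := (exp_int hV hc hmono).div_const Z
  have h2 := ((hent.sub hmi).add h1).const_mul (4 / c)
  refine Integrable.mono' h2 (by fun_prop) (Filter.Eventually.of_forall fun x => ?_)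
  have hpx : 0 < p x := by rw [hp]; positivity
  have hmx := hm0 x
  rw [Real.norm_eq_abs, abs_of_nonneg (by positivity)]
  simp only [Pi.add_apply, Pi.sub_apply]
  have h3 := Real.add_one_le_exp (c / 4 * ‖x‖ ^ 2 - Real.log (m x / p x))
  rw [Real.exp_sub, Real.exp_log (by positivity)] at h3
  have h4 := mul_le_mul_of_nonneg_left h3 hmx.le
  have h5 : m x * (Real.exp (c / 4 * ‖x‖ ^ 2) / (m x / p x))
      = Real.exp (-V x + c / 4 * ‖x‖ ^ 2) / Z := by
    rw [Real.exp_add, hp]; field_simp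
  rw [h5] at h4
  have h6 : ‖x‖ ^ 2 * m x = 4 / c * (m x * (c / 4 * ‖x‖ ^ 2)) := by field_simp
  rw [h6]
  apply mul_le_mul_of_nonneg_left _ (by positivity)
  linarith

/-- Proposition 1 (Tempered W): decay of the Kullback–Leibler divergence along the
tempered Wasserstein flow `∂_t μ_t = ∇·(μ_t ∇log(μ_t/π_t))` with
`π_t ∝ π^{λ(t)} μ₀^{1-λ(t)}`, stated with the energy–dissipation identity, the
uniform second-moment bound and the log-Sobolev inequality as hypotheses. -/
theorem tempered_wasserstein_KL_decay
    {d : ℕ} (hd : 1 ≤ d)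
    (Vπ Vμ₀ : EuclideanSpace ℝ (Fin d) → ℝ)
    (hVπ : ContDiff ℝ 2 Vπ) (hVμ₀ : ContDiff ℝ 2 Vμ₀)
    (Lπ cπ Lμ₀ cμ₀ : ℝ) (hLπ : 0 < Lπ) (hcπ : 0 < cπ) (hLμ₀ : 0 < Lμ₀) (hcμ₀ : 0 < cμ₀)
    (hVπ_lip : ∀ x x', ‖gradient Vπ x - gradient Vπ x'‖ ≤ Lπ * ‖x - x'‖)
    (hVπ_mono : ∀ x x', cπ * ‖x - x'‖ ^ 2 ≤ ⟪x - x', gradient Vπ x - gradient Vπ x'⟫)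
    (hVμ₀_lip : ∀ x x', ‖gradient Vμ₀ x - gradient Vμ₀ x'‖ ≤ Lμ₀ * ‖x - x'‖)
    (hVμ₀_mono : ∀ x x', cμ₀ * ‖x - x'‖ ^ 2 ≤ ⟪x - x', gradient Vμ₀ x - gradient Vμ₀ x'⟫)
    (π : EuclideanSpace ℝ (Fin d) → ℝ)
    (hexp_int : Integrable (fun x => Real.exp (-Vπ x)))
    (hπ : ∀ x, π x = Real.exp (-Vπ x) / ∫ y, Real.exp (-Vπ y))
    (επ εμ₀ aπ bπ aμ₀ bμ₀ : ℝ)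
    (hεπ : 1 / (2 * cπ) < επ) (hεμ₀ : 1 / (2 * cμ₀) < εμ₀)
    (haπ : aπ = cπ - 1 / (2 * επ)) (hbπ : bπ = επ * ‖gradient Vπ 0‖ ^ 2 / 2)
    (haμ₀ : aμ₀ = cμ₀ - 1 / (2 * εμ₀)) (hbμ₀ : bμ₀ = εμ₀ * ‖gradient Vμ₀ 0‖ ^ 2 / 2)
    (lam : ℝ → ℝ)
    (hlam : ∀ s, 0 ≤ s → lam s ∈ Set.Icc (0 : ℝ) 1)
    (hlam_mono : MonotoneOn lam (Set.Ici (0 : ℝ)))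
    (S : ℝ) (hS : 0 < S)
    (μ : ℝ → EuclideanSpace ℝ (Fin d) → ℝ)
    (hμ_pos : ∀ t, 0 ≤ t → ∀ x, 0 < μ t x)
    (hμ_smooth : ∀ t, 0 ≤ t → ContDiff ℝ 1 (μ t))
    (hμ_int : ∀ t, 0 ≤ t → Integrable (μ t))
    (hμ_prob : ∀ t, 0 ≤ t → (∫ x, μ t x) = 1)
    (hμ_mom : ∀ t, 0 ≤ t → (∫ x, ‖x‖ ^ 2 * μ t x) ≤ S)
    (F : ℝ → ℝ)
    (hF : ∀ t, F t = ∫ x, μ t x * Real.log (μ t x / π x))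
    (hF_int : ∀ t, 0 ≤ t → Integrable (fun x => μ t x * Real.log (μ t x / π x)))
    (hEDI : ∀ t, 0 ≤ t →
      HasDerivAt F
        (-(∫ x, μ t x * ‖gradient (fun y => Real.log (μ t y / π y)) x‖ ^ 2) +
          (1 - lam t) *
            ∫ x, μ t x *
              (laplacian Vμ₀ x - laplacian Vπ x -
                ⟪gradient Vπ x, gradient Vμ₀ x - gradient Vπ x⟫)) t)
    (hLSI : ∀ t, 0 ≤ t →
      F t ≤ (1 / (2 * cπ)) *
        ∫ x, μ t x * ‖gradient (fun y => Real.log (μ t y / π y)) x‖ ^ 2) :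
    ∀ t, 0 ≤ t →
      F t ≤ Real.exp (-(2 * cπ * t)) * F 0 +
        ((d : ℝ) * (Lμ₀ - cπ) +
            4 * max (Lπ ^ 2) (Lμ₀ ^ 2) * (S + max (bπ / aπ) (bμ₀ / aμ₀))) *
          ∫ s in (0 : ℝ)..t, Real.exp (-(2 * cπ * (t - s))) * (1 - lam s) := by
  have hZ : 0 < ∫ y, Real.exp (-Vπ y) := integral_exp_pos hexp_int
  set M : ℝ := max (Lπ ^ 2) (Lμ₀ ^ 2) with hM
  set B : ℝ := max (bπ / aπ) (bμ₀ / aμ₀) with hB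
  set A : ℝ := (d : ℝ) * (Lμ₀ - cπ) + 4 * M * (S + B) with hA
  have hM0 : 0 ≤ M := le_trans (sq_nonneg _) (le_max_left _ _)
  have hB0 : 0 ≤ B := le_trans
    (grad_sq_le hd hVπ hLπ hcπ hVπ_lip hVπ_mono hεπ haπ hbπ 0).1 (le_max_left _ _)
  have g1 : ∀ x, ‖gradient Vπ x‖ ^ 2 ≤ 2 * M * (‖x‖ ^ 2 + B) := fun x => by
    have h := (grad_sq_le hd hVπ hLπ hcπ hVπ_lip hVπ_mono hεπ haπ hbπ x)
    refine h.2.trans ?_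
    have h1 : Lπ ^ 2 ≤ M := le_max_left _ _
    have h2 : bπ / aπ ≤ B := le_max_left _ _
    have h0 := h.1
    gcongr
  have g2 : ∀ x, ‖gradient Vμ₀ x‖ ^ 2 ≤ 2 * M * (‖x‖ ^ 2 + B) := fun x => by
    have h := (grad_sq_le hd hVμ₀ hLμ₀ hcμ₀ hVμ₀_lip hVμ₀_mono hεμ₀ haμ₀ hbμ₀ x)
    refine h.2.trans ?_
    have h1 : Lμ₀ ^ 2 ≤ M := le_max_right _ _
    have h2 : bμ₀ / aμ₀ ≤ B := le_max_right _ _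
    have h0 := h.1
    gcongr
  have g3 : ∀ x, |⟪gradient Vπ x, gradient Vμ₀ x - gradient Vπ x⟫| ≤ 4 * M * (‖x‖ ^ 2 + B) := by
    intro x
    have h1 := abs_le.1 (abs_real_inner_le_norm (gradient Vπ x) (gradient Vμ₀ x))
    have h2 := g1 x
    have h3 := g2 x
    rw [inner_sub_right, real_inner_self_eq_norm_sq, abs_le]
    constructor <;> nlinarith [sq_nonneg (‖gradient Vπ x‖ - ‖gradient Vμ₀ x‖),
      sq_nonneg ‖gradient Vπ x‖, sq_nonneg ‖gradient Vμ₀ x‖]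
  have cπc : Continuous (gradient Vπ) := (grad_contDiff hVπ).continuous
  have cμc : Continuous (gradient Vμ₀) := (grad_contDiff hVμ₀).continuous
  have lπc := lap_cont hVπ
  have lμc := lap_cont hVμ₀
  -- bound on the integral term
  have key : ∀ t, 0 ≤ t → (∫ x, μ t x *
              (laplacian Vμ₀ x - laplacian Vπ x -
                ⟪gradient Vπ x, gradient Vμ₀ x - gradient Vπ x⟫)) ≤ A := by
    intro t ht
    have hmc : Continuous (μ t) := (hμ_smooth t ht).continuous
    have hmom := mom_int hVπ hcπ hVπ_mono hZ hπ (hμ_pos t ht) hmc (hμ_int t ht) (hF_int t ht)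
    have hi : ∀ k : ℝ, Integrable (fun x => μ t x * k + 4 * M * (‖x‖ ^ 2 * μ t x)) := fun k =>
      ((hμ_int t ht).mul_const k).add (hmom.const_mul (4 * M))
    have hint : Integrable (fun x => μ t x *
              (laplacian Vμ₀ x - laplacian Vπ x -
                ⟪gradient Vπ x, gradient Vμ₀ x - gradient Vπ x⟫)) := by
      refine Integrable.mono' (hi (d * Lμ₀ + d * Lπ + 4 * M * B))
        (Continuous.aestronglyMeasurable (by fun_prop)) (Filter.Eventually.of_forall fun x => ?_)
      have hx := hμ_pos t ht x
      rw [Real.norm_eq_abs, abs_mul, abs_of_pos hx]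
      have h1 := abs_le.1 (lap_upper hVμ₀ hLμ₀ hVμ₀_lip x)
      have h2 := abs_le.1 (lap_upper hVπ hLπ hVπ_lip x)
      have h3 := abs_le.1 (g3 x)
      have h4 : |laplacian Vμ₀ x - laplacian Vπ x -
                ⟪gradient Vπ x, gradient Vμ₀ x - gradient Vπ x⟫| ≤
          d * Lμ₀ + d * Lπ + 4 * M * (‖x‖ ^ 2 + B) := by
        rw [abs_le]; constructor <;> linarith
      have := mul_le_mul_of_nonneg_left h4 hx.le
      linarith
    have h1 := integral_mono hint (hi (d * (Lμ₀ - cπ) + 4 * M * B)) (fun x => by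
      have hx := hμ_pos t ht x
      have h1 := abs_le.1 (lap_upper hVμ₀ hLμ₀ hVμ₀_lip x)
      have h2 := lap_lower hVπ hVπ_mono x
      have h3 := abs_le.1 (g3 x)
      have h4 : laplacian Vμ₀ x - laplacian Vπ x -
                ⟪gradient Vπ x, gradient Vμ₀ x - gradient Vπ x⟫ ≤
          d * (Lμ₀ - cπ) + 4 * M * (‖x‖ ^ 2 + B) := by linarith
      have := mul_le_mul_of_nonneg_left h4 hx.le
      dsimp only
      linarith)
    rw [integral_add ((hμ_int t ht).mul_const _) (hmom.const_mul (4 * M)),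
      integral_mul_const, integral_const_mul, hμ_prob t ht] at h1
    have h2 := mul_le_mul_of_nonneg_left (hμ_mom t ht) (show 0 ≤ 4 * M by positivity)
    rw [hA]
    linarith
  intro t ht
  have hcont : ContinuousOn (fun s => Real.exp (2 * cπ * s) * F s) (Set.Icc 0 t) := by
    intro s hs
    have := (hEDI s hs.1).continuousAt
    exact (ContinuousAt.mul (by fun_prop) this).continuousWithinAt
  have hlamint : IntegrableOn lam (Set.Icc 0 t) :=
    (hlam_mono.mono Set.Icc_subset_Ici_self).integrableOn_isCompact isCompact_Icc
  have hφ : IntegrableOn (fun s => Real.exp (2 * cπ * s) * (A * (1 - lam s))) (Set.Icc 0 t) := by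
    have h1 : IntegrableOn (fun s => A * (1 - lam s)) (Set.Icc 0 t) :=
      ((integrableOn_const (by simp)).sub hlamint).const_mul A
    exact h1.continuousOn_mul (by fun_prop) isCompact_Icc
  have hder : ∀ s ∈ Set.Ioo 0 t, HasDerivAt (fun s => Real.exp (2 * cπ * s) * F s)
      (Real.exp (2 * cπ * s) * (2 * cπ) * F s + Real.exp (2 * cπ * s) * (-(∫ x, μ s x * ‖gradient (fun y => Real.log (μ s y / π y)) x‖ ^ 2) +
          (1 - lam s) *
            ∫ x, μ s x *
              (laplacian Vμ₀ x - laplacian Vπ x -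
                ⟪gradient Vπ x, gradient Vμ₀ x - gradient Vπ x⟫))) s := by
    intro s hs
    have h1 : HasDerivAt (fun s => Real.exp (2 * cπ * s)) (Real.exp (2 * cπ * s) * (2 * cπ)) s := by
      simpa using ((hasDerivAt_id s).const_mul (2 * cπ)).exp
    exact h1.mul (hEDI s hs.1.le)
  have hfin := intervalIntegral.sub_le_integral_of_hasDeriv_right_of_le ht hcont
    (fun s hs => (hder s hs).hasDerivWithinAt) hφ (by
      intro s hs
      have hk := key s hs.1.le
      have hl := hLSI s hs.1.le
      have hlm := (hlam s hs.1.le).2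
      have h1 := mul_le_mul_of_nonneg_left hk (sub_nonneg.2 hlm)
      have h2 := mul_le_mul_of_nonneg_left hl (show 0 ≤ 2 * cπ by positivity)
      rw [← mul_assoc, mul_one_div_cancel (by positivity), one_mul] at h2
      rw [mul_assoc, ← mul_add]
      apply mul_le_mul_of_nonneg_left _ (Real.exp_pos _).le
      linarith)
  simp only [mul_zero, Real.exp_zero, one_mul] at hfin
  have he : Real.exp (-(2 * cπ * t)) * Real.exp (2 * cπ * t) = 1 := by
    rw [← Real.exp_add]; simp
  have hint : Real.exp (-(2 * cπ * t)) *
      (∫ s in (0 : ℝ)..t, Real.exp (2 * cπ * s) * (A * (1 - lam s)))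
      = A * ∫ s in (0 : ℝ)..t, Real.exp (-(2 * cπ * (t - s))) * (1 - lam s) := by
    rw [← intervalIntegral.integral_const_mul, ← intervalIntegral.integral_const_mul]
    congr 1
    funext s
    have : -(2 * cπ * (t - s)) = -(2 * cπ * t) + 2 * cπ * s := by ring
    rw [this, Real.exp_add]
    ring
  have h1 := mul_le_mul_of_nonneg_left hfin (Real.exp_pos (-(2 * cπ * t))).le
  rw [hint, mul_sub, ← mul_assoc, he, one_mul] at h1
  linarith
end

section
/- Let d ≥ 1 and let π be a strictly positive probability density on ℝ^d such that log π is continuously differentiable and ∇log π is L-Lipschitz (L > 0). Assume π satisfies a log-Sobolev inequality with constant C > 0, i.e. for every strictly positive continuously differentiable probability density ρ on ℝ^d (with all integrals finite), ∫ ρ log(ρ/π) ≤ (C/2)∫ ρ(x)‖∇log(ρ(x)/π(x))‖² dx, and assume L·C ≥ 1. Let 0 < γ ≤ 1/(4CL²). Starting from a strictly positive probability density μ₀ with ∫μ₀ log(μ₀/π) < ∞, define recursively μ_{n+1/2}(x) = (4πγ)^{−d/2} ∫ exp(−‖x − y − γ∇log π(y)‖²/(4γ)) μ_n(y) dy (one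 unadjusted-Langevin step) and μ_{n+1} = μ_{n+1/2}^{exp(−γ)} π^{1−exp(−γ)} / Z_{n+1} with Z_{n+1} = ∫ μ_{n+1/2}(y)^{exp(−γ)} π(y)^{1−exp(−γ)} dy (one exact Fisher–Rao / mirror-descent step). Then for every n ≥ 0: ∫ μ_n log(μ_n/π) ≤ exp(−nγ/C)·∫ μ₀ log(μ₀/π) + 8γ d L² C. -/
set_option linter.unusedSectionVars false
open MeasureTheory

noncomputable def smcK {d : ℕ} (t : ℝ) (u : EuclideanSpace ℝ (Fin d)) : ℝ :=
  (4 * Real.pi * t) ^ (-(d : ℝ) / 2) * Real.exp (-‖u‖ ^ 2 / (4 * t))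

theorem smcK_pos {d : ℕ} {t : ℝ} (ht : 0 < t) (u : EuclideanSpace ℝ (Fin d)) : 0 < smcK t u := by
  have := Real.pi_pos
  unfold smcK; positivity

theorem smcK_cont {d : ℕ} (t : ℝ) : Continuous (smcK t : EuclideanSpace ℝ (Fin d) → ℝ) := by
  unfold smcK; fun_prop

theorem smcK_int {d : ℕ} {t : ℝ} (ht : 0 < t) :
    Integrable (smcK t : EuclideanSpace ℝ (Fin d) → ℝ) ∧
      ∫ u : EuclideanSpace ℝ (Fin d), smcK t u = 1 := by
  have hpi := Real.pi_pos
  have h := GaussianFourier.integral_rexp_neg_mul_sq_norm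
    (V := EuclideanSpace ℝ (Fin d)) (b := 1 / (4 * t)) (by positivity)
  have h1 : ∫ u : EuclideanSpace ℝ (Fin d), smcK t u = 1 := by
    unfold smcK
    rw [integral_const_mul]
    have : (fun v : EuclideanSpace ℝ (Fin d) => Real.exp (-‖v‖ ^ 2 / (4 * t))) =
        fun v => Real.exp (-(1 / (4 * t)) * ‖v‖ ^ 2) := by
      ext v; congr 1; ring
    rw [this, h]
    have h2 : Real.pi / (1 / (4 * t)) = 4 * Real.pi * t := by field_simp
    rw [h2, finrank_euclideanSpace_fin, ← Real.rpow_add (by positivity)]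
    have : -(d : ℝ) / 2 + d / 2 = 0 := by ring
    rw [this, Real.rpow_zero]
  refine ⟨?_, h1⟩
  by_contra hc
  rw [integral_undef hc] at h1
  norm_num at h1

theorem smcK_lint {d : ℕ} {t : ℝ} (ht : 0 < t) :
    ∫⁻ u : EuclideanSpace ℝ (Fin d), ENNReal.ofReal (smcK t u) = 1 := by
  rw [← ofReal_integral_eq_lintegral_ofReal (smcK_int ht).1
    (Filter.Eventually.of_forall fun u => (smcK_pos ht u).le), (smcK_int ht).2]
  simp

/-- standard Gaussian measure -/
noncomputable def smcG (d : ℕ) : Measure (EuclideanSpace ℝ (Fin d)) :=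
  volume.withDensity (fun z => ENNReal.ofReal (smcK (1 / 2) z))

instance smcG_prob (d : ℕ) : IsProbabilityMeasure (smcG d) := by
  constructor
  rw [smcG, withDensity_apply _ MeasurableSet.univ, Measure.restrict_univ]
  exact smcK_lint (by norm_num)

theorem smc_meas_K {d : ℕ} (t : ℝ) :
    Measurable (fun z : EuclideanSpace ℝ (Fin d) => ENNReal.ofReal (smcK t z)) :=
  ENNReal.measurable_ofReal.comp (smcK_cont t).measurable

theorem smc_lintegral_G {d : ℕ} {F : EuclideanSpace ℝ (Fin d) → ENNReal} (hF : Measurable F)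
    {t : ℝ} (ht : 0 < t) (m : EuclideanSpace ℝ (Fin d)) :
    ∫⁻ x, F x * ENNReal.ofReal (smcK t (x - m)) = ∫⁻ z, F (m + √(2 * t) • z) ∂(smcG d) := by
  have hpi := Real.pi_pos
  have hs : 0 < √(2 * t) := Real.sqrt_pos.mpr (by positivity)
  rw [smcG, lintegral_withDensity_eq_lintegral_mul _ (smc_meas_K _)
    (by fun_prop)]
  have h1 : ∫⁻ x, F x * ENNReal.ofReal (smcK t (x - m)) =
      ∫⁻ x, F (m + x) * ENNReal.ofReal (smcK t x) := by
    rw [← lintegral_add_left_eq_self _ m]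
    simp
  rw [h1]
  have hm := Measure.map_addHaar_smul (volume : Measure (EuclideanSpace ℝ (Fin d))) hs.ne'
  have h2 : ∫⁻ x, F (m + x) * ENNReal.ofReal (smcK t x) ∂
      (Measure.map (fun x : EuclideanSpace ℝ (Fin d) => √(2 * t) • x) volume) =
      ∫⁻ z, F (m + √(2 * t) • z) * ENNReal.ofReal (smcK t (√(2 * t) • z)) := by
    rw [lintegral_map]
    · have := smc_meas_K (d := d) t
      fun_prop
    · fun_prop
  rw [show (fun x : EuclideanSpace ℝ (Fin d) => √(2 * t) • x) = (√(2 * t) • ·) from rfl,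
    hm, lintegral_smul_measure] at h2
  have hK : ∀ z : EuclideanSpace ℝ (Fin d),
      smcK t (√(2 * t) • z) = |(√(2 * t) ^ d)⁻¹| * smcK (1 / 2) z := by
    intro z
    unfold smcK
    rw [norm_smul, mul_pow, Real.norm_of_nonneg hs.le, Real.sq_sqrt (by positivity),
      abs_of_pos (by positivity), ← mul_assoc]
    congr 1
    · rw [show 4 * Real.pi * t = (4 * Real.pi * (1 / 2)) * (2 * t) by ring,
        Real.mul_rpow (by positivity) (by positivity), mul_comm]
      congr 1
      rw [Real.sqrt_eq_rpow, ← Real.rpow_natCast, ← Real.rpow_mul (by positivity),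
        ← Real.rpow_neg (by positivity)]
      congr 1; ring
    · congr 1; field_simp
  simp only [finrank_euclideanSpace_fin] at h2
  have hc : ENNReal.ofReal |(√(2 * t) ^ d)⁻¹| ≠ 0 := by
    simp only [ne_eq, ENNReal.ofReal_eq_zero, not_le]; positivity
  have hc' : ENNReal.ofReal |(√(2 * t) ^ d)⁻¹| ≠ ⊤ := ENNReal.ofReal_ne_top
  have h3 : ∫⁻ z, F (m + √(2 * t) • z) * ENNReal.ofReal (smcK t (√(2 * t) • z)) =
      ENNReal.ofReal |(√(2 * t) ^ d)⁻¹| *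
      ∫⁻ z, ENNReal.ofReal (smcK (1 / 2) z) * F (m + √(2 * t) • z) := by
    rw [← lintegral_const_mul]
    · congr 1; ext z
      rw [hK, ENNReal.ofReal_mul (abs_nonneg _)]; ring
    · have := smc_meas_K (d := d) (1 / 2)
      fun_prop
  rw [h3, smul_eq_mul] at h2
  exact (ENNReal.mul_right_inj hc hc').mp h2

theorem smc_integral_G {d : ℕ} (F : EuclideanSpace ℝ (Fin d) → ℝ) :
    ∫ z, F z ∂(smcG d) = ∫ z, smcK (1 / 2) z * F z := by
  rw [smcG, integral_withDensity_eq_integral_toReal_smul (smc_meas_K _) (by simp)]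
  simp_rw [ENNReal.toReal_ofReal (smcK_pos (by norm_num : (0 : ℝ) < 1 / 2) _).le, smul_eq_mul]

theorem smc_integrable_G {d : ℕ} (F : EuclideanSpace ℝ (Fin d) → ℝ) :
    Integrable F (smcG d) ↔ Integrable (fun z => smcK (1 / 2) z * F z) := by
  rw [smcG, integrable_withDensity_iff_integrable_smul' (smc_meas_K _) (by simp)]
  simp_rw [ENNReal.toReal_ofReal (smcK_pos (by norm_num : (0 : ℝ) < 1 / 2) _).le, smul_eq_mul]

theorem smcG_sq_aux {d : ℕ} {h : ℝ} (h0 : 0 < h) (h1 : h < 1 / 2) :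
    Integrable (fun z => ‖z‖ ^ 2) (smcG d) ∧
    h * ∫ z, ‖z‖ ^ 2 ∂(smcG d) ≤ (1 - 2 * h) ^ (-(d : ℝ) / 2) - 1 := by
  have hpi := Real.pi_pos
  have hk : (0 : ℝ) < 1 - 2 * h := by linarith
  set s : ℝ := (1 / 2) / (1 - 2 * h) with hs
  have hspos : 0 < s := by positivity
  have e : ∀ z : EuclideanSpace ℝ (Fin d),
      smcK (1 / 2) z * Real.exp (h * ‖z‖ ^ 2) = (1 - 2 * h) ^ (-(d : ℝ) / 2) * smcK s z := by
    intro z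
    unfold smcK
    rw [mul_assoc, ← Real.exp_add, ← mul_assoc, ← Real.mul_rpow (by positivity) (by positivity)]
    congr 2
    · rw [hs]; field_simp
    · rw [hs]; field_simp; ring
  have i1 : Integrable (fun z : EuclideanSpace ℝ (Fin d) => Real.exp (h * ‖z‖ ^ 2)) (smcG d) := by
    rw [smc_integrable_G]; simp_rw [e]; exact (smcK_int hspos).1.const_mul _
  have v1 : ∫ z, Real.exp (h * ‖z‖ ^ 2) ∂(smcG d) = (1 - 2 * h) ^ (-(d : ℝ) / 2) := by
    rw [smc_integral_G]; simp_rw [e]; rw [integral_const_mul, (smcK_int hspos).2, mul_one]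
  have i2 : Integrable (fun z : EuclideanSpace ℝ (Fin d) => ‖z‖ ^ 2) (smcG d) := by
    refine (i1.const_mul (1 / h)).mono' (by fun_prop) (Filter.Eventually.of_forall fun z => ?_)
    rw [Real.norm_of_nonneg (by positivity), div_mul_eq_mul_div, le_div_iff₀ h0, one_mul]
    nlinarith [Real.add_one_le_exp (h * ‖z‖ ^ 2)]
  refine ⟨i2, ?_⟩
  have := integral_mono ((i2.const_mul h).add (integrable_const (1 : ℝ))) i1
    (fun z => by simpa using Real.add_one_le_exp (h * ‖z‖ ^ 2))
  simp only [Pi.add_apply] at this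
  rw [integral_add (i2.const_mul h) (integrable_const _), integral_const_mul, v1] at this
  simp at this
  linarith

theorem smcG_sq_int (d : ℕ) : Integrable (fun z => ‖z‖ ^ 2) (smcG d) :=
  (smcG_sq_aux (h := 1 / 4) (by norm_num) (by norm_num)).1

theorem smcG_sq_le (d : ℕ) : ∫ z, ‖z‖ ^ 2 ∂(smcG d) ≤ d := by
  have hd : HasDerivAt (fun h : ℝ => (1 - 2 * h) ^ (-(d : ℝ) / 2)) (d : ℝ) 0 := by
    have h1 : HasDerivAt (fun h : ℝ => 1 - 2 * h) (-2) 0 := by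
      simpa using ((hasDerivAt_id (0 : ℝ)).const_mul 2).const_sub 1
    have := h1.rpow_const (p := -(d : ℝ) / 2) (Or.inl (by norm_num))
    convert this using 1
    simp
    ring
  have ht := (hasDerivAt_iff_tendsto_slope.mp hd).mono_left
    (nhdsWithin_mono (0 : ℝ) (s := Set.Ioi 0) (fun x hx => ne_of_gt hx))
  refine ge_of_tendsto ht ?_
  have : Set.Ioo (0 : ℝ) (1 / 2) ∈ nhdsWithin (0 : ℝ) (Set.Ioi 0) :=
    Ioo_mem_nhdsGT (by norm_num)
  filter_upwards [this] with h hh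
  have := (smcG_sq_aux (d := d) hh.1 hh.2).2
  rw [slope_def_field]
  simp only [mul_zero, sub_zero, Real.one_rpow]
  rw [le_div_iff₀ hh.1]; linarith

theorem smcG_inner (d : ℕ) (v : EuclideanSpace ℝ (Fin d)) :
    ∫ z, inner ℝ v z ∂(smcG d) = 0 := by
  rw [smc_integral_G]
  have h := integral_neg_eq_self
    (fun z : EuclideanSpace ℝ (Fin d) => smcK (1 / 2) z * inner ℝ v z) volume
  have h2 : ∀ z : EuclideanSpace ℝ (Fin d), smcK (1 / 2) (-z) * inner ℝ v (-z) =
      -(smcK (1 / 2) z * inner ℝ v z) := by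
    intro z; simp [smcK]
  simp_rw [h2] at h
  rw [integral_neg] at h
  linarith

/-- integrability of quadratically bounded functions -/
theorem smc_quad_int {d : ℕ} {ν : Measure (EuclideanSpace ℝ (Fin d))} [IsProbabilityMeasure ν]
    {F : EuclideanSpace ℝ (Fin d) × EuclideanSpace ℝ (Fin d) → ℝ}
    (hF : AEStronglyMeasurable F (ν.prod (smcG d))) (R K : ℝ) (hR : ∀ᵐ y ∂ν, ‖y‖ ≤ R)
    (hb : ∀ y z, ‖y‖ ≤ R → |F (y, z)| ≤ K * (1 + ‖z‖ ^ 2)) :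
    Integrable F (ν.prod (smcG d)) := by
  have h1 : Integrable (fun p : EuclideanSpace ℝ (Fin d) × EuclideanSpace ℝ (Fin d) =>
      K * (1 + ‖p.2‖ ^ 2)) (ν.prod (smcG d)) :=
    (((integrable_const (1 : ℝ)).add (smcG_sq_int d)).const_mul K).comp_snd ν
  refine h1.mono' hF ?_
  have h2 : ∀ᵐ p ∂(ν.prod (smcG d)), ‖p.1‖ ≤ R := Measure.quasiMeasurePreserving_fst.ae hR
  filter_upwards [h2] with p hp using hb p.1 p.2 hp

noncomputable def smcDK {d : ℕ} (t : ℝ) (u : EuclideanSpace ℝ (Fin d)) :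
    EuclideanSpace ℝ (Fin d) := (-(1 / (2 * t)) * smcK t u) • u

theorem smcK_hasGrad {d : ℕ} (t : ℝ) (u : EuclideanSpace ℝ (Fin d)) :
    HasFDerivAt (smcK t) (innerSL ℝ (smcDK t u)) u := by
  have h1 : HasFDerivAt (fun u : EuclideanSpace ℝ (Fin d) => ‖u‖ ^ 2) (2 • innerSL ℝ u) u :=
    (hasStrictFDerivAt_norm_sq u).hasFDerivAt
  have h2 := ((h1.neg.mul_const (4 * t)⁻¹).exp).const_mul ((4 * Real.pi * t) ^ (-(d : ℝ) / 2))
  have e : smcK t = fun u : EuclideanSpace ℝ (Fin d) => (4 * Real.pi * t) ^ (-(d : ℝ) / 2) *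
      Real.exp ((-fun u : EuclideanSpace ℝ (Fin d) => ‖u‖ ^ 2) u * (4 * t)⁻¹) := by
    ext u; simp [smcK, div_eq_mul_inv]
  rw [e]
  refine h2.congr_fderiv ?_
  ext v
  simp [smcDK, smcK, inner_smul_left, div_eq_mul_inv]
  ring

theorem smcDK_cont {d : ℕ} (t : ℝ) :
    Continuous (smcDK t : EuclideanSpace ℝ (Fin d) → EuclideanSpace ℝ (Fin d)) := by
  have := smcK_cont (d := d) t
  unfold smcDK; fun_prop

theorem smcK_le {d : ℕ} {t : ℝ} (ht : 0 < t) (u : EuclideanSpace ℝ (Fin d)) :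
    smcK t u ≤ (4 * Real.pi * t) ^ (-(d : ℝ) / 2) := by
  have hpi := Real.pi_pos
  unfold smcK
  refine mul_le_of_le_one_right (by positivity) (Real.exp_le_one_iff.mpr ?_)
  rw [neg_div, neg_nonpos]; positivity

theorem smcDK_le {d : ℕ} {t : ℝ} (ht : 0 < t) (u : EuclideanSpace ℝ (Fin d)) :
    ‖smcDK t u‖ ≤ (1 / (2 * t)) * ((4 * Real.pi * t) ^ (-(d : ℝ) / 2) * (1 + 4 * t)) := by
  have hpi := Real.pi_pos
  have hk := smcK_pos ht u
  unfold smcDK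
  rw [norm_smul, norm_mul, norm_neg, Real.norm_of_nonneg (by positivity),
    Real.norm_of_nonneg hk.le, mul_assoc (1 / (2 * t))]
  refine mul_le_mul_of_nonneg_left ?_ (by positivity)
  unfold smcK
  rw [mul_assoc ((4 * Real.pi * t) ^ (-(d : ℝ) / 2))]
  refine mul_le_mul_of_nonneg_left ?_ (by positivity)
  set a := ‖u‖ with ha
  have ha0 : 0 ≤ a := norm_nonneg _
  have h1 := Real.add_one_le_exp (a ^ 2 / (4 * t))
  rw [show -a ^ 2 / (4 * t) = -(a ^ 2 / (4 * t)) by ring, Real.exp_neg, inv_mul_le_iff₀ (Real.exp_pos _)]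
  have h2 : a ^ 2 = 4 * t * (a ^ 2 / (4 * t)) := by field_simp
  have h3 : 0 ≤ a ^ 2 / (4 * t) := by positivity
  set w := a ^ 2 / (4 * t) with hw
  have h4 : t * (w + 1) ≤ t * Real.exp w := mul_le_mul_of_nonneg_left h1 ht.le
  nlinarith [sq_nonneg (a - 1)]

noncomputable def smcRho {d : ℕ} (ν : Measure (EuclideanSpace ℝ (Fin d)))
    (m : EuclideanSpace ℝ (Fin d) → EuclideanSpace ℝ (Fin d)) (t : ℝ)
    (x : EuclideanSpace ℝ (Fin d)) : ℝ := ∫ y, smcK t (x - m y) ∂ν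

noncomputable def smcDRho {d : ℕ} (ν : Measure (EuclideanSpace ℝ (Fin d)))
    (m : EuclideanSpace ℝ (Fin d) → EuclideanSpace ℝ (Fin d)) (t : ℝ)
    (x : EuclideanSpace ℝ (Fin d)) : EuclideanSpace ℝ (Fin d) := ∫ y, smcDK t (x - m y) ∂ν

section
variable {d : ℕ} {ν : Measure (EuclideanSpace ℝ (Fin d))} [IsProbabilityMeasure ν]
  {m : EuclideanSpace ℝ (Fin d) → EuclideanSpace ℝ (Fin d)} {t : ℝ}

theorem smcK_nu_int (hm : Continuous m) (ht : 0 < t) (x : EuclideanSpace ℝ (Fin d)) :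
    Integrable (fun y => smcK t (x - m y)) ν := by
  have := smcK_cont (d := d) t
  refine Integrable.of_bound (C := (4 * Real.pi * t) ^ (-(d : ℝ) / 2))
    (Continuous.aestronglyMeasurable (by fun_prop)) (Filter.Eventually.of_forall fun y => ?_)
  rw [Real.norm_of_nonneg (smcK_pos ht _).le]
  exact smcK_le ht _

theorem smcDK_nu_int (hm : Continuous m) (ht : 0 < t) (x : EuclideanSpace ℝ (Fin d)) :
    Integrable (fun y => smcDK t (x - m y)) ν := by
  have := smcDK_cont (d := d) t
  exact Integrable.of_bound
    (Continuous.aestronglyMeasurable (by fun_prop)) _ (Filter.Eventually.of_forall fun y => smcDK_le ht _)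

theorem smcRho_hasGrad (hm : Continuous m) (ht : 0 < t) (x : EuclideanSpace ℝ (Fin d)) :
    HasFDerivAt (smcRho ν m t) (innerSL ℝ (smcDRho ν m t x)) x := by
  have c1 := smcK_cont (d := d) t
  have c2 := smcDK_cont (d := d) t
  have h := hasFDerivAt_integral_of_dominated_of_fderiv_le (𝕜 := ℝ) (μ := ν) (x₀ := x)
    (F := fun x y => smcK t (x - m y)) (F' := fun x y => innerSL ℝ (smcDK t (x - m y)))
    (s := Set.univ) (bound := fun _ => (1 / (2 * t)) * ((4 * Real.pi * t) ^ (-(d : ℝ) / 2) * (1 + 4 * t)))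
    Filter.univ_mem
    (Filter.Eventually.of_forall fun x => Continuous.aestronglyMeasurable (by fun_prop))
    (smcK_nu_int hm ht x)
    (Continuous.aestronglyMeasurable (by fun_prop))
    (Filter.Eventually.of_forall fun y x _ => by
      rw [innerSL_apply_norm]; exact smcDK_le ht _)
    (integrable_const _)
    (Filter.Eventually.of_forall fun y x _ => by
      have := (smcK_hasGrad t (x - m y)).comp x ((hasFDerivAt_id x).sub_const (m y))
      simpa [Function.comp_def] using this)
  refine h.congr_fderiv ?_
  ext v
  have hi : Integrable (fun y => innerSL ℝ (smcDK t (x - m y))) ν := by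
    refine Integrable.of_bound (C := (1 / (2 * t)) * ((4 * Real.pi * t) ^ (-(d : ℝ) / 2) * (1 + 4 * t)))
      (Continuous.aestronglyMeasurable (by fun_prop))
      (Filter.Eventually.of_forall fun y => ?_)
    · rw [innerSL_apply_norm]; exact smcDK_le ht _
  rw [ContinuousLinearMap.integral_apply hi]
  simp only [innerSL_apply_apply]
  rw [smcDRho, real_inner_comm, ← integral_inner (smcDK_nu_int hm ht x)]
  simp_rw [real_inner_comm]

theorem smcDRho_cont (hm : Continuous m) (ht : 0 < t) : Continuous (smcDRho ν m t) := by
  have c2 := smcDK_cont (d := d) t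
  exact continuous_of_dominated (fun x => Continuous.aestronglyMeasurable (by fun_prop))
    (fun x => Filter.Eventually.of_forall fun y => smcDK_le ht _) (integrable_const _)
    (Filter.Eventually.of_forall fun y => by fun_prop)

theorem smcRho_contDiff (hm : Continuous m) (ht : 0 < t) : ContDiff ℝ 1 (smcRho ν m t) := by
  rw [contDiff_one_iff_fderiv]
  refine ⟨fun x => (smcRho_hasGrad hm ht x).differentiableAt, ?_⟩
  have : fderiv ℝ (smcRho ν m t) = fun x => innerSL ℝ (smcDRho ν m t x) :=
    funext fun x => (smcRho_hasGrad hm ht x).fderiv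
  rw [this]
  have := smcDRho_cont (ν := ν) hm ht
  fun_prop

theorem smcRho_lower (hm : Continuous m) (ht : 0 < t) {R : ℝ} (hR : ∀ᵐ y ∂ν, ‖m y‖ ≤ R)
    (x : EuclideanSpace ℝ (Fin d)) :
    (4 * Real.pi * t) ^ (-(d : ℝ) / 2) * Real.exp (-((2 * ‖x‖ ^ 2 + 2 * R ^ 2) / (4 * t))) ≤
      smcRho ν m t x := by
  have hpi := Real.pi_pos
  have h := integral_mono_ae (integrable_const (μ := ν) ((4 * Real.pi * t) ^ (-(d : ℝ) / 2) *
    Real.exp (-((2 * ‖x‖ ^ 2 + 2 * R ^ 2) / (4 * t))))) (smcK_nu_int hm ht x) (by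
    filter_upwards [hR] with y hy
    unfold smcK
    gcongr
    rw [neg_div, neg_le_neg_iff]
    gcongr
    have h1 := norm_sub_le x (m y)
    have h2 := norm_nonneg (x - m y)
    have h3 := norm_nonneg (m y)
    have : ‖m y‖ ^ 2 ≤ R ^ 2 := by gcongr
    nlinarith [sq_nonneg (‖x‖ - ‖m y‖), norm_nonneg x])
  simpa [smcRho] using h

theorem smcRho_pos (hm : Continuous m) (ht : 0 < t) {R : ℝ} (hR : ∀ᵐ y ∂ν, ‖m y‖ ≤ R)
    (x : EuclideanSpace ℝ (Fin d)) : 0 < smcRho ν m t x := by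
  have hpi := Real.pi_pos
  exact lt_of_lt_of_le (by positivity) (smcRho_lower hm ht hR x)

theorem smcRho_le (hm : Continuous m) (ht : 0 < t) (x : EuclideanSpace ℝ (Fin d)) :
    smcRho ν m t x ≤ (4 * Real.pi * t) ^ (-(d : ℝ) / 2) := by
  have h := integral_mono (smcK_nu_int (ν := ν) hm ht x) (integrable_const _)
    (fun y => smcK_le ht (x - m y))
  simpa [smcRho] using h

theorem smcRho_log (hm : Continuous m) (ht : 0 < t) {R : ℝ} (hR : ∀ᵐ y ∂ν, ‖m y‖ ≤ R)
    (x : EuclideanSpace ℝ (Fin d)) :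
    |Real.log (smcRho ν m t x)| ≤ |Real.log ((4 * Real.pi * t) ^ (-(d : ℝ) / 2))| +
      (2 * ‖x‖ ^ 2 + 2 * R ^ 2) / (4 * t) := by
  have hpi := Real.pi_pos
  have hp := smcRho_pos hm ht hR x
  have h1 := Real.log_le_log hp (smcRho_le (ν := ν) hm ht x)
  have h2 := Real.log_le_log (by positivity) (smcRho_lower (ν := ν) hm ht hR x)
  rw [Real.log_mul (by positivity) (by positivity), Real.log_exp] at h2
  have h3 : 0 ≤ (2 * ‖x‖ ^ 2 + 2 * R ^ 2) / (4 * t) := by positivity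
  rw [abs_le]
  constructor
  · linarith [neg_abs_le (Real.log ((4 * Real.pi * t) ^ (-(d : ℝ) / 2)))]
  · linarith [le_abs_self (Real.log ((4 * Real.pi * t) ^ (-(d : ℝ) / 2)))]

theorem smcDRho_le (hm : Continuous m) (ht : 0 < t) {R : ℝ} (hR : ∀ᵐ y ∂ν, ‖m y‖ ≤ R)
    (x : EuclideanSpace ℝ (Fin d)) :
    ‖smcDRho ν m t x‖ ≤ (‖x‖ + R) / (2 * t) * smcRho ν m t x := by
  have h := norm_integral_le_of_norm_le (μ := ν) (f := fun y => smcDK t (x - m y))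
    ((smcK_nu_int hm ht x).const_mul ((‖x‖ + R) / (2 * t))) (by
    filter_upwards [hR] with y hy
    unfold smcDK
    have hk := smcK_pos ht (x - m y)
    rw [norm_smul, norm_mul, norm_neg, Real.norm_of_nonneg (by positivity),
      Real.norm_of_nonneg hk.le]
    have : ‖x - m y‖ ≤ ‖x‖ + R := (norm_sub_le _ _).trans (by linarith)
    calc 1 / (2 * t) * smcK t (x - m y) * ‖x - m y‖
        ≤ 1 / (2 * t) * smcK t (x - m y) * (‖x‖ + R) := by gcongr
      _ = _ := by ring)
  rwa [integral_const_mul] at h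

/-- the joint law -/
theorem smc_joint_measure (hm : Continuous m) (ht : 0 < t) :
    (ν.prod volume).withDensity
      (fun p : EuclideanSpace ℝ (Fin d) × EuclideanSpace ℝ (Fin d) =>
        ENNReal.ofReal (smcK t (p.2 - m p.1))) =
    Measure.map (fun p : EuclideanSpace ℝ (Fin d) × EuclideanSpace ℝ (Fin d) =>
      (p.1, m p.1 + √(2 * t) • p.2)) (ν.prod (smcG d)) := by
  have c1 := smcK_cont (d := d) t
  have c2 : Measurable (fun p : EuclideanSpace ℝ (Fin d) × EuclideanSpace ℝ (Fin d) =>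
        ENNReal.ofReal (smcK t (p.2 - m p.1))) :=
    ENNReal.measurable_ofReal.comp (Continuous.measurable (by fun_prop))
  have c3 : Measurable (fun p : EuclideanSpace ℝ (Fin d) × EuclideanSpace ℝ (Fin d) =>
      (p.1, m p.1 + √(2 * t) • p.2)) := Continuous.measurable (by fun_prop)
  refine Measure.ext_of_lintegral _ fun F hF => ?_
  rw [lintegral_map hF c3, lintegral_withDensity_eq_lintegral_mul _ c2 hF,
    lintegral_prod _ (by fun_prop), lintegral_prod _ (by fun_prop)]
  congr 1; ext y
  rw [← smc_lintegral_G (F := fun x => F (y, x)) (by fun_prop) ht (m y)]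
  congr 1; ext x
  simp [mul_comm]

theorem smc_joint (hm : Continuous m) (ht : 0 < t)
    {F : EuclideanSpace ℝ (Fin d) × EuclideanSpace ℝ (Fin d) → ℝ} (hF : StronglyMeasurable F)
    (hi : Integrable (fun p : EuclideanSpace ℝ (Fin d) × EuclideanSpace ℝ (Fin d) =>
      F (p.1, m p.1 + √(2 * t) • p.2)) (ν.prod (smcG d))) :
    Integrable (fun x => ∫ y, smcK t (x - m y) * F (y, x) ∂ν) ∧
    ∫ x, ∫ y, smcK t (x - m y) * F (y, x) ∂ν =
      ∫ p, F (p.1, m p.1 + √(2 * t) • p.2) ∂(ν.prod (smcG d)) := by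
  have c1 := smcK_cont (d := d) t
  have c2 : Measurable (fun p : EuclideanSpace ℝ (Fin d) × EuclideanSpace ℝ (Fin d) =>
        ENNReal.ofReal (smcK t (p.2 - m p.1))) :=
    ENNReal.measurable_ofReal.comp (Continuous.measurable (by fun_prop))
  have c3 : Measurable (fun p : EuclideanSpace ℝ (Fin d) × EuclideanSpace ℝ (Fin d) =>
      (p.1, m p.1 + √(2 * t) • p.2)) := Continuous.measurable (by fun_prop)
  have h1 : Integrable F ((ν.prod volume).withDensity
      (fun p : EuclideanSpace ℝ (Fin d) × EuclideanSpace ℝ (Fin d) =>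
        ENNReal.ofReal (smcK t (p.2 - m p.1)))) := by
    rw [smc_joint_measure hm ht]
    exact (integrable_map_measure hF.aestronglyMeasurable c3.aemeasurable).mpr hi
  have h2 := h1
  rw [integrable_withDensity_iff_integrable_smul' c2 (by simp)] at h2
  simp_rw [ENNReal.toReal_ofReal (smcK_pos ht _).le, smul_eq_mul] at h2
  refine ⟨h2.integral_prod_right, ?_⟩
  rw [← integral_prod_symm _ h2]
  have h3 := integral_map (μ := ν.prod (smcG d)) c3.aemeasurable (f := F) hF.aestronglyMeasurable
  rw [← h3, ← smc_joint_measure hm ht, integral_withDensity_eq_integral_toReal_smul c2 (by simp)]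
  simp_rw [ENNReal.toReal_ofReal (smcK_pos ht _).le, smul_eq_mul]

theorem smc_single (hm : Continuous m) (ht : 0 < t)
    {F : EuclideanSpace ℝ (Fin d) → ℝ} (hF : StronglyMeasurable F)
    (hi : Integrable (fun p : EuclideanSpace ℝ (Fin d) × EuclideanSpace ℝ (Fin d) =>
      F (m p.1 + √(2 * t) • p.2)) (ν.prod (smcG d))) :
    Integrable (fun x => smcRho ν m t x * F x) ∧
    ∫ x, smcRho ν m t x * F x =
      ∫ p, F (m p.1 + √(2 * t) • p.2) ∂(ν.prod (smcG d)) := by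
  have := smc_joint (F := fun p => F p.2) hm ht
    (hF.comp_measurable measurable_snd) hi
  simpa [integral_mul_const, smcRho] using this

/-- Stein-type identity -/
theorem smc_stein (hm : Continuous m) (ht : 0 < t)
    {Ψ : EuclideanSpace ℝ (Fin d) → EuclideanSpace ℝ (Fin d)} (hΨ : Continuous Ψ)
    (hi : Integrable (fun p : EuclideanSpace ℝ (Fin d) × EuclideanSpace ℝ (Fin d) =>
      inner ℝ (Ψ (m p.1 + √(2 * t) • p.2)) p.2) (ν.prod (smcG d))) :
    ∫ p, inner ℝ (Ψ (m p.1 + √(2 * t) • p.2)) p.2 ∂(ν.prod (smcG d)) =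
      - √(2 * t) * ∫ x, inner ℝ (Ψ x) (smcDRho ν m t x) := by
  have hs : 0 < √(2 * t) := Real.sqrt_pos.mpr (by positivity)
  have hs2 : √(2 * t) * √(2 * t) = 2 * t := Real.mul_self_sqrt (by positivity)
  have h := (smc_joint (ν := ν) (F := fun p => (√(2 * t))⁻¹ * inner ℝ (Ψ p.2) (p.2 - m p.1)) hm ht
    (Continuous.stronglyMeasurable (by fun_prop)) (by
      refine hi.congr (Filter.Eventually.of_forall fun p => ?_)
      simp [inner_smul_right]; field_simp)).2
  have e1 : ∀ p : EuclideanSpace ℝ (Fin d) × EuclideanSpace ℝ (Fin d),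
      (√(2 * t))⁻¹ * inner ℝ (Ψ (m p.1 + √(2 * t) • p.2)) (m p.1 + √(2 * t) • p.2 - m p.1) =
      inner ℝ (Ψ (m p.1 + √(2 * t) • p.2)) p.2 := by
    intro p; simp [inner_smul_right]; field_simp
  simp only [e1] at h
  rw [← h, ← integral_const_mul]
  congr 1; ext x
  rw [smcDRho, ← integral_inner (smcDK_nu_int hm ht x), ← integral_const_mul]
  congr 1; ext y
  rw [smcDK, inner_smul_right]
  rw [show (√(2 * t))⁻¹ = √(2 * t) * (1 / (2 * t)) by
    field_simp; rw [sq, hs2]]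
  ring
end

/-- continuous maps with linear growth in the second variable -/
def smcLG {d : ℕ} (R : ℝ) (P : EuclideanSpace ℝ (Fin d) × EuclideanSpace ℝ (Fin d) →
    EuclideanSpace ℝ (Fin d)) : Prop :=
  Continuous P ∧ ∃ a, 0 ≤ a ∧ ∀ y z, ‖y‖ ≤ R → ‖P (y, z)‖ ≤ a * (1 + ‖z‖)

section
variable {d : ℕ} {R : ℝ} {P Q : EuclideanSpace ℝ (Fin d) × EuclideanSpace ℝ (Fin d) →
    EuclideanSpace ℝ (Fin d)}

theorem smcLG.add (hP : smcLG R P) (hQ : smcLG R Q) : smcLG R (fun p => P p + Q p) := by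
  obtain ⟨cP, a, ha, hP⟩ := hP
  obtain ⟨cQ, b, hb, hQ⟩ := hQ
  refine ⟨cP.add cQ, a + b, by positivity, fun y z hy => (norm_add_le _ _).trans ?_⟩
  linarith [hP y z hy, hQ y z hy]

theorem smcLG.smul (hP : smcLG R P) (c : ℝ) : smcLG R (fun p => c • P p) := by
  obtain ⟨cP, a, ha, hP⟩ := hP
  refine ⟨cP.const_smul c, |c| * a, by positivity, fun y z hy => ?_⟩
  rw [norm_smul, mul_assoc, Real.norm_eq_abs]
  exact mul_le_mul_of_nonneg_left (hP y z hy) (abs_nonneg _)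

theorem smcLG.sub (hP : smcLG R P) (hQ : smcLG R Q) : smcLG R (fun p => P p - Q p) := by
  have := hP.add (hQ.smul (-1))
  simpa [sub_eq_add_neg] using this

theorem smcLG.comp (hP : smcLG R P) {f : EuclideanSpace ℝ (Fin d) → EuclideanSpace ℝ (Fin d)}
    (hf : Continuous f) {K : ℝ} (hK : ∀ x, ‖f x‖ ≤ K * (1 + ‖x‖)) :
    smcLG R (fun p => f (P p)) := by
  obtain ⟨cP, a, ha, hP⟩ := hP
  have hK0 : 0 ≤ K := by
    have := (norm_nonneg _).trans (hK 0)
    simpa using this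
  refine ⟨hf.comp cP, K * (1 + a), by positivity, fun y z hy => (hK _).trans ?_⟩
  rw [mul_assoc]
  refine mul_le_mul_of_nonneg_left ?_ hK0
  nlinarith [hP y z hy, norm_nonneg z]

theorem smcLG_fst (hR : 0 ≤ R) : smcLG (d := d) R (fun p => p.1) :=
  ⟨continuous_fst, R, hR, fun y z hy => by nlinarith [norm_nonneg z]⟩

theorem smcLG_snd : smcLG (d := d) R (fun p => p.2) :=
  ⟨continuous_snd, 1, zero_le_one, fun y z hy => by simp⟩

variable {ν : Measure (EuclideanSpace ℝ (Fin d))} [IsProbabilityMeasure ν]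

theorem smcLG.inner_int (hP : smcLG R P) (hQ : smcLG R Q) (hR : ∀ᵐ y ∂ν, ‖y‖ ≤ R) :
    Integrable (fun p => inner ℝ (P p) (Q p)) (ν.prod (smcG d)) := by
  obtain ⟨cP, a, ha, hP⟩ := hP
  obtain ⟨cQ, b, hb, hQ⟩ := hQ
  refine smc_quad_int (Continuous.aestronglyMeasurable (by fun_prop)) R (2 * (a * b)) hR ?_
  intro y z hy
  calc |inner ℝ (P (y, z)) (Q (y, z))| ≤ ‖P (y, z)‖ * ‖Q (y, z)‖ := abs_real_inner_le_norm _ _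
    _ ≤ (a * (1 + ‖z‖)) * (b * (1 + ‖z‖)) := by
        gcongr
        · exact hP y z hy
        · exact hQ y z hy
    _ = (a * b) * (1 + ‖z‖) ^ 2 := by ring
    _ ≤ (a * b) * (2 * (1 + ‖z‖ ^ 2)) := by
        gcongr
        nlinarith [sq_nonneg (1 - ‖z‖)]
    _ = _ := by ring

end

noncomputable def smcIp {d : ℕ} (ν : Measure (EuclideanSpace ℝ (Fin d)))
    (P Q : EuclideanSpace ℝ (Fin d) × EuclideanSpace ℝ (Fin d) → EuclideanSpace ℝ (Fin d)) : ℝ :=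
  ∫ p, inner ℝ (P p) (Q p) ∂(ν.prod (smcG d))

section
variable {d : ℕ} {R : ℝ} {P Q S : EuclideanSpace ℝ (Fin d) × EuclideanSpace ℝ (Fin d) →
    EuclideanSpace ℝ (Fin d)} {ν : Measure (EuclideanSpace ℝ (Fin d))} [IsProbabilityMeasure ν]

theorem smcIp_comm : smcIp ν P Q = smcIp ν Q P := by
  unfold smcIp; simp_rw [real_inner_comm]

theorem smcIp_add (hR : ∀ᵐ y ∂ν, ‖y‖ ≤ R) (hP : smcLG R P) (hQ : smcLG R Q) (hS : smcLG R S) :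
    smcIp ν S (fun p => P p + Q p) = smcIp ν S P + smcIp ν S Q := by
  unfold smcIp; simp_rw [inner_add_right]
  exact integral_add (hS.inner_int hP hR) (hS.inner_int hQ hR)

theorem smcIp_sub (hR : ∀ᵐ y ∂ν, ‖y‖ ≤ R) (hP : smcLG R P) (hQ : smcLG R Q) (hS : smcLG R S) :
    smcIp ν S (fun p => P p - Q p) = smcIp ν S P - smcIp ν S Q := by
  unfold smcIp; simp_rw [inner_sub_right]
  exact integral_sub (hS.inner_int hP hR) (hS.inner_int hQ hR)

theorem smcIp_smul (c : ℝ) : smcIp ν S (fun p => c • P p) = c * smcIp ν S P := by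
  unfold smcIp; simp_rw [inner_smul_right]
  exact integral_const_mul _ _

theorem smcIp_self_nonneg : 0 ≤ smcIp ν P P :=
  integral_nonneg fun _ => real_inner_self_nonneg

theorem smcIp_addsq (hR : ∀ᵐ y ∂ν, ‖y‖ ≤ R) (hP : smcLG R P) (hQ : smcLG R Q) :
    smcIp ν (fun p => P p + Q p) (fun p => P p + Q p) =
      smcIp ν P P + 2 * smcIp ν P Q + smcIp ν Q Q := by
  have h1 := smcIp_add hR hP hQ (hP.add hQ)
  have h2 := smcIp_add hR hP hQ hP
  have h3 := smcIp_add hR hP hQ hQ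
  rw [smcIp_comm] at h2 h3
  rw [h1, h2, h3, smcIp_comm (P := Q) (Q := P)]
  ring

theorem smcIp_subsq (hR : ∀ᵐ y ∂ν, ‖y‖ ≤ R) (hP : smcLG R P) (hQ : smcLG R Q) :
    smcIp ν (fun p => P p - Q p) (fun p => P p - Q p) =
      smcIp ν P P - 2 * smcIp ν P Q + smcIp ν Q Q := by
  have h1 := smcIp_sub hR hP hQ (hP.sub hQ)
  have h2 := smcIp_sub hR hP hQ hP
  have h3 := smcIp_sub hR hP hQ hQ
  rw [smcIp_comm] at h2 h3
  rw [h1, h2, h3, smcIp_comm (P := Q) (Q := P)]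
  ring

theorem smcIp_fst_snd (hR : ∀ᵐ y ∂ν, ‖y‖ ≤ R)
    {f : EuclideanSpace ℝ (Fin d) → EuclideanSpace ℝ (Fin d)}
    (hf : smcLG R (fun p => f p.1)) : smcIp ν (fun p => f p.1) (fun p => p.2) = 0 := by
  unfold smcIp
  rw [integral_prod _ (hf.inner_int smcLG_snd hR)]
  simp [smcG_inner]

theorem smcIp_snd : smcIp ν (fun p => p.2) (fun p => p.2) ≤ d := by
  unfold smcIp
  simp_rw [real_inner_self_eq_norm_sq]
  have := integral_fun_snd (μ := ν) (ν := smcG d) (fun z : EuclideanSpace ℝ (Fin d) => ‖z‖ ^ 2)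
  rw [this]
  simpa using smcG_sq_le d

/-- algebra -/
theorem smc_alg {J N A D2 e sb L t dd : ℝ} (hJ0 : 0 ≤ J) (hL : 0 < L) (ht : 0 < t)
    (htL : t * L ≤ 1 / 4) (hd : 0 ≤ dd)
    (h1 : sb ≤ 1 / 4 * J + e) (h2 : e ≤ L ^ 2 * D2)
    (h3 : D2 ≤ t ^ 2 * A + 2 * t * dd) (h4 : A ≤ 2 * N + 2 * e) (h5 : N ≤ J + 2 * L * dd) :
    -J + sb ≤ -(1 / 2) * J + 4 * t * dd * L ^ 2 := by
  set q := t * L with hq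
  have hq0 : 0 < q := by positivity
  have hq2 : q ^ 2 ≤ 1 / 16 := by nlinarith
  have a1 : L ^ 2 * D2 ≤ q ^ 2 * A + 2 * q * L * dd := by
    have := mul_le_mul_of_nonneg_left h3 (sq_nonneg L)
    rw [hq]; linarith
  have a2 : q ^ 2 * A ≤ q ^ 2 * (2 * (J + 2 * L * dd) + 2 * e) := by
    refine mul_le_mul_of_nonneg_left (by linarith) (sq_nonneg q)
  have e1 : e ≤ q ^ 2 * (2 * (J + 2 * L * dd)) + 2 * (q ^ 2 * e) + 2 * q * L * dd := by linarith
  have b1 : q ^ 2 * J ≤ 1 / 16 * J := by gcongr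
  have b2 : q ^ 2 * (L * dd) ≤ 1 / 4 * (q * L * dd) := by
    have : 0 ≤ q * L * dd := by positivity
    nlinarith
  have hc : 4 * t * dd * L ^ 2 = 4 * (q * L * dd) := by rw [hq]; ring
  rw [hc]
  have hx : 0 ≤ q * L * dd := by positivity
  rcases le_or_gt e 0 with he | he
  · linarith
  · have b3 : q ^ 2 * e ≤ 1 / 16 * e := by gcongr
    linarith

/-- The derivative estimate. -/
theorem smc_deriv_bound {b : EuclideanSpace ℝ (Fin d) → EuclideanSpace ℝ (Fin d)}
    {L : ℝ} (hL : 0 < L) (hb : ∀ x y, ‖b x - b y‖ ≤ L * ‖x - y‖) (hbc : Continuous b)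
    {Kb : ℝ} (hKb : ∀ x, ‖b x‖ ≤ Kb * (1 + ‖x‖))
    (hR0 : 0 ≤ R) (hR : ∀ᵐ y ∂ν, ‖y‖ ≤ R) {t : ℝ} (ht : 0 < t) (htL : t * L ≤ 1 / 4)
    {S : EuclideanSpace ℝ (Fin d) → EuclideanSpace ℝ (Fin d)} (hSc : Continuous S)
    {K : ℝ} (hK : ∀ x, ‖S x‖ ≤ K * (1 + ‖x‖))
    (hS : ∀ x, smcDRho ν (fun y => y + t • b y) t x =
      smcRho ν (fun y => y + t • b y) t x • (S x + b x)) :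
    smcIp ν (fun p => S (p.1 + t • b p.1 + √(2 * t) • p.2))
      (fun p => b p.1 + (√(2 * t))⁻¹ • p.2) ≤
    -(1 / 2) * smcIp ν (fun p => S (p.1 + t • b p.1 + √(2 * t) • p.2))
      (fun p => S (p.1 + t • b p.1 + √(2 * t) • p.2)) + 4 * t * d * L ^ 2 := by
  have hs : 0 < √(2 * t) := Real.sqrt_pos.mpr (by positivity)
  have hs2 : √(2 * t) * √(2 * t) = 2 * t := Real.mul_self_sqrt (by positivity)
  have hm : Continuous (fun y => y + t • b y) := by fun_prop
  have ly : smcLG (d := d) R (fun p => p.1) := smcLG_fst hR0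
  have lz : smcLG (d := d) R (fun p => p.2) := smcLG_snd
  have lby : smcLG R (fun p => b p.1) := ly.comp hbc hKb
  have lm : smcLG R (fun p => p.1 + t • b p.1) := ly.add (lby.smul t)
  have lx : smcLG R (fun p => p.1 + t • b p.1 + √(2 * t) • p.2) := lm.add (lz.smul _)
  have lbx : smcLG R (fun p => b (p.1 + t • b p.1 + √(2 * t) • p.2)) := lx.comp hbc hKb
  have lbm : smcLG R (fun p => b (p.1 + t • b p.1)) := lm.comp hbc hKb
  have lS : smcLG R (fun p => S (p.1 + t • b p.1 + √(2 * t) • p.2)) := lx.comp hSc hK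
  -- Stein
  have stein : ∀ Ψ : EuclideanSpace ℝ (Fin d) → EuclideanSpace ℝ (Fin d), Continuous Ψ →
      smcLG R (fun p => Ψ (p.1 + t • b p.1 + √(2 * t) • p.2)) →
      smcIp ν (fun p => Ψ (p.1 + t • b p.1 + √(2 * t) • p.2)) (fun p => p.2) =
      - √(2 * t) * smcIp ν (fun p => Ψ (p.1 + t • b p.1 + √(2 * t) • p.2))
        (fun p => S (p.1 + t • b p.1 + √(2 * t) • p.2) +
          b (p.1 + t • b p.1 + √(2 * t) • p.2)) := by
    intro Ψ hΨ lΨ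
    have h1 := smc_stein (ν := ν) hm ht hΨ (lΨ.inner_int lz hR)
    have h2 := (smc_single (ν := ν) hm ht (F := fun x => inner ℝ (Ψ x) (S x + b x))
      (Continuous.stronglyMeasurable (by fun_prop)) (lΨ.inner_int (lS.add lbx) hR)).2
    unfold smcIp
    rw [h1, ← h2]
    congr 2; ext x
    rw [hS, inner_smul_right]
  have st1 := stein S hSc lS
  have st2 := stein b hbc lbx
  clear stein
  rw [smcIp_add hR lS lbx lS] at st1
  rw [smcIp_add hR lS lbx lbx] at st2
  rw [smcIp_add hR lby (lz.smul _) lS, smcIp_smul, st1]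
  have hDz : smcIp ν (fun p => b (p.1 + t • b p.1)) (fun p => p.2) = 0 :=
    smcIp_fst_snd (f := fun y => b (y + t • b y)) hR lbm
  have hyz : smcIp ν (fun p => b p.1) (fun p => p.2) = 0 := smcIp_fst_snd hR lby
  have hzz := smcIp_snd (ν := ν)
  -- E<bx,z> bound
  have hbz : -(L * √(2 * t) * d) ≤
      smcIp ν (fun p => b (p.1 + t • b p.1 + √(2 * t) • p.2)) (fun p => p.2) := by
    have e1 : smcIp ν (fun p => b (p.1 + t • b p.1 + √(2 * t) • p.2)) (fun p => p.2) =
        smcIp ν (fun p => p.2) (fun p => b (p.1 + t • b p.1 + √(2 * t) • p.2) -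
          b (p.1 + t • b p.1)) := by
      rw [smcIp_sub hR lbx lbm lz, smcIp_comm (P := fun p => p.2) (Q := fun p => b (p.1 + t • b p.1)), hDz, smcIp_comm]
      ring
    rw [e1]
    have h1 : - (L * √(2 * t)) * smcIp ν (fun p => p.2) (fun p => p.2) ≤
        smcIp ν (fun p => p.2) (fun p => b (p.1 + t • b p.1 + √(2 * t) • p.2) -
          b (p.1 + t • b p.1)) := by
      unfold smcIp
      rw [← integral_const_mul]
      refine integral_mono ((lz.inner_int lz hR).const_mul _) (lz.inner_int (lbx.sub lbm) hR) ?_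
      intro p
      have h2 := hb (p.1 + t • b p.1 + √(2 * t) • p.2) (p.1 + t • b p.1)
      rw [add_sub_cancel_left, norm_smul, Real.norm_of_nonneg hs.le] at h2
      have h3 := abs_real_inner_le_norm p.2 (b (p.1 + t • b p.1 + √(2 * t) • p.2) - b (p.1 + t • b p.1))
      have h4 := neg_abs_le (inner ℝ p.2 (b (p.1 + t • b p.1 + √(2 * t) • p.2) - b (p.1 + t • b p.1)))
      simp only [real_inner_self_eq_norm_sq]
      have h5 := mul_le_mul_of_nonneg_left h2 (norm_nonneg p.2)
      nlinarith
    refine le_trans ?_ h1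
    have : 0 ≤ L * √(2 * t) := by positivity
    nlinarith
  -- abbreviations
  have k1 : 0 ≤ smcIp ν (fun p => (1 / 2 : ℝ) • S (p.1 + t • b p.1 + √(2 * t) • p.2) -
      (b p.1 - b (p.1 + t • b p.1 + √(2 * t) • p.2)))
      (fun p => (1 / 2 : ℝ) • S (p.1 + t • b p.1 + √(2 * t) • p.2) -
      (b p.1 - b (p.1 + t • b p.1 + √(2 * t) • p.2))) := smcIp_self_nonneg
  rw [smcIp_subsq hR (lS.smul _) (lby.sub lbx), smcIp_smul, smcIp_comm, smcIp_smul,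
    smcIp_comm (P := fun p => (1 / 2 : ℝ) • S (p.1 + t • b p.1 + √(2 * t) • p.2)),
    smcIp_smul, smcIp_comm (P := fun p => b p.1 - b (p.1 + t • b p.1 + √(2 * t) • p.2))
      (Q := fun p => S (p.1 + t • b p.1 + √(2 * t) • p.2)),
    smcIp_sub hR lby lbx lS] at k1
  have k2 : smcIp ν (fun p => b p.1 - b (p.1 + t • b p.1 + √(2 * t) • p.2))
      (fun p => b p.1 - b (p.1 + t • b p.1 + √(2 * t) • p.2)) ≤
      L ^ 2 * smcIp ν (fun p => t • b p.1 + √(2 * t) • p.2) (fun p => t • b p.1 + √(2 * t) • p.2) := by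
    unfold smcIp
    rw [← integral_const_mul]
    refine integral_mono ((lby.sub lbx).inner_int (lby.sub lbx) hR)
      ((((lby.smul t).add (lz.smul _)).inner_int ((lby.smul t).add (lz.smul _)) hR).const_mul _) ?_
    intro p
    simp only [real_inner_self_eq_norm_sq]
    have h2 := hb p.1 (p.1 + t • b p.1 + √(2 * t) • p.2)
    rw [show p.1 - (p.1 + t • b p.1 + √(2 * t) • p.2) = -(t • b p.1 + √(2 * t) • p.2) by abel,
      norm_neg] at h2
    rw [← mul_pow]
    gcongr
  have k3 : smcIp ν (fun p => t • b p.1 + √(2 * t) • p.2) (fun p => t • b p.1 + √(2 * t) • p.2) =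
      t ^ 2 * smcIp ν (fun p => b p.1) (fun p => b p.1) +
        2 * t * smcIp ν (fun p => p.2) (fun p => p.2) := by
    rw [smcIp_addsq hR (lby.smul t) (lz.smul _), smcIp_smul, smcIp_smul, smcIp_smul,
      smcIp_comm (P := fun p => t • b p.1), smcIp_smul,
      smcIp_comm (P := fun p => t • b p.1), smcIp_smul,
      smcIp_comm (P := fun p => √(2 * t) • p.2), smcIp_smul, smcIp_comm (P := fun p => p.2) (Q := fun p => b p.1), hyz]
    linear_combination (smcIp ν (fun p => p.2) (fun p => p.2)) * hs2
  have k4 : 0 ≤ smcIp ν (fun p => b (p.1 + t • b p.1 + √(2 * t) • p.2) -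
      (b p.1 - b (p.1 + t • b p.1 + √(2 * t) • p.2)))
      (fun p => b (p.1 + t • b p.1 + √(2 * t) • p.2) -
      (b p.1 - b (p.1 + t • b p.1 + √(2 * t) • p.2))) := smcIp_self_nonneg
  rw [smcIp_subsq hR lbx (lby.sub lbx), smcIp_sub hR lby lbx lbx] at k4
  have k5 := smcIp_subsq hR lby lbx
  have k6 : 0 ≤ smcIp ν (fun p => S (p.1 + t • b p.1 + √(2 * t) • p.2) +
      b (p.1 + t • b p.1 + √(2 * t) • p.2)) (fun p => S (p.1 + t • b p.1 + √(2 * t) • p.2) +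
      b (p.1 + t • b p.1 + √(2 * t) • p.2)) := smcIp_self_nonneg
  rw [smcIp_addsq hR lS lbx] at k6
  have k0 : 0 ≤ smcIp ν (fun p => S (p.1 + t • b p.1 + √(2 * t) • p.2))
    (fun p => S (p.1 + t • b p.1 + √(2 * t) • p.2)) := smcIp_self_nonneg
  rw [smcIp_comm (Q := fun p => S (p.1 + t • b p.1 + √(2 * t) • p.2)) (P := fun p => b (p.1 + t • b p.1 + √(2 * t) • p.2))] at st2
  rw [smcIp_comm (Q := fun p => b p.1) (P := fun p => b (p.1 + t • b p.1 + √(2 * t) • p.2))] at k4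
  set J := smcIp ν (fun p => S (p.1 + t • b p.1 + √(2 * t) • p.2))
    (fun p => S (p.1 + t • b p.1 + √(2 * t) • p.2))
  set sby := smcIp ν (fun p => S (p.1 + t • b p.1 + √(2 * t) • p.2)) (fun p => b p.1)
  set sbx := smcIp ν (fun p => S (p.1 + t • b p.1 + √(2 * t) • p.2))
    (fun p => b (p.1 + t • b p.1 + √(2 * t) • p.2))
  set N := smcIp ν (fun p => b (p.1 + t • b p.1 + √(2 * t) • p.2))
    (fun p => b (p.1 + t • b p.1 + √(2 * t) • p.2))
  set A := smcIp ν (fun p => b p.1) (fun p => b p.1)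
  set e := smcIp ν (fun p => b p.1 - b (p.1 + t • b p.1 + √(2 * t) • p.2))
      (fun p => b p.1 - b (p.1 + t • b p.1 + √(2 * t) • p.2))
  have hq : sbx + N ≤ L * d := by
    rw [st2] at hbz
    have : √(2 * t) * (sbx + N) ≤ √(2 * t) * (L * d) := by linarith
    exact le_of_mul_le_mul_left this hs
  have hfin : sby + (√(2 * t))⁻¹ * (-√(2 * t) * (J + sbx)) = -J + (sby - sbx) := by
    field_simp; ring
  rw [hfin]
  have hdd : (0 : ℝ) ≤ d := Nat.cast_nonneg d
  refine smc_alg (e := e) (N := N) (A := A) k0 hL ht htL hdd ?_ k2 ?_ ?_ ?_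
  · linarith
  · rw [k3]; gcongr
  · linarith
  · linarith
end

theorem smc_real_induction {G : ℝ → ℝ} {γ : ℝ}
    (h1 : ∀ t, 0 < t → t ≤ γ → ∃ (h : ℝ → ℝ) (h' : ℝ), HasDerivAt h h' t ∧ h' ≤ 0 ∧ h t = G t ∧
      ∀ s, 0 < s → s ≤ t → h s ≤ G s)
    (h2 : ∀ c, 0 < c → c < γ → ∀ ε, 0 < ε → ∀ᶠ t in nhdsWithin c (Set.Ioi c), G t ≤ G c + ε)
    {a : ℝ} (ha : 0 < a) (haγ : a ≤ γ) : G γ ≤ G a := by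
  have key : ∀ ε, 0 < ε → G γ ≤ G a + ε * (γ - a) := by
    intro ε hε
    set S : Set ℝ := {t | a ≤ t ∧ t ≤ γ ∧ G γ - G t ≤ ε * (γ - t)} with hS
    have hγS : γ ∈ S := ⟨haγ, le_rfl, by simp⟩
    have hbdd : BddBelow S := ⟨a, fun t ht => ht.1⟩
    set c := sInf S with hc
    have hac : a ≤ c := le_csInf ⟨γ, hγS⟩ fun t ht => ht.1
    have hcγ : c ≤ γ := csInf_le hbdd hγS
    have hcS : c ∈ S := by
      by_contra hcon
      have hclt : c < γ := lt_of_le_of_ne hcγ (fun h => hcon (h ▸ hγS))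
      refine hcon ⟨hac, hcγ, ?_⟩
      have : ∀ η, 0 < η → G γ ≤ (G c + ε * (γ - c)) + η := by
        intro η hη
        obtain ⟨u, hu, hu2⟩ := mem_nhdsGT_iff_exists_Ioo_subset.mp (h2 c (by linarith) hclt η hη)
        obtain ⟨t, htS, htu⟩ := exists_lt_of_csInf_lt ⟨γ, hγS⟩ (show sInf S < u from hu)
        have hct : c < t := lt_of_le_of_ne (csInf_le hbdd htS) (fun h => hcon (h ▸ htS))
        have h3 : G t ≤ G c + η := hu2 ⟨hct, htu⟩
        have h4 := htS.2.2
        have h5 : ε * (γ - t) ≤ ε * (γ - c) := by gcongr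
        linarith
      linarith [le_of_forall_pos_le_add this]
    rcases hac.eq_or_lt with h | h
    · rw [h]; linarith [hcS.2.2]
    · exfalso
      obtain ⟨f, f', hf, hf', hfc, hfG⟩ := h1 c (by linarith) hcγ
      have hsl := hasDerivAt_iff_tendsto_slope.mp hf
      have hev : ∀ᶠ s in nhdsWithin c {c}ᶜ, slope f c s < ε :=
        hsl.eventually (gt_mem_nhds (by linarith))
      have hev2 : ∀ᶠ s in nhdsWithin c (Set.Iio c), slope f c s < ε :=
        hev.filter_mono (nhdsWithin_mono _ (fun s hs => ne_of_lt hs))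
      have hev3 : ∀ᶠ s in nhdsWithin c (Set.Iio c), a < s := 
        (lt_mem_nhds h).filter_mono nhdsWithin_le_nhds
      obtain ⟨s, ⟨hs1, hs2⟩, hs3⟩ := ((hev2.and hev3).and self_mem_nhdsWithin).exists
      have hs3 : s < c := hs3
      rw [slope_def_field, div_lt_iff_of_neg (by linarith)] at hs1
      have h6 := hfG s (by linarith) hs3.le
      have h7 := hcS.2.2
      have : s ∈ S := ⟨hs2.le, by linarith, by linarith⟩
      linarith [csInf_le hbdd this]
  have hlim : Filter.Tendsto (fun ε : ℝ => G a + ε * (γ - a)) (nhdsWithin 0 (Set.Ioi 0))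
      (nhds (G a + 0 * (γ - a))) :=
    (Continuous.tendsto (by fun_prop) 0).mono_left nhdsWithin_le_nhds
  rw [zero_mul, add_zero] at hlim
  exact ge_of_tendsto hlim (by filter_upwards [self_mem_nhdsWithin] with ε hε using key ε hε)

/-- potential with gradient of linear growth -/
def smcQ {d : ℕ} (K : ℝ) (φ : EuclideanSpace ℝ (Fin d) → ℝ)
    (S : EuclideanSpace ℝ (Fin d) → EuclideanSpace ℝ (Fin d)) : Prop :=
  (∀ x, HasFDerivAt φ (innerSL ℝ (S x)) x) ∧ Continuous S ∧ 0 ≤ K ∧ ∀ x, ‖S x‖ ≤ K * (1 + ‖x‖)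

section
variable {d : ℕ} {K R B T : ℝ} {φ : EuclideanSpace ℝ (Fin d) → ℝ}
  {S b : EuclideanSpace ℝ (Fin d) → EuclideanSpace ℝ (Fin d)}
  {ν : Measure (EuclideanSpace ℝ (Fin d))} [IsProbabilityMeasure ν]

theorem smcQ.cont (h : smcQ K φ S) : Continuous φ :=
  continuous_iff_continuousAt.mpr fun x => (h.1 x).continuousAt

theorem smcQ.lip (h : smcQ K φ S) (x x' : EuclideanSpace ℝ (Fin d)) :
    |φ x - φ x'| ≤ K * (1 + ‖x‖ + ‖x'‖) * ‖x - x'‖ := by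
  have := (convex_closedBall (0 : EuclideanSpace ℝ (Fin d)) (max ‖x‖ ‖x'‖)).norm_image_sub_le_of_norm_hasFDerivWithin_le
    (f := φ) (f' := fun x => innerSL ℝ (S x)) (C := K * (1 + max ‖x‖ ‖x'‖)) (x := x') (y := x)
    (fun y _ => (h.1 y).hasFDerivWithinAt) (fun y hy => by
      rw [innerSL_apply_norm]
      refine (h.2.2.2 y).trans ?_
      have := h.2.2.1
      rw [mem_closedBall_zero_iff] at hy
      gcongr) (by simp) (by simp)
  rw [Real.norm_eq_abs] at this
  refine this.trans ?_
  have := h.2.2.1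
  have h3 : max ‖x‖ ‖x'‖ ≤ ‖x‖ + ‖x'‖ := max_le (by simp) (by simp)
  rw [add_assoc 1 ‖x‖ ‖x'‖]
  gcongr

theorem smcQ.growth (h : smcQ K φ S) (x : EuclideanSpace ℝ (Fin d)) :
    |φ x| ≤ |φ 0| + K * (1 + ‖x‖) * ‖x‖ := by
  have := h.lip x 0
  simp only [norm_zero, add_zero, sub_zero] at this
  have h2 := abs_sub_abs_le_abs_sub (φ x) (φ 0)
  linarith

theorem smc_x_le (hB : ∀ y, ‖y‖ ≤ R → ‖b y‖ ≤ B) {s : ℝ} (hs : 0 ≤ s) (hsT : s ≤ T)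
    {y z : EuclideanSpace ℝ (Fin d)} (hy : ‖y‖ ≤ R) :
    ‖y + s • b y + √(2 * s) • z‖ ≤ (R + T * B + √(2 * T)) * (1 + ‖z‖) := by
  have h0 : 0 ≤ B := (norm_nonneg _).trans (hB y hy)
  have h1 : ‖s • b y‖ ≤ T * B := by
    rw [norm_smul, Real.norm_of_nonneg hs]
    exact mul_le_mul hsT (hB y hy) (norm_nonneg _) (hs.trans hsT)
  have h2 : ‖√(2 * s) • z‖ ≤ √(2 * T) * ‖z‖ := by
    rw [norm_smul, Real.norm_of_nonneg (Real.sqrt_nonneg _)]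
    gcongr
  have h3 := norm_add₃_le (a := y) (b := s • b y) (c := √(2 * s) • z)
  have h4 : 0 ≤ T * B := mul_nonneg (hs.trans hsT) h0
  have h5 : 0 ≤ R := (norm_nonneg _).trans hy
  have h6 := Real.sqrt_nonneg (2 * T)
  nlinarith [norm_nonneg z, mul_nonneg h5 (norm_nonneg z), mul_nonneg h4 (norm_nonneg z)]

theorem smcQ.int (h : smcQ K φ S) (hbc : Continuous b) (hB : ∀ y, ‖y‖ ≤ R → ‖b y‖ ≤ B)
    (hR0 : 0 ≤ R) (hR : ∀ᵐ y ∂ν, ‖y‖ ≤ R) {s : ℝ} (hs : 0 ≤ s) :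
    Integrable (fun p => φ (p.1 + s • b p.1 + √(2 * s) • p.2)) (ν.prod (smcG d)) := by
  have hφ := h.cont
  have hK := h.2.2.1
  have hB0 : 0 ≤ B := (norm_nonneg _).trans (hB 0 (by simpa using hR0))
  set A := R + s * B + √(2 * s) with hA
  have hA0 : 0 ≤ A := by positivity
  refine smc_quad_int (Continuous.aestronglyMeasurable (by fun_prop)) R
    (|φ 0| + K * (1 + A) * A * 2) hR ?_
  intro y z hy
  have h1 := smc_x_le hB hs le_rfl (z := z) hy
  refine (h.growth _).trans ?_
  have hz := norm_nonneg z
  calc |φ 0| + K * (1 + ‖y + s • b y + √(2 * s) • z‖) * ‖y + s • b y + √(2 * s) • z‖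
      ≤ |φ 0| + K * (1 + A * (1 + ‖z‖)) * (A * (1 + ‖z‖)) := by gcongr
    _ ≤ |φ 0| * (1 + ‖z‖ ^ 2) + K * ((1 + A) * (1 + ‖z‖)) * (A * (1 + ‖z‖)) := by
        gcongr
        · nlinarith [abs_nonneg (φ 0), sq_nonneg ‖z‖]
        · nlinarith
    _ = |φ 0| * (1 + ‖z‖ ^ 2) + K * (1 + A) * A * (1 + ‖z‖) ^ 2 := by ring
    _ ≤ |φ 0| * (1 + ‖z‖ ^ 2) + K * (1 + A) * A * (2 * (1 + ‖z‖ ^ 2)) := by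
        gcongr
        nlinarith [sq_nonneg (1 - ‖z‖)]
    _ = _ := by ring

theorem smc_lip (hbc : Continuous b) (hB : ∀ y, ‖y‖ ≤ R → ‖b y‖ ≤ B)
    (hR0 : 0 ≤ R) (hR : ∀ᵐ y ∂ν, ‖y‖ ≤ R) (hT : 0 ≤ T) :
    ∃ W, 0 ≤ W ∧ ∀ (φ : EuclideanSpace ℝ (Fin d) → ℝ)
      (S : EuclideanSpace ℝ (Fin d) → EuclideanSpace ℝ (Fin d)) (K : ℝ), smcQ K φ S →
      ∀ s t, 0 ≤ s → s ≤ T → 0 ≤ t → t ≤ T →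
      |∫ p, φ (p.1 + t • b p.1 + √(2 * t) • p.2) ∂(ν.prod (smcG d)) -
        ∫ p, φ (p.1 + s • b p.1 + √(2 * s) • p.2) ∂(ν.prod (smcG d))| ≤
        W * K * (|t - s| + |√(2 * t) - √(2 * s)|) := by
  have hB0 : 0 ≤ B := (norm_nonneg _).trans (hB 0 (by simpa using hR0))
  set A := R + T * B + √(2 * T) with hA
  have hA0 : 0 ≤ A := by positivity
  have hwi : Integrable (fun p : EuclideanSpace ℝ (Fin d) × EuclideanSpace ℝ (Fin d) =>
      (1 + 2 * A) * (1 + B) * 2 * (1 + ‖p.2‖ ^ 2)) (ν.prod (smcG d)) := by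
    refine smc_quad_int (Continuous.aestronglyMeasurable (by fun_prop)) R
      ((1 + 2 * A) * (1 + B) * 2) hR ?_
    intro y z hy
    rw [abs_of_nonneg (by positivity)]
  refine ⟨∫ p, (1 + 2 * A) * (1 + B) * 2 * (1 + ‖p.2‖ ^ 2) ∂(ν.prod (smcG d)),
    integral_nonneg fun p => by positivity, ?_⟩
  intro φ S K h s t hs hsT ht htT
  have hK := h.2.2.1
  have e1 := integral_sub (h.int (ν := ν) hbc hB hR0 hR ht) (h.int (ν := ν) hbc hB hR0 hR hs)
  rw [← e1, mul_assoc, ← integral_mul_const]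
  rw [← Real.norm_eq_abs (∫ p, _ ∂(ν.prod (smcG d)))]
  refine norm_integral_le_of_norm_le (hwi.mul_const _) ?_
  have hae : ∀ᵐ p ∂(ν.prod (smcG d)), ‖p.1‖ ≤ R := Measure.quasiMeasurePreserving_fst.ae hR
  filter_upwards [hae] with p hp
  obtain ⟨y, z⟩ := p
  simp only at hp ⊢
  have hz := norm_nonneg z
  rw [Real.norm_eq_abs]
  refine (h.lip _ _).trans ?_
  have h1 := smc_x_le hB ht htT (z := z) hp
  have h2 := smc_x_le hB hs hsT (z := z) hp
  set δ := |t - s| + |√(2 * t) - √(2 * s)| with hδ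
  have hδ0 : 0 ≤ δ := by positivity
  have h3 : ‖(y + t • b y + √(2 * t) • z) - (y + s • b y + √(2 * s) • z)‖ ≤
      δ * ((1 + B) * (1 + ‖z‖)) := by
    have : (y + t • b y + √(2 * t) • z) - (y + s • b y + √(2 * s) • z) =
      (t - s) • b y + (√(2 * t) - √(2 * s)) • z := by
      rw [sub_smul, sub_smul]; abel
    rw [this]
    refine (norm_add_le _ _).trans ?_
    rw [norm_smul, norm_smul, Real.norm_eq_abs, Real.norm_eq_abs, hδ, add_mul]
    gcongr
    · nlinarith [hB y hp]
    · nlinarith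
  calc K * (1 + ‖y + t • b y + √(2 * t) • z‖ + ‖y + s • b y + √(2 * s) • z‖) *
      ‖(y + t • b y + √(2 * t) • z) - (y + s • b y + √(2 * s) • z)‖
      ≤ K * (1 + A * (1 + ‖z‖) + A * (1 + ‖z‖)) * (δ * ((1 + B) * (1 + ‖z‖))) := by gcongr
    _ ≤ K * ((1 + 2 * A) * (1 + ‖z‖)) * (δ * ((1 + B) * (1 + ‖z‖))) := by
        gcongr
        nlinarith
    _ = K * δ * ((1 + 2 * A) * (1 + B) * (1 + ‖z‖) ^ 2) := by ring
    _ ≤ K * δ * ((1 + 2 * A) * (1 + B) * (2 * (1 + ‖z‖ ^ 2))) := by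
        gcongr
        nlinarith [sq_nonneg (1 - ‖z‖)]
    _ = _ := by ring

theorem smcQ.deriv (h : smcQ K φ S) (hbc : Continuous b) (hB : ∀ y, ‖y‖ ≤ R → ‖b y‖ ≤ B)
    (hR0 : 0 ≤ R) (hR : ∀ᵐ y ∂ν, ‖y‖ ≤ R) {t : ℝ} (ht : 0 < t) :
    HasDerivAt (fun s => ∫ p, φ (p.1 + s • b p.1 + √(2 * s) • p.2) ∂(ν.prod (smcG d)))
      (smcIp ν (fun p => S (p.1 + t • b p.1 + √(2 * t) • p.2))
        (fun p => b p.1 + (√(2 * t))⁻¹ • p.2)) t := by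
  have hB0 : 0 ≤ B := (norm_nonneg _).trans (hB 0 (by simpa using hR0))
  have hφ := h.cont
  have hSc := h.2.1
  have hK := h.2.2.1
  set A := R + (2 * t) * B + √(2 * (2 * t)) with hA
  have hA0 : 0 ≤ A := by positivity
  set D := (√t)⁻¹ with hD
  have hD0 : 0 ≤ D := by positivity
  have hwi : Integrable (fun p : EuclideanSpace ℝ (Fin d) × EuclideanSpace ℝ (Fin d) =>
      K * (1 + A) * (B + D) * 2 * (1 + ‖p.2‖ ^ 2)) (ν.prod (smcG d)) := by
    refine smc_quad_int (Continuous.aestronglyMeasurable (by fun_prop)) R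
      (K * (1 + A) * (B + D) * 2) hR ?_
    intro y z hy
    rw [abs_of_nonneg (by positivity)]
  refine (hasDerivAt_integral_of_dominated_loc_of_deriv_le (𝕜 := ℝ) (μ := ν.prod (smcG d))
    (x₀ := t) (s := Metric.ball t (t / 2))
    (F := fun s p => φ (p.1 + s • b p.1 + √(2 * s) • p.2))
    (F' := fun s p => inner ℝ (S (p.1 + s • b p.1 + √(2 * s) • p.2)) (b p.1 + (√(2 * s))⁻¹ • p.2))
    (bound := fun p => K * (1 + A) * (B + D) * 2 * (1 + ‖p.2‖ ^ 2))
    (Metric.ball_mem_nhds t (by positivity)) ?_ (h.int hbc hB hR0 hR ht.le) ?_ ?_ hwi ?_).2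
  · exact Filter.Eventually.of_forall fun s => Continuous.aestronglyMeasurable (by fun_prop)
  · exact Continuous.aestronglyMeasurable (by fun_prop)
  · have hae : ∀ᵐ p ∂(ν.prod (smcG d)), ‖p.1‖ ≤ R := Measure.quasiMeasurePreserving_fst.ae hR
    filter_upwards [hae] with p hp s hs
    obtain ⟨y, z⟩ := p
    simp only at hp ⊢
    have hz := norm_nonneg z
    rw [Metric.mem_ball, Real.dist_eq, abs_lt] at hs
    have hs0 : 0 < s := by linarith
    refine (norm_inner_le_norm _ _).trans ?_
    have h1 := smc_x_le hB hs0.le (by linarith : s ≤ 2 * t) (z := z) hp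
    have h2 : ‖b y + (√(2 * s))⁻¹ • z‖ ≤ (B + D) * (1 + ‖z‖) := by
      refine (norm_add_le _ _).trans ?_
      rw [norm_smul, Real.norm_of_nonneg (by positivity)]
      have h3 : (√(2 * s))⁻¹ ≤ D := by
        rw [hD]
        gcongr
        · linarith
      have h4 : (√(2 * s))⁻¹ * ‖z‖ ≤ D * ‖z‖ := by gcongr
      nlinarith [hB y hp, mul_nonneg hB0 hz]
    calc _ ≤ (K * (1 + A * (1 + ‖z‖))) * ((B + D) * (1 + ‖z‖)) := by
          gcongr
          refine (h.2.2.2 _).trans ?_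
          gcongr
      _ ≤ (K * ((1 + A) * (1 + ‖z‖))) * ((B + D) * (1 + ‖z‖)) := by
          gcongr
          nlinarith
      _ = K * (1 + A) * (B + D) * (1 + ‖z‖) ^ 2 := by ring
      _ ≤ K * (1 + A) * (B + D) * (2 * (1 + ‖z‖ ^ 2)) := by
          gcongr
          nlinarith [sq_nonneg (1 - ‖z‖)]
      _ = _ := by ring
  · refine Filter.Eventually.of_forall fun p s hs => ?_
    rw [Metric.mem_ball, Real.dist_eq, abs_lt] at hs
    have hs0 : 0 < s := by linarith
    have e1 : HasDerivAt (fun s : ℝ => √(2 * s)) ((√(2 * s))⁻¹) s := by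
      have := ((hasDerivAt_id s).const_mul 2).sqrt (by simp; positivity)
      have e : (√(2 * s))⁻¹ = 2 * 1 / (2 * √(2 * s)) := by field_simp
      rw [e]
      exact this
    have e2 : HasDerivAt (fun s : ℝ => p.1 + s • b p.1 + √(2 * s) • p.2)
        (b p.1 + (√(2 * s))⁻¹ • p.2) s := by
      have := (((hasDerivAt_id s).smul_const (b p.1)).const_add p.1).add (e1.smul_const p.2)
      rw [one_smul] at this
      exact this
    have := (h.1 (p.1 + s • b p.1 + √(2 * s) • p.2)).comp_hasDerivAt s e2
    simp only [innerSL_apply_apply] at this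
    exact this
end

noncomputable def smcH {d : ℕ} (ν : Measure (EuclideanSpace ℝ (Fin d)))
    (U : EuclideanSpace ℝ (Fin d) → ℝ) (b : EuclideanSpace ℝ (Fin d) → EuclideanSpace ℝ (Fin d))
    (t : ℝ) : ℝ :=
  ∫ x, smcRho ν (fun y => y + t • b y) t x *
    (Real.log (smcRho ν (fun y => y + t • b y) t x) - U x)

section
variable {d : ℕ} {R B T L : ℝ} {U : EuclideanSpace ℝ (Fin d) → ℝ}
  {b : EuclideanSpace ℝ (Fin d) → EuclideanSpace ℝ (Fin d)}
  {ν : Measure (EuclideanSpace ℝ (Fin d))} [IsProbabilityMeasure ν]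

theorem smc_b_cont (hL : 0 < L) (hb : ∀ x y, ‖b x - b y‖ ≤ L * ‖x - y‖) : Continuous b := by
  have : LipschitzWith (Real.toNNReal L) b := LipschitzWith.of_dist_le_mul fun x y => by
    rw [dist_eq_norm, dist_eq_norm, Real.coe_toNNReal _ hL.le]; exact hb x y
  exact this.continuous

theorem smc_b_growth (hL : 0 < L) (hb : ∀ x y, ‖b x - b y‖ ≤ L * ‖x - y‖)
    (x : EuclideanSpace ℝ (Fin d)) : ‖b x‖ ≤ (‖b 0‖ + L) * (1 + ‖x‖) := by
  have h1 := hb x 0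
  rw [sub_zero] at h1
  have h2 := norm_sub_norm_le (b x) (b 0)
  nlinarith [norm_nonneg x, norm_nonneg (b 0), mul_nonneg (norm_nonneg x) (norm_nonneg (b 0))]

theorem smc_b_bound (hL : 0 < L) (hb : ∀ x y, ‖b x - b y‖ ≤ L * ‖x - y‖)
    (y : EuclideanSpace ℝ (Fin d)) (hy : ‖y‖ ≤ R) : ‖b y‖ ≤ (‖b 0‖ + L) * (1 + R) := by
  refine (smc_b_growth hL hb y).trans ?_
  gcongr

theorem smcQ_U (hL : 0 < L) (hb : ∀ x y, ‖b x - b y‖ ≤ L * ‖x - y‖)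
    (hU : ∀ x, HasFDerivAt U (innerSL ℝ (b x)) x) : smcQ (‖b 0‖ + L) U b :=
  ⟨hU, smc_b_cont hL hb, by positivity, smc_b_growth hL hb⟩

theorem smc_m_le (hB : ∀ y, ‖y‖ ≤ R → ‖b y‖ ≤ B) {t : ℝ} (ht : 0 < t) (htT : t ≤ T)
    (hR : ∀ᵐ y ∂ν, ‖y‖ ≤ R) : ∀ᵐ y ∂ν, ‖y + t • b y‖ ≤ R + T * B := by
  filter_upwards [hR] with y hy
  refine (norm_add_le _ _).trans ?_
  rw [norm_smul, Real.norm_of_nonneg ht.le]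
  have := hB y hy
  have h0 : 0 ≤ T := ht.le.trans htT
  gcongr

theorem smcQ_phi (hL : 0 < L) (hb : ∀ x y, ‖b x - b y‖ ≤ L * ‖x - y‖)
    (hU : ∀ x, HasFDerivAt U (innerSL ℝ (b x)) x) {t : ℝ} (ht : 0 < t) {R1 : ℝ} (hR1 : 0 ≤ R1)
    (hR : ∀ᵐ y ∂ν, ‖y + t • b y‖ ≤ R1) :
    smcQ ((1 + R1) / (2 * t) + (‖b 0‖ + L))
      (fun x => Real.log (smcRho ν (fun y => y + t • b y) t x) - U x)
      (fun x => (smcRho ν (fun y => y + t • b y) t x)⁻¹ • smcDRho ν (fun y => y + t • b y) t x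
        - b x) := by
  have hbc := smc_b_cont hL hb
  have hm : Continuous (fun y => y + t • b y) := by fun_prop
  have hpos := smcRho_pos (ν := ν) hm ht hR
  have hrc : Continuous (smcRho ν (fun y => y + t • b y) t) := (smcRho_contDiff hm ht).continuous
  have hDc := smcDRho_cont (ν := ν) hm ht
  refine ⟨fun x => ?_, ?_, by positivity, fun x => ?_⟩
  · have := ((smcRho_hasGrad (ν := ν) hm ht x).log (hpos x).ne').sub (hU x)
    rw [map_sub, map_smul]
    exact this
  · exact ((hrc.inv₀ fun x => (hpos x).ne').smul hDc).sub hbc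
  · refine (norm_sub_le _ _).trans ?_
    rw [norm_smul, norm_inv, Real.norm_of_nonneg (hpos x).le, add_mul]
    refine add_le_add ?_ (smc_b_growth hL hb x)
    have h1 := smcDRho_le (ν := ν) hm ht hR x
    have h2 : (smcRho ν (fun y => y + t • b y) t x)⁻¹ * ‖smcDRho ν (fun y => y + t • b y) t x‖ ≤
        (‖x‖ + R1) / (2 * t) := by
      rw [inv_mul_le_iff₀ (hpos x)]; linarith
    refine h2.trans ?_
    rw [div_mul_eq_mul_div]
    gcongr
    nlinarith [norm_nonneg x, mul_nonneg hR1 (norm_nonneg x)]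

theorem smc_rho_one (hbc : Continuous b) {t : ℝ} (ht : 0 < t) :
    Integrable (smcRho ν (fun y => y + t • b y) t) ∧
      ∫ x, smcRho ν (fun y => y + t • b y) t x = 1 := by
  have hm : Continuous (fun y => y + t • b y) := by fun_prop
  have := smc_single (ν := ν) hm ht (F := fun _ => 1) stronglyMeasurable_const (integrable_const _)
  simpa using this

/-- H at time t equals expectation -/
theorem smc_H_eq (hL : 0 < L) (hb : ∀ x y, ‖b x - b y‖ ≤ L * ‖x - y‖)
    (hR0 : 0 ≤ R) (hR : ∀ᵐ y ∂ν, ‖y‖ ≤ R) {t : ℝ} (ht : 0 < t)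
    {φ : EuclideanSpace ℝ (Fin d) → ℝ} {S : EuclideanSpace ℝ (Fin d) → EuclideanSpace ℝ (Fin d)}
    {K : ℝ} (h : smcQ K φ S) :
    Integrable (fun x => smcRho ν (fun y => y + t • b y) t x * φ x) ∧
    ∫ x, smcRho ν (fun y => y + t • b y) t x * φ x =
      ∫ p, φ (p.1 + t • b p.1 + √(2 * t) • p.2) ∂(ν.prod (smcG d)) := by
  have hbc := smc_b_cont hL hb
  have hm : Continuous (fun y => y + t • b y) := by fun_prop
  exact smc_single (ν := ν) hm ht h.cont.stronglyMeasurable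
    (h.int hbc (smc_b_bound hL hb) hR0 hR ht.le)

theorem smc_gibbs (hL : 0 < L) (hb : ∀ x y, ‖b x - b y‖ ≤ L * ‖x - y‖)
    (hU : ∀ x, HasFDerivAt U (innerSL ℝ (b x)) x)
    (hR0 : 0 ≤ R) (hR : ∀ᵐ y ∂ν, ‖y‖ ≤ R) {s t : ℝ} (hs : 0 < s) (ht : 0 < t) :
    ∫ p, (fun x => Real.log (smcRho ν (fun y => y + t • b y) t x) - U x)
      (p.1 + s • b p.1 + √(2 * s) • p.2) ∂(ν.prod (smcG d)) ≤ smcH ν U b s := by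
  have hbc := smc_b_cont hL hb
  have hB := smc_b_bound (R := R) hL hb
  have hB0 : 0 ≤ (‖b 0‖ + L) * (1 + R) := by positivity
  have q1 := smcQ_phi hL hb hU ht (R1 := R + t * ((‖b 0‖ + L) * (1 + R))) (by positivity)
    (smc_m_le (ν := ν) hB ht le_rfl hR)
  have q2 := smcQ_phi hL hb hU hs (R1 := R + s * ((‖b 0‖ + L) * (1 + R))) (by positivity)
    (smc_m_le (ν := ν) hB hs le_rfl hR)
  have e1 := smc_H_eq hL hb hR0 hR hs q1
  have e2 := smc_H_eq hL hb hR0 hR hs q2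
  rw [← e1.2]
  unfold smcH
  have o1 := smc_rho_one (ν := ν) hbc hs
  have o2 := smc_rho_one (ν := ν) hbc ht
  have key := integral_mono (o1.1.sub o2.1) (e2.1.sub e1.1) (fun x => by
    have p1 := smcRho_pos (ν := ν) (m := fun y => y + s • b y) (by fun_prop) hs
      (smc_m_le (ν := ν) hB hs le_rfl hR) x
    have p2 := smcRho_pos (ν := ν) (m := fun y => y + t • b y) (by fun_prop) ht
      (smc_m_le (ν := ν) hB ht le_rfl hR) x
    simp only [Pi.sub_apply]
    have h1 := Real.log_le_sub_one_of_pos (div_pos p2 p1)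
    rw [Real.log_div p2.ne' p1.ne'] at h1
    have h2 := mul_le_mul_of_nonneg_left h1 p1.le
    rw [mul_sub, mul_sub, mul_div_cancel₀ _ p1.ne'] at h2
    linarith)
  simp only [Pi.sub_apply] at key
  rw [integral_sub o1.1 o2.1, integral_sub e2.1 e1.1, o1.2, o2.2] at key
  linarith

end

section
variable {d : ℕ} {R L : ℝ} {π : EuclideanSpace ℝ (Fin d) → ℝ}
  {b : EuclideanSpace ℝ (Fin d) → EuclideanSpace ℝ (Fin d)}
  {ν : Measure (EuclideanSpace ℝ (Fin d))} [IsProbabilityMeasure ν]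

def smcLSI {d : ℕ} (π : EuclideanSpace ℝ (Fin d) → ℝ) (C : ℝ) : Prop :=
  ∀ ρ : EuclideanSpace ℝ (Fin d) → ℝ,
      (∀ x, 0 < ρ x) → ContDiff ℝ 1 ρ → Integrable ρ → (∫ x, ρ x) = 1 →
      Integrable (fun x => ρ x * Real.log (ρ x / π x)) →
      Integrable (fun x => ρ x * ‖gradient (fun y => Real.log (ρ y / π y)) x‖ ^ 2) →
      (∫ x, ρ x * Real.log (ρ x / π x)) ≤
        (C / 2) * ∫ x, ρ x * ‖gradient (fun y => Real.log (ρ y / π y)) x‖ ^ 2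

theorem smc_lsi_use (hL : 0 < L) (hb : ∀ x y, ‖b x - b y‖ ≤ L * ‖x - y‖)
    (hπpos : ∀ x, 0 < π x)
    (hU : ∀ x, HasFDerivAt (fun x => Real.log (π x)) (innerSL ℝ (b x)) x)
    {C : ℝ} (hC : 0 < C) (hLSI : smcLSI π C)
    (hR0 : 0 ≤ R) (hR : ∀ᵐ y ∂ν, ‖y‖ ≤ R) {t : ℝ} (ht : 0 < t) (htL : t * L ≤ 1 / 4) :
    ∃ g', HasDerivAt (fun s => ∫ p, (fun x => Real.log (smcRho ν (fun y => y + t • b y) t x) -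
      Real.log (π x)) (p.1 + s • b p.1 + √(2 * s) • p.2) ∂(ν.prod (smcG d))) g' t ∧
      g' ≤ - smcH ν (fun x => Real.log (π x)) b t / C + 4 * t * d * L ^ 2 := by
  have hbc := smc_b_cont hL hb
  have hB := smc_b_bound (R := R) hL hb
  have hB0 : 0 ≤ (‖b 0‖ + L) * (1 + R) := by positivity
  have hR1 := smc_m_le (ν := ν) hB ht le_rfl hR
  have hm : Continuous (fun y => y + t • b y) := by fun_prop
  have hpos := smcRho_pos (ν := ν) hm ht hR1
  have q1 := smcQ_phi hL hb hU ht (R1 := R + t * ((‖b 0‖ + L) * (1 + R))) (by positivity) hR1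
  refine ⟨_, q1.deriv hbc hB hR0 hR ht, ?_⟩
  refine (smc_deriv_bound hL hb hbc (smc_b_growth hL hb) hR0 hR ht htL q1.2.1 q1.2.2.2
    (fun x => ?_)).trans ?_
  · rw [sub_add_cancel, smul_inv_smul₀ (hpos x).ne']
  have hlog : (fun x => Real.log (smcRho ν (fun y => y + t • b y) t x / π x)) = 
      fun x => Real.log (smcRho ν (fun y => y + t • b y) t x) - Real.log (π x) :=
    funext fun x => Real.log_div (hpos x).ne' (hπpos x).ne'
  have e1 := smc_H_eq hL hb hR0 hR ht q1
  have o1 := smc_rho_one (ν := ν) hbc ht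
  have hgrad : ∀ x, gradient (fun x => Real.log (smcRho ν (fun y => y + t • b y) t x / π x)) x =
      (smcRho ν (fun y => y + t • b y) t x)⁻¹ • smcDRho ν (fun y => y + t • b y) t x - b x := by
    intro x
    rw [hlog]
    refine HasGradientAt.gradient ?_
    rw [hasGradientAt_iff_hasFDerivAt]
    exact q1.1 x
  have ly : smcLG (d := d) R (fun p => p.1) := smcLG_fst hR0
  have lz : smcLG (d := d) R (fun p => p.2) := smcLG_snd
  have lby : smcLG R (fun p => b p.1) := ly.comp hbc (smc_b_growth hL hb)
  have lx : smcLG R (fun p => p.1 + t • b p.1 + √(2 * t) • p.2) :=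
    (ly.add (lby.smul t)).add (lz.smul _)
  have lS := lx.comp q1.2.1 q1.2.2.2
  have hSc := q1.2.1
  have e2 := smc_single (ν := ν) hm ht
    (F := fun x => inner ℝ ((smcRho ν (fun y => y + t • b y) t x)⁻¹ • smcDRho ν (fun y => y + t • b y) t x - b x)
      ((smcRho ν (fun y => y + t • b y) t x)⁻¹ • smcDRho ν (fun y => y + t • b y) t x - b x))
    (hSc.inner hSc).stronglyMeasurable (lS.inner_int lS hR)
  have h := hLSI _ hpos (smcRho_contDiff hm ht) o1.1 o1.2 (by
    have := e1.1
    simp_rw [Real.log_div (hpos _).ne' (hπpos _).ne']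
    exact this) (by
    simp_rw [hgrad, ← real_inner_self_eq_norm_sq]
    exact e2.1)
  simp_rw [hgrad, ← real_inner_self_eq_norm_sq] at h
  rw [e2.2] at h
  simp_rw [Real.log_div (hpos _).ne' (hπpos _).ne'] at h
  change smcH ν (fun x => Real.log (π x)) b t ≤ C / 2 * smcIp ν _ _ at h
  gcongr
  rw [neg_div, neg_mul, neg_le_neg_iff, div_le_iff₀ hC]
  linarith

theorem smc_flow (hL : 0 < L) (hb : ∀ x y, ‖b x - b y‖ ≤ L * ‖x - y‖)
    (hπpos : ∀ x, 0 < π x)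
    (hU : ∀ x, HasFDerivAt (fun x => Real.log (π x)) (innerSL ℝ (b x)) x)
    {C : ℝ} (hC : 0 < C) (hLSI : smcLSI π C)
    (hR0 : 0 ≤ R) (hR : ∀ᵐ y ∂ν, ‖y‖ ≤ R) {γ : ℝ} (hγ : 0 < γ) (hγL : γ * L ≤ 1 / 4) {H0 : ℝ}
    (hstart : ∀ ε, 0 < ε → ∀ᶠ t in nhdsWithin 0 (Set.Ioi 0),
      smcH ν (fun x => Real.log (π x)) b t ≤ H0 + ε) :
    smcH ν (fun x => Real.log (π x)) b γ ≤ Real.exp (-(γ / C)) * H0 + 2 * γ ^ 2 * d * L ^ 2 := by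
  have hbc := smc_b_cont hL hb
  have hB := smc_b_bound (R := R) hL hb
  have hB0 : 0 ≤ (‖b 0‖ + L) * (1 + R) := by positivity
  set H := smcH ν (fun x => Real.log (π x)) b with hH
  set q := 2 * d * L ^ 2 * Real.exp (γ / C) with hq
  have hq0 : 0 ≤ q := by positivity
  have hval : ∀ t, 0 < t → ∫ p, (fun x => Real.log (smcRho ν (fun y => y + t • b y) t x) -
      Real.log (π x)) (p.1 + t • b p.1 + √(2 * t) • p.2) ∂(ν.prod (smcG d)) = H t := by
    intro t ht
    have hR1 := smc_m_le (ν := ν) hB ht le_rfl hR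
    have q1 := smcQ_phi hL hb hU ht (R1 := R + t * ((‖b 0‖ + L) * (1 + R))) (by positivity) hR1
    exact (smc_H_eq hL hb hR0 hR ht q1).2.symm
  have mono : ∀ a, 0 < a → a ≤ γ →
      Real.exp (γ / C) * H γ - q * γ ^ 2 ≤ Real.exp (a / C) * H a - q * a ^ 2 := by
    intro a ha haγ
    refine smc_real_induction (G := fun t => Real.exp (t / C) * H t - q * t ^ 2) ?_ ?_ ha haγ
    · intro t ht htγ
      obtain ⟨g', hg, hg'⟩ := smc_lsi_use (ν := ν) hL hb hπpos hU hC hLSI hR0 hR ht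
        (le_trans (by gcongr) hγL)
      have hexp : HasDerivAt (fun s : ℝ => Real.exp (s / C)) (Real.exp (t / C) * (1 / C)) t :=
        ((hasDerivAt_id t).div_const C).exp
      have hd := (hexp.mul hg).sub (((hasDerivAt_id t).pow 2).const_mul q)
      refine ⟨_, _, hd, ?_, ?_, ?_⟩
      · rw [hval t ht]
        simp only [id]
        have h1 : Real.exp (t / C) * g' ≤ Real.exp (t / C) * (- H t / C + 4 * t * d * L ^ 2) := by
          gcongr
        have h2 : Real.exp (t / C) * (4 * t * d * L ^ 2) ≤ Real.exp (γ / C) * (4 * t * d * L ^ 2) := by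
          gcongr
        have h3 : Real.exp (t / C) * (1 / C) * H t + Real.exp (t / C) * (- H t / C + 4 * t * d * L ^ 2) =
          Real.exp (t / C) * (4 * t * d * L ^ 2) := by ring
        norm_num
        rw [hq]
        norm_num at h3
        linarith
      · simp only [Pi.sub_apply, Pi.mul_apply, Pi.pow_apply, id]
        rw [hval t ht]
      · intro s hs _
        simp only [Pi.sub_apply, Pi.mul_apply, Pi.pow_apply, id]
        have := smc_gibbs (ν := ν) hL hb hU hR0 hR hs ht
        gcongr
    · intro c hc hcγ ε hε
      obtain ⟨W, hW, hlip⟩ := smc_lip (ν := ν) hbc hB hR0 hR hγ.le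
      set R1 := R + γ * ((‖b 0‖ + L) * (1 + R)) with hR1
      have hR10 : 0 ≤ R1 := by positivity
      set Kc := (1 + R1) / (2 * c) + (‖b 0‖ + L) with hKc
      have hcont : Continuous (fun t => Real.exp (t / C) *
          (H c + W * Kc * (|t - c| + |√(2 * t) - √(2 * c)|)) - q * t ^ 2) := by fun_prop
      have hlt : Real.exp (c / C) * (H c + W * Kc * (|c - c| + |√(2 * c) - √(2 * c)|)) - q * c ^ 2 <
          Real.exp (c / C) * H c - q * c ^ 2 + ε := by simp [hε]
      have hev := (hcont.tendsto c).eventually (gt_mem_nhds hlt)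
      have hev2 : ∀ᶠ t in nhdsWithin c (Set.Ioi c), t < γ :=
        (gt_mem_nhds hcγ).filter_mono nhdsWithin_le_nhds
      filter_upwards [hev.filter_mono nhdsWithin_le_nhds, hev2, self_mem_nhdsWithin] with t h1 h2 h3
      have h3 : c < t := h3
      have ht : 0 < t := hc.trans h3
      refine le_trans ?_ h1.le
      have q1 := smcQ_phi hL hb hU ht hR10 (smc_m_le (ν := ν) hB ht h2.le hR)
      have h4 := hlip _ _ _ q1 c t hc.le hcγ.le ht.le h2.le
      rw [hval t ht] at h4
      have h5 := smc_gibbs (ν := ν) hL hb hU hR0 hR hc ht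
      have h6 := (abs_le.mp h4).2
      have h7 : W * ((1 + R1) / (2 * t) + (‖b 0‖ + L)) * (|t - c| + |√(2 * t) - √(2 * c)|) ≤
        W * Kc * (|t - c| + |√(2 * t) - √(2 * c)|) := by
        rw [hKc]; gcongr
      gcongr
      change _ ≤ H c at h5
      linarith
  have hfin : ∀ ε, 0 < ε → Real.exp (γ / C) * H γ - q * γ ^ 2 ≤ H0 + ε := by
    intro ε hε
    have hlim : Filter.Tendsto (fun a : ℝ => Real.exp (a / C) * (H0 + ε))
        (nhdsWithin 0 (Set.Ioi 0)) (nhds (Real.exp (0 / C) * (H0 + ε))) :=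
      (Continuous.tendsto (by fun_prop) 0).mono_left nhdsWithin_le_nhds
    rw [zero_div, Real.exp_zero, one_mul] at hlim
    refine ge_of_tendsto hlim ?_
    have hev2 : ∀ᶠ t in nhdsWithin (0 : ℝ) (Set.Ioi 0), t < γ :=
        (gt_mem_nhds hγ).filter_mono nhdsWithin_le_nhds
    filter_upwards [hstart ε hε, hev2, self_mem_nhdsWithin] with a h1 h2 h3
    have h3 : 0 < a := h3
    have h4 := mono a h3 h2.le
    have h5 : Real.exp (a / C) * H a ≤ Real.exp (a / C) * (H0 + ε) := by gcongr
    have h6 : 0 ≤ q * a ^ 2 := by positivity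
    linarith
  have h1 := le_of_forall_pos_le_add hfin
  have h2 := mul_le_mul_of_nonneg_left h1 (Real.exp_pos (-(γ / C))).le
  have h3 : Real.exp (-(γ / C)) * Real.exp (γ / C) = 1 := by rw [← Real.exp_add]; simp
  have h4 : Real.exp (-(γ / C)) * (Real.exp (γ / C) * H γ - q * γ ^ 2) =
    H γ - 2 * γ ^ 2 * d * L ^ 2 := by
    rw [hq]
    linear_combination (H γ - 2 * d * L ^ 2 * γ ^ 2) * h3
  linarith
end

section
variable {d : ℕ} {R L : ℝ} {U : EuclideanSpace ℝ (Fin d) → ℝ}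
  {b : EuclideanSpace ℝ (Fin d) → EuclideanSpace ℝ (Fin d)}
  {ρ₀ : EuclideanSpace ℝ (Fin d) → ℝ}
  {ν : Measure (EuclideanSpace ℝ (Fin d))} [IsProbabilityMeasure ν]

/-- density ratio weight -/
noncomputable def smcWt {d : ℕ} (ρ₀ ρ : EuclideanSpace ℝ (Fin d) → ℝ)
    (m : EuclideanSpace ℝ (Fin d) → EuclideanSpace ℝ (Fin d)) (t : ℝ)
    (p : EuclideanSpace ℝ (Fin d) × EuclideanSpace ℝ (Fin d)) : ℝ :=
  Real.log (ρ₀ p.1) + (‖p.2 - p.1‖ ^ 2 - ‖p.2 - m p.1‖ ^ 2) / (4 * t) - Real.log (ρ p.2)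

theorem smc_exp_lint (hρ₀ : Measurable ρ₀) (h0 : ∀ y, 0 ≤ ρ₀ y)
    (hν : ν = volume.withDensity (fun y => ENNReal.ofReal (ρ₀ y)))
    {m : EuclideanSpace ℝ (Fin d) → EuclideanSpace ℝ (Fin d)} (hm : Continuous m)
    {ρ : EuclideanSpace ℝ (Fin d) → ℝ} (hρ : Continuous ρ) (hρpos : ∀ x, 0 < ρ x)
    (hρi : Integrable ρ) (hρ1 : ∫ x, ρ x = 1) {t : ℝ} (ht : 0 < t) :
    ∫⁻ p, ENNReal.ofReal (Real.exp (- smcWt ρ₀ ρ m t (p.1, m p.1 + √(2 * t) • p.2)))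
      ∂(ν.prod (smcG d)) ≤ 1 := by
  have cK := smcK_cont (d := d) t
  have hWm : Measurable (fun p => ENNReal.ofReal (Real.exp (- smcWt ρ₀ ρ m t p))) := by
    unfold smcWt
    have h1 : Measurable (fun p : EuclideanSpace ℝ (Fin d) × EuclideanSpace ℝ (Fin d) =>
      Real.log (ρ₀ p.1)) := by fun_prop
    have h2 : Measurable (fun p : EuclideanSpace ℝ (Fin d) × EuclideanSpace ℝ (Fin d) =>
      (‖p.2 - p.1‖ ^ 2 - ‖p.2 - m p.1‖ ^ 2) / (4 * t)) := Continuous.measurable (by fun_prop)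
    have h3 : Measurable (fun p : EuclideanSpace ℝ (Fin d) × EuclideanSpace ℝ (Fin d) =>
      Real.log (ρ p.2)) := (hρ.measurable.comp measurable_snd).log
    exact ((h1.add h2).sub h3).neg.exp.ennreal_ofReal
  have hpm : Measurable (fun p : EuclideanSpace ℝ (Fin d) × EuclideanSpace ℝ (Fin d) =>
      (p.1, m p.1 + √(2 * t) • p.2)) := Continuous.measurable (by fun_prop)
  have hKm : Measurable (fun p : EuclideanSpace ℝ (Fin d) × EuclideanSpace ℝ (Fin d) =>
        ENNReal.ofReal (smcK t (p.2 - m p.1))) :=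
    (Continuous.measurable (by fun_prop)).ennreal_ofReal
  rw [← lintegral_map hWm hpm, ← smc_joint_measure (ν := ν) hm ht,
    lintegral_withDensity_eq_lintegral_mul _ hKm hWm, lintegral_prod _ (hKm.mul hWm).aemeasurable]
  have hmeas2 : Measurable (fun y => ∫⁻ x, ENNReal.ofReal (smcK t (x - m y)) *
      ENNReal.ofReal (Real.exp (- smcWt ρ₀ ρ m t (y, x)))) :=
    Measurable.lintegral_prod_right' (hKm.mul hWm)
  have hρ₀m : Measurable (fun y => ENNReal.ofReal (ρ₀ y)) := hρ₀.ennreal_ofReal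
  simp only [Pi.mul_apply]
  rw [hν, lintegral_withDensity_eq_lintegral_mul _ hρ₀m hmeas2]
  simp only [Pi.mul_apply]
  calc ∫⁻ y, ENNReal.ofReal (ρ₀ y) * ∫⁻ x, ENNReal.ofReal (smcK t (x - m y)) *
      ENNReal.ofReal (Real.exp (- smcWt ρ₀ ρ m t (y, x)))
      ≤ ∫⁻ y, ∫⁻ x, ENNReal.ofReal (ρ x) * ENNReal.ofReal (smcK t (y - x)) := by
        refine lintegral_mono fun y => ?_
        rw [← lintegral_const_mul' _ _ ENNReal.ofReal_ne_top]
        refine lintegral_mono fun x => ?_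
        have hk := smcK_pos ht (x - m y)
        simp only
        rw [← ENNReal.ofReal_mul hk.le, ← ENNReal.ofReal_mul (h0 y), ← ENNReal.ofReal_mul (hρpos x).le]
        refine ENNReal.ofReal_le_ofReal ?_
        rcases (h0 y).eq_or_lt with h | h
        · rw [← h, zero_mul]
          exact mul_nonneg (hρpos x).le (smcK_pos ht _).le
        · refine le_of_eq ?_
          unfold smcWt smcK
          simp only
          rw [show -(Real.log (ρ₀ y) + (‖x - y‖ ^ 2 - ‖x - m y‖ ^ 2) / (4 * t) - Real.log (ρ x)) =
            Real.log (ρ x) - Real.log (ρ₀ y) + (-‖x - y‖ ^ 2 / (4 * t) - -‖x - m y‖ ^ 2 / (4 * t))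
            by ring, Real.exp_add, Real.exp_sub, Real.exp_log h, Real.exp_log (hρpos x),
            Real.exp_sub, norm_sub_rev y x]
          have := Real.exp_pos (-‖x - m y‖ ^ 2 / (4 * t))
          field_simp
    _ = ∫⁻ x, ∫⁻ y, ENNReal.ofReal (ρ x) * ENNReal.ofReal (smcK t (y - x)) := by
        refine lintegral_lintegral_swap (Measurable.aemeasurable ?_)
        exact ((hρ.measurable.comp measurable_snd).ennreal_ofReal).mul
          ((Continuous.measurable (by fun_prop)).ennreal_ofReal)
    _ = ∫⁻ x, ENNReal.ofReal (ρ x) := by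
        refine lintegral_congr fun x => ?_
        rw [lintegral_const_mul' _ _ ENNReal.ofReal_ne_top,
          lintegral_sub_right_eq_self (fun y => ENNReal.ofReal (smcK t y)) x, smcK_lint ht, mul_one]
    _ = 1 := by
        rw [← ofReal_integral_eq_lintegral_ofReal hρi
          (Filter.Eventually.of_forall fun u => (hρpos u).le), hρ1]
        simp
    _ ≤ 1 := le_rfl

theorem smc_start_ineq (hL : 0 < L) (hb : ∀ x y, ‖b x - b y‖ ≤ L * ‖x - y‖)
    (hU : ∀ x, HasFDerivAt U (innerSL ℝ (b x)) x)
    (hρ₀ : Measurable ρ₀) (h0 : ∀ y, 0 ≤ ρ₀ y)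
    (hν : ν = volume.withDensity (fun y => ENNReal.ofReal (ρ₀ y)))
    (hlog : Integrable (fun y => Real.log (ρ₀ y)) ν)
    (hR0 : 0 ≤ R) (hR : ∀ᵐ y ∂ν, ‖y‖ ≤ R) {t : ℝ} (ht : 0 < t) :
    smcH ν U b t ≤ ∫ y, Real.log (ρ₀ y) ∂ν + t / 4 * smcIp ν (fun p => b p.1) (fun p => b p.1) -
      ∫ p, U (p.1 + t • b p.1 + √(2 * t) • p.2) ∂(ν.prod (smcG d)) := by
  have hbc := smc_b_cont hL hb
  have hB := smc_b_bound (R := R) hL hb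
  have hB0 : 0 ≤ (‖b 0‖ + L) * (1 + R) := by positivity
  have hR1 := smc_m_le (ν := ν) hB ht le_rfl hR
  have hm : Continuous (fun y => y + t • b y) := by fun_prop
  have hpos := smcRho_pos (ν := ν) hm ht hR1
  have hrc : Continuous (smcRho ν (fun y => y + t • b y) t) := (smcRho_contDiff hm ht).continuous
  have o1 := smc_rho_one (ν := ν) hbc ht
  have q1 := smcQ_phi hL hb hU ht (R1 := R + t * ((‖b 0‖ + L) * (1 + R))) (by positivity) hR1
  have qU := smcQ_U hL hb hU
  have i1 := q1.int hbc hB hR0 hR ht.le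
  have iU := qU.int (ν := ν) hbc hB hR0 hR ht.le
  have e1 : smcH ν U b t = _ := (smc_H_eq hL hb hR0 hR ht q1).2
  have hlint := smc_exp_lint hρ₀ h0 hν hm hrc hpos o1.1 o1.2 ht
  have ly : smcLG (d := d) R (fun p => p.1) := smcLG_fst hR0
  have lz : smcLG (d := d) R (fun p => p.2) := smcLG_snd
  have lby : smcLG R (fun p => b p.1) := ly.comp hbc (smc_b_growth hL hb)
  have ibb := lby.inner_int lby hR
  have ibz := lby.inner_int lz hR
  have hyz : smcIp ν (fun p => b p.1) (fun p => p.2) = 0 := smcIp_fst_snd hR lby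
  have ilog : Integrable (fun p : EuclideanSpace ℝ (Fin d) × EuclideanSpace ℝ (Fin d) =>
    Real.log (ρ₀ p.1)) (ν.prod (smcG d)) := hlog.comp_fst _
  set m := fun y => y + t • b y with hmdef
  set ρ := smcRho ν m t with hρdef
  have hW : (fun p : EuclideanSpace ℝ (Fin d) × EuclideanSpace ℝ (Fin d) =>
      smcWt ρ₀ ρ m t (p.1, m p.1 + √(2 * t) • p.2)) = fun p =>
      Real.log (ρ₀ p.1) + (t / 4 * inner ℝ (b p.1) (b p.1) + √(2 * t) / 2 * inner ℝ (b p.1) p.2) -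
       ((Real.log (ρ (p.1 + t • b p.1 + √(2 * t) • p.2)) - U (p.1 + t • b p.1 + √(2 * t) • p.2)) +
        U (p.1 + t • b p.1 + √(2 * t) • p.2)) := by
    ext p
    unfold smcWt
    simp only [hmdef]
    rw [sub_add_cancel]
    congr 2
    rw [add_sub_cancel_left, show p.1 + t • b p.1 + √(2 * t) • p.2 - p.1 = t • b p.1 + √(2 * t) • p.2 by abel,
      norm_add_sq_real, norm_smul, inner_smul_left, inner_smul_right, real_inner_self_eq_norm_sq,
      Real.norm_of_nonneg ht.le]
    simp only [conj_trivial]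
    field_simp
    ring
  have iW : Integrable (fun p : EuclideanSpace ℝ (Fin d) × EuclideanSpace ℝ (Fin d) =>
      smcWt ρ₀ ρ m t (p.1, m p.1 + √(2 * t) • p.2)) (ν.prod (smcG d)) := by
    rw [hW]
    exact (ilog.add ((ibb.const_mul _).add (ibz.const_mul _))).sub (i1.add iU)
  have vW : ∫ p, smcWt ρ₀ ρ m t (p.1, m p.1 + √(2 * t) • p.2) ∂(ν.prod (smcG d)) =
      ∫ y, Real.log (ρ₀ y) ∂ν + t / 4 * smcIp ν (fun p => b p.1) (fun p => b p.1) -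
      (smcH ν U b t + ∫ p, U (p.1 + t • b p.1 + √(2 * t) • p.2) ∂(ν.prod (smcG d))) := by
    rw [e1, ← integral_add i1 iU]
    simp only [hW]
    rw [integral_sub, integral_add ilog, integral_add (ibb.const_mul _) (ibz.const_mul _),
      integral_const_mul, integral_const_mul]
    · change _ + (t / 4 * smcIp ν (fun p => b p.1) (fun p => b p.1) + _ * smcIp ν (fun p => b p.1) (fun p => p.2)) - _ = _
      rw [hyz, integral_fun_fst (μ := ν) (ν := smcG d) (fun y => Real.log (ρ₀ y))]
      simp
    · exact (ibb.const_mul _).add (ibz.const_mul _)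
    · exact ilog.add ((ibb.const_mul _).add (ibz.const_mul _))
    · exact i1.add iU
  have iE : Integrable (fun p : EuclideanSpace ℝ (Fin d) × EuclideanSpace ℝ (Fin d) =>
      Real.exp (- smcWt ρ₀ ρ m t (p.1, m p.1 + √(2 * t) • p.2))) (ν.prod (smcG d)) := by
    refine ⟨Real.continuous_exp.comp_aestronglyMeasurable iW.1.neg, ?_⟩
    rw [hasFiniteIntegral_iff_ofReal (Filter.Eventually.of_forall fun p => (Real.exp_pos _).le)]
    exact hlint.trans_lt ENNReal.one_lt_top
  have vE : ∫ p, Real.exp (- smcWt ρ₀ ρ m t (p.1, m p.1 + √(2 * t) • p.2)) ∂(ν.prod (smcG d)) ≤ 1 := by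
    rw [integral_eq_lintegral_of_nonneg_ae (Filter.Eventually.of_forall fun p => (Real.exp_pos _).le) iE.1]
    exact ENNReal.toReal_le_of_le_ofReal zero_le_one (by simpa using hlint)
  have key := integral_mono (iW.neg.add (integrable_const 1)) iE (fun p => by
    simpa using Real.add_one_le_exp (- smcWt ρ₀ ρ m t (p.1, m p.1 + √(2 * t) • p.2)))
  have hk : ∫ p, - smcWt ρ₀ ρ m t (p.1, m p.1 + √(2 * t) • p.2) + 1 ∂(ν.prod (smcG d)) =
      - ∫ p, smcWt ρ₀ ρ m t (p.1, m p.1 + √(2 * t) • p.2) ∂(ν.prod (smcG d)) + 1 := by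
    have h1 := integral_add iW.neg (integrable_const (1 : ℝ))
    simp only [Pi.neg_apply, integral_neg, integral_const, probReal_univ, one_smul] at h1
    exact h1
  have key2 := hk.symm.le.trans key
  rw [vW] at key2
  linarith

theorem smc_start (hL : 0 < L) (hb : ∀ x y, ‖b x - b y‖ ≤ L * ‖x - y‖)
    (hU : ∀ x, HasFDerivAt U (innerSL ℝ (b x)) x)
    (hρ₀ : Measurable ρ₀) (h0 : ∀ y, 0 ≤ ρ₀ y)
    (hν : ν = volume.withDensity (fun y => ENNReal.ofReal (ρ₀ y)))
    (hlog : Integrable (fun y => Real.log (ρ₀ y)) ν)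
    (hR0 : 0 ≤ R) (hR : ∀ᵐ y ∂ν, ‖y‖ ≤ R) :
    ∀ ε, 0 < ε → ∀ᶠ t in nhdsWithin 0 (Set.Ioi 0),
      smcH ν U b t ≤ (∫ y, Real.log (ρ₀ y) ∂ν - ∫ y, U y ∂ν) + ε := by
  intro ε hε
  have hbc := smc_b_cont hL hb
  have hB := smc_b_bound (R := R) hL hb
  obtain ⟨W, hW, hlip⟩ := smc_lip (ν := ν) hbc hB hR0 hR zero_le_one
  have qU := smcQ_U hL hb hU
  set A := smcIp ν (fun p => b p.1) (fun p => b p.1)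
  set K := ‖b 0‖ + L
  have hcont : Continuous (fun t : ℝ => t / 4 * A + W * K * (|t - 0| + |√(2 * t) - √(2 * 0)|)) := by
    fun_prop
  have hlt : (0 : ℝ) / 4 * A + W * K * (|(0 : ℝ) - 0| + |√(2 * 0) - √(2 * 0)|) < ε := by simp [hε]
  have hev := (hcont.tendsto 0).eventually (gt_mem_nhds hlt)
  have hev2 : ∀ᶠ t in nhdsWithin (0 : ℝ) (Set.Ioi 0), t < 1 :=
    (gt_mem_nhds one_pos).filter_mono nhdsWithin_le_nhds
  filter_upwards [hev.filter_mono nhdsWithin_le_nhds, hev2, self_mem_nhdsWithin] with t h1 h2 h3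
  have ht : 0 < t := h3
  have h4 := smc_start_ineq hL hb hU hρ₀ h0 hν hlog hR0 hR ht
  have h5 := (abs_le.mp (hlip _ _ _ qU 0 t le_rfl zero_le_one ht.le h2.le)).1
  have h6 : ∫ p, U (p.1 + (0 : ℝ) • b p.1 + √(2 * 0) • p.2) ∂(ν.prod (smcG d)) = ∫ y, U y ∂ν := by
    simp only [mul_zero, Real.sqrt_zero, zero_smul, add_zero]
    rw [integral_fun_fst (μ := ν) (ν := smcG d) U]
    simp
  rw [h6] at h5
  rw [show smcIp ν (fun p => b p.1) (fun p => b p.1) = A from rfl] at h4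
  clear hlt hev hcont
  generalize W * K * (|t - 0| + |√(2 * t) - √(2 * 0)|) = δ at h1 h5
  generalize t / 4 * A = δ' at h1 h4
  linarith
end

section
variable {d : ℕ} {L : ℝ} {π : EuclideanSpace ℝ (Fin d) → ℝ}
  {b : EuclideanSpace ℝ (Fin d) → EuclideanSpace ℝ (Fin d)} {f : EuclideanSpace ℝ (Fin d) → ℝ}

theorem smc_wd_int {ρ : EuclideanSpace ℝ (Fin d) → ℝ} (hρ : Measurable ρ) (h0 : ∀ y, 0 ≤ ρ y)
    (g : EuclideanSpace ℝ (Fin d) → ℝ) :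
    (Integrable g (volume.withDensity (fun y => ENNReal.ofReal (ρ y))) ↔
      Integrable (fun y => ρ y * g y)) ∧
    ∫ y, g y ∂(volume.withDensity (fun y => ENNReal.ofReal (ρ y))) = ∫ y, ρ y * g y := by
  constructor
  · rw [integrable_withDensity_iff_integrable_smul' hρ.ennreal_ofReal (by simp)]
    simp_rw [ENNReal.toReal_ofReal (h0 _), smul_eq_mul]
  · rw [integral_withDensity_eq_integral_toReal_smul hρ.ennreal_ofReal (by simp)]
    simp_rw [ENNReal.toReal_ofReal (h0 _), smul_eq_mul]

theorem smc_wd_prob {ρ : EuclideanSpace ℝ (Fin d) → ℝ} (h0 : ∀ y, 0 ≤ ρ y)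
    (hi : Integrable ρ) (h1 : ∫ y, ρ y = 1) :
    IsProbabilityMeasure (volume.withDensity (fun y => ENNReal.ofReal (ρ y))) := by
  constructor
  rw [withDensity_apply _ MeasurableSet.univ, Measure.restrict_univ,
    ← ofReal_integral_eq_lintegral_ofReal hi (Filter.Eventually.of_forall h0), h1]
  simp

theorem smc_trunc (hL : 0 < L) (hb : ∀ x y, ‖b x - b y‖ ≤ L * ‖x - y‖)
    (hπpos : ∀ x, 0 < π x)
    (hU : ∀ x, HasFDerivAt (fun x => Real.log (π x)) (innerSL ℝ (b x)) x)
    {C : ℝ} (hC : 0 < C) (hLSI : smcLSI π C)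
    {γ : ℝ} (hγ : 0 < γ) (hγL : γ * L ≤ 1 / 4)
    (hf : Measurable f) (hf0 : ∀ y, 0 ≤ f y) (hfi : Integrable f)
    (hfKL : Integrable (fun x => f x * Real.log (f x / π x)))
    {r c : ℝ} (hr : 0 ≤ r) (hc : c = ∫ y in Metric.closedBall 0 r, f y) (hc0 : 0 < c) :
    ∃ ρ : EuclideanSpace ℝ (Fin d) → ℝ,
      (∀ x, ρ x = c⁻¹ * ∫ y in Metric.closedBall 0 r, smcK γ (x - (y + γ • b y)) * f y) ∧
      Continuous ρ ∧ (∀ x, 0 < ρ x) ∧ Integrable ρ ∧ ∫ x, ρ x = 1 ∧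
      Integrable (fun x => ρ x * (Real.log (ρ x) - Real.log (π x))) ∧
      ∫ x, ρ x * (Real.log (ρ x) - Real.log (π x)) ≤
        Real.exp (-(γ / C)) * (c⁻¹ * (∫ y in Metric.closedBall 0 r, f y * Real.log (f y / π y)) -
          Real.log c) + 2 * γ ^ 2 * d * L ^ 2 := by
  set D : Set (EuclideanSpace ℝ (Fin d)) := Metric.closedBall 0 r with hD
  have hDm : MeasurableSet D := Metric.isClosed_closedBall.measurableSet
  set ρ₀ : EuclideanSpace ℝ (Fin d) → ℝ := fun y => c⁻¹ * D.indicator f y with hρ₀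
  have hρ₀m : Measurable ρ₀ := (hf.indicator hDm).const_mul _
  have hρ₀0 : ∀ y, 0 ≤ ρ₀ y := fun y => mul_nonneg (inv_pos.mpr hc0).le
    (Set.indicator_nonneg (fun y _ => hf0 y) y)
  have hρ₀i : Integrable ρ₀ := (hfi.indicator hDm).const_mul _
  have hρ₀1 : ∫ y, ρ₀ y = 1 := by
    rw [hρ₀, integral_const_mul, integral_indicator hDm, ← hc, inv_mul_cancel₀ hc0.ne']
  have hprob := smc_wd_prob hρ₀0 hρ₀i hρ₀1
  set ν := volume.withDensity (fun y => ENNReal.ofReal (ρ₀ y)) with hν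
  have hmul : ∀ g : EuclideanSpace ℝ (Fin d) → ℝ, (fun y => ρ₀ y * g y) =
      fun y => c⁻¹ * D.indicator (fun y => f y * g y) y := by
    intro g; ext y
    by_cases hy : y ∈ D <;> simp [hρ₀, hy, mul_assoc]
  have hR : ∀ᵐ y ∂ν, ‖y‖ ≤ r := by
    rw [hν, ae_withDensity_iff hρ₀m.ennreal_ofReal]
    refine Filter.Eventually.of_forall fun y hy => ?_
    by_contra hcon
    have : y ∉ D := by simpa [hD] using hcon
    simp [hρ₀, this] at hy
  have hbc := smc_b_cont hL hb
  have hm : Continuous (fun y => y + γ • b y) := by fun_prop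
  have hB := smc_b_bound (R := r) hL hb
  have hB0 : 0 ≤ (‖b 0‖ + L) * (1 + r) := by positivity
  have hR1 := smc_m_le (ν := ν) hB hγ le_rfl hR
  have qU := smcQ_U hL hb hU
  have iU : Integrable (fun x => Real.log (π x)) ν := by
    refine Integrable.of_bound qU.cont.aestronglyMeasurable
      (|Real.log (π 0)| + (‖b 0‖ + L) * (1 + r) * r) ?_
    filter_upwards [hR] with y hy
    rw [Real.norm_eq_abs]
    refine (qU.growth y).trans ?_
    gcongr
  have hid : (fun y => ρ₀ y * (Real.log (ρ₀ y) - Real.log (π y))) =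
      fun y => c⁻¹ * D.indicator (fun y => f y * Real.log (f y / π y) - Real.log c * f y) y := by
    ext y
    by_cases hy : y ∈ D
    · simp only [hρ₀, hy, Set.indicator_of_mem]
      rcases (hf0 y).eq_or_lt with h | h
      · simp [← h]
      · rw [Real.log_mul (inv_pos.mpr hc0).ne' h.ne', Real.log_inv, Real.log_div h.ne' (hπpos y).ne']
        ring
    · simp [hρ₀, hy]
  have iKL : Integrable (fun y => Real.log (ρ₀ y) - Real.log (π y)) ν := by
    rw [hν, (smc_wd_int hρ₀m hρ₀0 _).1, hid]
    exact ((hfKL.sub (hfi.const_mul _)).indicator hDm).const_mul _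
  have vKL : ∫ y, (Real.log (ρ₀ y) - Real.log (π y)) ∂ν =
      c⁻¹ * (∫ y in D, f y * Real.log (f y / π y)) - Real.log c := by
    rw [hν, (smc_wd_int hρ₀m hρ₀0 _).2, hid, integral_const_mul, integral_indicator hDm,
      integral_sub hfKL.integrableOn (hfi.const_mul _).integrableOn, integral_const_mul, ← hc]
    field_simp
  have ilog : Integrable (fun y => Real.log (ρ₀ y)) ν := by
    have := iKL.add iU
    refine this.congr (Filter.Eventually.of_forall fun y => ?_)
    simp
  have hst := smc_start (ν := ν) hL hb hU hρ₀m hρ₀0 hν ilog hr hR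
  rw [← integral_sub ilog iU, vKL] at hst
  have hfl := smc_flow (ν := ν) hL hb hπpos hU hC hLSI hr hR hγ hγL hst
  have q1 := smcQ_phi hL hb hU hγ (R1 := r + γ * ((‖b 0‖ + L) * (1 + r))) (by positivity) hR1
  have o1 := smc_rho_one (ν := ν) hbc hγ
  refine ⟨smcRho ν (fun y => y + γ • b y) γ, ?_, (smcRho_contDiff hm hγ).continuous,
    smcRho_pos hm hγ hR1, o1.1, o1.2, (smc_H_eq hL hb hr hR hγ q1).1, hfl⟩
  intro x
  unfold smcRho
  rw [hν, (smc_wd_int hρ₀m hρ₀0 _).2, hmul, integral_const_mul, integral_indicator hDm]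
  simp_rw [mul_comm (f _)]

theorem smc_fatou {F : ℕ → EuclideanSpace ℝ (Fin d) → ℝ} {G : EuclideanSpace ℝ (Fin d) → ℝ}
    {Bd : ℕ → ℝ} {β : ℝ} (hm : ∀ k, Measurable (F k)) (h0 : ∀ k x, 0 ≤ F k x)
    (hi : ∀ k, Integrable (F k)) (hB : ∀ k, ∫ x, F k x ≤ Bd k)
    (hβ : Filter.Tendsto Bd Filter.atTop (nhds β))
    (hpt : ∀ x, Filter.Tendsto (fun k => F k x) Filter.atTop (nhds (G x))) :
    Integrable G ∧ ∫ x, G x ≤ β := by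
  have hGm : Measurable G := measurable_of_tendsto_metrizable hm (tendsto_pi_nhds.mpr hpt)
  have hG0 : ∀ x, 0 ≤ G x := fun x => ge_of_tendsto' (hpt x) fun k => h0 k x
  have hβ0 : 0 ≤ β := ge_of_tendsto' hβ fun k => (integral_nonneg (h0 k)).trans (hB k)
  have hle : ∫⁻ x, ENNReal.ofReal (G x) ≤ ENNReal.ofReal β := by
    have h1 : ∀ x, ENNReal.ofReal (G x) =
        Filter.liminf (fun k => ENNReal.ofReal (F k x)) Filter.atTop := fun x =>
      ((ENNReal.continuous_ofReal.tendsto _).comp (hpt x)).liminf_eq.symm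
    simp_rw [h1]
    refine (lintegral_liminf_le fun k => (hm k).ennreal_ofReal).trans ?_
    have h2 : Filter.Tendsto (fun k => ENNReal.ofReal (Bd k)) Filter.atTop (nhds (ENNReal.ofReal β)) :=
      (ENNReal.continuous_ofReal.tendsto _).comp hβ
    rw [← h2.liminf_eq]
    refine Filter.liminf_le_liminf (Filter.Eventually.of_forall fun k => ?_)
    rw [← ofReal_integral_eq_lintegral_ofReal (hi k) (Filter.Eventually.of_forall (h0 k))]
    exact ENNReal.ofReal_le_ofReal (hB k)
  have hGi : Integrable G := by
    refine ⟨hGm.aestronglyMeasurable, ?_⟩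
    rw [hasFiniteIntegral_iff_ofReal (Filter.Eventually.of_forall hG0)]
    exact hle.trans_lt ENNReal.ofReal_lt_top
  refine ⟨hGi, ?_⟩
  rw [← ofReal_integral_eq_lintegral_ofReal hGi (Filter.Eventually.of_forall hG0)] at hle
  exact (ENNReal.ofReal_le_ofReal_iff hβ0).mp hle

theorem smc_ula (hL : 0 < L) (hb : ∀ x y, ‖b x - b y‖ ≤ L * ‖x - y‖)
    (hπpos : ∀ x, 0 < π x) (hπi : Integrable π) (hπ1 : ∫ x, π x = 1)
    (hU : ∀ x, HasFDerivAt (fun x => Real.log (π x)) (innerSL ℝ (b x)) x)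
    {C : ℝ} (hC : 0 < C) (hLSI : smcLSI π C)
    {γ : ℝ} (hγ : 0 < γ) (hγL : γ * L ≤ 1 / 4)
    (hf : Measurable f) (hf0 : ∀ y, 0 ≤ f y) (hfi : Integrable f) (hf1 : ∫ x, f x = 1)
    (hfKL : Integrable (fun x => f x * Real.log (f x / π x)))
    {h : EuclideanSpace ℝ (Fin d) → ℝ}
    (hh : ∀ x, h x = ∫ y, smcK γ (x - (y + γ • b y)) * f y) :
    (∀ x, 0 < h x) ∧ Integrable h ∧ ∫ x, h x = 1 ∧
      Integrable (fun x => h x * Real.log (h x / π x)) ∧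
      ∫ x, h x * Real.log (h x / π x) ≤
        Real.exp (-(γ / C)) * (∫ x, f x * Real.log (f x / π x)) + 2 * γ ^ 2 * d * L ^ 2 := by
  have hbc := smc_b_cont hL hb
  have hm : Continuous (fun y => y + γ • b y) := by fun_prop
  have cK := smcK_cont (d := d) γ
  have qU := smcQ_U hL hb hU
  have hπm : Measurable π := by
    have : π = fun x => Real.exp (Real.log (π x)) := funext fun x => (Real.exp_log (hπpos x)).symm
    rw [this]
    exact (Real.continuous_exp.comp qU.cont).measurable
  have hprob := smc_wd_prob hf0 hfi hf1
  have hrho : smcRho (volume.withDensity (fun y => ENNReal.ofReal (f y))) (fun y => y + γ • b y) γ = h := by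
    ext x
    rw [hh]
    unfold smcRho
    rw [(smc_wd_int hf hf0 _).2]
    simp_rw [mul_comm (f _)]
  have o1 := smc_rho_one (ν := volume.withDensity (fun y => ENNReal.ofReal (f y))) hbc hγ
  rw [hrho] at o1
  have hint : ∀ x, Integrable (fun y => smcK γ (x - (y + γ • b y)) * f y) := by
    intro x
    have := smcK_nu_int (ν := volume.withDensity (fun y => ENNReal.ofReal (f y))) hm hγ x
    rw [(smc_wd_int hf hf0 _).1] at this
    simpa only [mul_comm (f _)] using this
  have hpos : ∀ x, 0 < h x := by
    intro x
    rw [← hrho]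
    unfold smcRho
    rw [integral_pos_iff_support_of_nonneg (fun y => (smcK_pos hγ _).le) (smcK_nu_int hm hγ x)]
    have : Function.support (fun y => smcK γ (x - (y + γ • b y))) = Set.univ := by
      ext y; simp [(smcK_pos hγ _).ne']
    rw [this, measure_univ]
    exact one_pos
  -- truncation
  have hcov := aecover_closedBall (μ := (volume : Measure (EuclideanSpace ℝ (Fin d)))) (x := 0)
    (r := fun k : ℕ => (k : ℝ)) (l := Filter.atTop) tendsto_natCast_atTop_atTop
  have t1 := hcov.integral_tendsto_of_countably_generated hfi
  have t2 := hcov.integral_tendsto_of_countably_generated hfKL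
  have t3 := fun x => hcov.integral_tendsto_of_countably_generated (hint x)
  rw [hf1] at t1
  simp_rw [← hh] at t3
  obtain ⟨N, hN⟩ := Filter.eventually_atTop.mp (t1.eventually (lt_mem_nhds zero_lt_one))
  have hsh := Filter.tendsto_add_atTop_nat N
  choose ρ hρ1 hρ2 hρ3 hρ4 hρ5 hρ6 hρ7 using fun k : ℕ => smc_trunc hL hb hπpos hU hC hLSI hγ hγL hf hf0 hfi hfKL
    (r := ((k + N : ℕ) : ℝ)) (Nat.cast_nonneg _) rfl (hN (k + N) (by omega))
  have t1' := t1.comp hsh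
  have t1i := t1'.inv₀ one_ne_zero
  have hρlim : ∀ x, Filter.Tendsto (fun k => ρ k x) Filter.atTop (nhds (h x)) := by
    intro x
    have := t1i.mul ((t3 x).comp hsh)
    rw [inv_one, one_mul] at this
    refine this.congr fun k => ?_
    rw [hρ1]; rfl
  have hBd : Filter.Tendsto (fun k : ℕ => Real.exp (-(γ / C)) *
      ((∫ y in Metric.closedBall 0 ((k + N : ℕ) : ℝ), f y)⁻¹ *
        (∫ y in Metric.closedBall 0 ((k + N : ℕ) : ℝ), f y * Real.log (f y / π y)) -
          Real.log (∫ y in Metric.closedBall 0 ((k + N : ℕ) : ℝ), f y)) + 2 * γ ^ 2 * d * L ^ 2) Filter.atTop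
      (nhds (Real.exp (-(γ / C)) * (∫ x, f x * Real.log (f x / π x)) + 2 * γ ^ 2 * d * L ^ 2)) := by
    have := (((t1i.mul (t2.comp hsh)).sub (t1'.log one_ne_zero)).const_mul
      (Real.exp (-(γ / C)))).add_const (2 * γ ^ 2 * d * L ^ 2)
    rw [inv_one, one_mul, Real.log_one, sub_zero] at this
    exact this
  have hF := smc_fatou
    (F := fun k x => ρ k x * (Real.log (ρ k x) - Real.log (π x)) - ρ k x + π x)
    (G := fun x => h x * (Real.log (h x) - Real.log (π x)) - h x + π x)
    (fun k => by
      have := (hρ2 k).measurable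
      fun_prop) (fun k x => by
      have h1 := Real.log_le_sub_one_of_pos (div_pos (hπpos x) (hρ3 k x))
      rw [Real.log_div (hπpos x).ne' (hρ3 k x).ne'] at h1
      have h2 := mul_le_mul_of_nonneg_left h1 (hρ3 k x).le
      rw [mul_sub, mul_sub, mul_div_cancel₀ _ (hρ3 k x).ne'] at h2
      linarith) (fun k => ((hρ6 k).sub (hρ4 k)).add hπi) (fun k => by
      have e1 := integral_add ((hρ6 k).sub (hρ4 k)) hπi
      have e2 := integral_sub (hρ6 k) (hρ4 k)
      simp only [Pi.sub_apply] at e1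
      rw [e1, e2, hρ5, hπ1, sub_add_cancel]
      exact hρ7 k) hBd (fun x => by
      have := hρlim x
      exact ((this.mul ((this.log (hpos x).ne').sub_const _)).sub this).add_const _)
  have i1 : Integrable (fun x => h x * (Real.log (h x) - Real.log (π x))) := by
    refine ((hF.1.sub hπi).add o1.1).congr (Filter.Eventually.of_forall fun x => ?_)
    simp
  simp_rw [Real.log_div (hpos _).ne' (hπpos _).ne']
  refine ⟨hpos, o1.1, o1.2, i1, ?_⟩
  have e1 := integral_add (i1.sub o1.1) hπi
  have e2 := integral_sub i1 o1.1
  simp only [Pi.sub_apply] at e1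
  have e3 := hF.2
  rw [e1, e2, o1.2, hπ1, sub_add_cancel] at e3
  exact e3
end

theorem smc_xlog {x y : ℝ} (hx : 0 < x) (hy : 0 < y) : x - y ≤ x * Real.log (x / y) := by
  have h := Real.log_le_sub_one_of_pos (div_pos hy hx)
  have e : Real.log (x / y) = - Real.log (y / x) := by rw [← Real.log_inv, inv_div]
  rw [e]
  have : x * Real.log (y / x) ≤ x * (y / x - 1) := by gcongr
  have e2 : x * (y / x - 1) = y - x := by field_simp
  linarith

theorem smc_fr {X : Type*} [MeasurableSpace X] {m : Measure X} {p π q : X → ℝ} {τ Z : ℝ}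
    (hp : ∀ x, 0 < p x) (hpi : Integrable p m) (hp1 : ∫ x, p x ∂m = 1)
    (hpKL : Integrable (fun x => p x * Real.log (p x / π x)) m)
    (hπ : ∀ x, 0 < π x) (hπi : Integrable π m) (hπ1 : ∫ x, π x ∂m = 1)
    (h0 : 0 < τ) (h1 : τ < 1)
    (hZ : Z = ∫ x, p x ^ τ * π x ^ (1 - τ) ∂m)
    (hq : ∀ x, q x = p x ^ τ * π x ^ (1 - τ) / Z) :
    (∀ x, 0 < q x) ∧ Integrable q m ∧ ∫ x, q x ∂m = 1 ∧
    Integrable (fun x => q x * Real.log (q x / π x)) m ∧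
    ∫ x, q x * Real.log (q x / π x) ∂m ≤ ∫ x, p x * Real.log (p x / π x) ∂m := by
  set w : X → ℝ := fun x => p x ^ τ * π x ^ (1 - τ) with hw
  have hwpos : ∀ x, 0 < w x := fun x =>
    mul_pos (Real.rpow_pos_of_pos (hp x) _) (Real.rpow_pos_of_pos (hπ x) _)
  have hwm : AEStronglyMeasurable w m :=
    ((hpi.1.aemeasurable.pow_const τ).mul (hπi.1.aemeasurable.pow_const (1 - τ))).aestronglyMeasurable
  have hwi : Integrable w m := by
    refine ((hpi.const_mul τ).add (hπi.const_mul (1 - τ))).mono' hwm (ae_of_all _ fun x => ?_)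
    rw [Real.norm_of_nonneg (hwpos x).le]
    exact Real.geom_mean_le_arith_mean2_weighted h0.le (by linarith) (hp x).le (hπ x).le (by ring)
  have hm : m ≠ 0 := by
    rintro rfl
    simp at hp1
  have hZpos : 0 < Z := by
    rw [hZ, integral_pos_iff_support_of_nonneg (fun x => (hwpos x).le) hwi]
    have : Function.support w = Set.univ := by
      ext x; simp [(hwpos x).ne']
    change 0 < m (Function.support w)
    rw [this]
    exact (Measure.measure_univ_pos).2 hm
  have hqe : q = fun x => w x / Z := funext hq
  have hqpos : ∀ x, 0 < q x := fun x => by rw [hqe]; exact div_pos (hwpos x) hZpos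
  have hqi : Integrable q m := by rw [hqe]; exact hwi.div_const _
  have hq1 : ∫ x, q x ∂m = 1 := by
    rw [hqe, integral_div]
    change (∫ x, p x ^ τ * π x ^ (1 - τ) ∂m) / Z = 1
    rw [← hZ]; exact div_self hZpos.ne'
  set u : X → ℝ := fun x => Real.log (p x / π x) with hu
  have hue : ∀ x, u x = Real.log (p x) - Real.log (π x) := fun x =>
    Real.log_div (hp x).ne' (hπ x).ne'
  have hum : AEStronglyMeasurable u m :=
    (Real.measurable_log.comp_aemeasurable
      (hpi.1.aemeasurable.div hπi.1.aemeasurable)).aestronglyMeasurable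
  have hlw : ∀ x, Real.log (w x) = τ * Real.log (p x) + (1 - τ) * Real.log (π x) := fun x => by
    rw [hw]
    simp only
    rw [Real.log_mul (Real.rpow_pos_of_pos (hp x) _).ne' (Real.rpow_pos_of_pos (hπ x) _).ne',
      Real.log_rpow (hp x), Real.log_rpow (hπ x)]
  have hlq : ∀ x, Real.log (q x) = Real.log (w x) - Real.log Z := fun x => by
    rw [hqe]; exact Real.log_div (hwpos x).ne' hZpos.ne'
  have hqπ : ∀ x, Real.log (q x / π x) = τ * u x - Real.log Z := fun x => by
    rw [Real.log_div (hqpos x).ne' (hπ x).ne', hlq, hlw, hue]; ring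
  have hqp : ∀ x, Real.log (q x / p x) = -(1 - τ) * u x - Real.log Z := fun x => by
    rw [Real.log_div (hqpos x).ne' (hp x).ne', hlq, hlw, hue]; ring
  have hpq : ∀ x, Real.log (p x / q x) = (1 - τ) * u x + Real.log Z := fun x => by
    rw [Real.log_div (hp x).ne' (hqpos x).ne', hlq, hlw, hue]; ring
  have hwu : Integrable (fun x => w x * u x) m := by
    refine (hpKL.abs.add (hπi.div_const τ)).mono' (hwm.mul hum) (ae_of_all _ fun x => ?_)
    rw [Real.norm_eq_abs, abs_mul, abs_of_pos (hwpos x)]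
    simp only [Pi.add_apply, abs_mul, abs_of_pos (hp x)]
    change _ ≤ p x * |u x| + π x / τ
    rcases le_or_gt 0 (u x) with h | h
    · have : w x ≤ p x := by
        rw [← Real.log_le_log_iff (hwpos x) (hp x), hlw]
        rw [hue] at h; nlinarith
      have h3 : 0 ≤ π x / τ := div_nonneg (hπ x).le h0.le
      have := mul_le_mul_of_nonneg_right this (abs_nonneg (u x))
      linarith
    · have e1 : w x = π x * Real.exp (τ * u x) := by
        rw [← Real.exp_log (hwpos x), hlw, ← Real.exp_log (hπ x), ← Real.exp_add, hue,
          Real.log_exp]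
        congr 1; ring
      have e2 : -(τ * u x) * Real.exp (τ * u x) ≤ 1 := by
        have := Real.add_one_le_exp (-(τ * u x))
        have h5 := Real.exp_pos (τ * u x)
        have : (-(τ * u x)) * Real.exp (τ * u x) ≤
            Real.exp (-(τ * u x)) * Real.exp (τ * u x) := by
          apply mul_le_mul_of_nonneg_right _ h5.le; linarith
        rwa [← Real.exp_add, neg_add_cancel, Real.exp_zero] at this
      have e3 : w x * |u x| ≤ π x / τ := by
        rw [abs_of_neg h, e1, le_div_iff₀ h0]
        have := mul_le_mul_of_nonneg_left e2 (hπ x).le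
        nlinarith
      have := mul_nonneg (hp x).le (abs_nonneg (u x))
      linarith
  have hqu : Integrable (fun x => q x * u x) m := by
    have : (fun x => q x * u x) = fun x => (w x * u x) / Z := by
      funext x; rw [hqe]; ring
    rw [this]; exact hwu.div_const _
  have A : (∫ x, q x - p x ∂m) ≤ ∫ x, (-(1 - τ) * (q x * u x) - Real.log Z * q x) ∂m := by
    refine integral_mono (hqi.sub hpi) ((hqu.const_mul _).sub (hqi.const_mul _)) fun x => ?_
    have := smc_xlog (hqpos x) (hp x)
    rw [hqp] at this
    change q x - p x ≤ -(1 - τ) * (q x * u x) - Real.log Z * q x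
    linarith
  have B : (∫ x, p x - q x ∂m) ≤ ∫ x, ((1 - τ) * (p x * u x) + Real.log Z * p x) ∂m := by
    refine integral_mono (hpi.sub hqi) ((hpKL.const_mul _).add (hpi.const_mul _)) fun x => ?_
    have := smc_xlog (hp x) (hqpos x)
    rw [hpq] at this
    change p x - q x ≤ (1 - τ) * (p x * u x) + Real.log Z * p x
    linarith
  rw [integral_sub hqi hpi, integral_sub (hqu.const_mul _) (hqi.const_mul _), integral_const_mul,
    integral_const_mul, hq1, hp1] at A
  rw [integral_sub hpi hqi, integral_add (hpKL.const_mul _) (hpi.const_mul _), integral_const_mul,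
    integral_const_mul, hq1, hp1] at B
  have hfe : (fun x => q x * Real.log (q x / π x)) =
      fun x => τ * (q x * u x) - Real.log Z * q x := by
    funext x; rw [hqπ]; ring
  refine ⟨hqpos, hqi, hq1, ?_, ?_⟩
  · rw [hfe]; exact (hqu.const_mul _).sub (hqi.const_mul _)
  · rw [hfe, integral_sub (hqu.const_mul _) (hqi.const_mul _), integral_const_mul,
      integral_const_mul, hq1]
    change _ ≤ ∫ x, p x * u x ∂m
    have : 0 ≤ (1 - τ) * ((∫ x, p x * u x ∂m) - ∫ x, q x * u x ∂m) := by linarith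
    have := nonneg_of_mul_nonneg_right this (by linarith)
    nlinarith

/-- Proposition 3: convergence of the splitting scheme alternating one unadjusted
Langevin step (Wasserstein part) with one exact Fisher–Rao / mirror-descent step
`μ_{n+1} ∝ μ_{n+1/2}^{e^{-γ}} π^{1-e^{-γ}}`, approximating the
Wasserstein–Fisher–Rao gradient flow of the KL divergence. -/
theorem smc_wfr_KL_decay
    {d : ℕ} (hd : 1 ≤ d)
    (π : EuclideanSpace ℝ (Fin d) → ℝ)
    (hπpos : ∀ x, 0 < π x)
    (hπint : Integrable π) (hπprob : (∫ x, π x) = 1)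
    (hπsmooth : ContDiff ℝ 1 (fun x => Real.log (π x)))
    (L : ℝ) (hL : 0 < L)
    (hπlip : ∀ x y,
      ‖gradient (fun z => Real.log (π z)) x - gradient (fun z => Real.log (π z)) y‖ ≤
        L * ‖x - y‖)
    (C : ℝ) (hC : 0 < C)
    (hLSI : ∀ ρ : EuclideanSpace ℝ (Fin d) → ℝ,
      (∀ x, 0 < ρ x) → ContDiff ℝ 1 ρ → Integrable ρ → (∫ x, ρ x) = 1 →
      Integrable (fun x => ρ x * Real.log (ρ x / π x)) →
      Integrable (fun x => ρ x * ‖gradient (fun y => Real.log (ρ y / π y)) x‖ ^ 2) →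
      (∫ x, ρ x * Real.log (ρ x / π x)) ≤
        (C / 2) * ∫ x, ρ x * ‖gradient (fun y => Real.log (ρ y / π y)) x‖ ^ 2)
    (hLC : 1 ≤ L * C)
    (γ : ℝ) (hγpos : 0 < γ) (hγ : γ ≤ 1 / (4 * C * L ^ 2))
    (μ μhalf : ℕ → EuclideanSpace ℝ (Fin d) → ℝ) (Z : ℕ → ℝ)
    (hμ₀pos : ∀ x, 0 < μ 0 x) (hμ₀int : Integrable (μ 0)) (hμ₀prob : (∫ x, μ 0 x) = 1)
    (hμ₀KL : Integrable (fun x => μ 0 x * Real.log (μ 0 x / π x)))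
    (hhalf : ∀ n x, μhalf n x =
      (4 * Real.pi * γ) ^ (-(d : ℝ) / 2) *
        ∫ y, Real.exp
            (-‖x - y - γ • gradient (fun z => Real.log (π z)) y‖ ^ 2 / (4 * γ)) * μ n y)
    (hZ : ∀ n : ℕ, Z (n + 1) = ∫ y, μhalf n y ^ Real.exp (-γ) * π y ^ (1 - Real.exp (-γ)))
    (hstep : ∀ (n : ℕ) x,
      μ (n + 1) x = μhalf n x ^ Real.exp (-γ) * π x ^ (1 - Real.exp (-γ)) / Z (n + 1)) :
    ∀ n : ℕ,
      (∫ x, μ n x * Real.log (μ n x / π x)) ≤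
        Real.exp (-((n : ℝ) * γ) / C) * (∫ x, μ 0 x * Real.log (μ 0 x / π x)) +
          8 * γ * (d : ℝ) * L ^ 2 * C := by

  set b : EuclideanSpace ℝ (Fin d) → EuclideanSpace ℝ (Fin d) :=
    gradient (fun z => Real.log (π z)) with hbdef
  have hU : ∀ x, HasFDerivAt (fun x => Real.log (π x)) (innerSL ℝ (b x)) x := fun x => by
    have h1 := (hπsmooth.differentiable (by norm_num) x).hasGradientAt
    exact hasGradientAt_iff_hasFDerivAt.1 h1
  have hL2 : 1 ≤ L * C * (L * C) := by nlinarith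
  have hγ2 : γ * (4 * C * L ^ 2) ≤ 1 := by
    rwa [le_div_iff₀ (by positivity)] at hγ
  have hγL : γ * L ≤ 1 / 4 := by
    have : γ * L * 1 ≤ γ * L * (L * C) := by gcongr
    nlinarith
  have hc4 : γ / C ≤ 1 / 4 := by
    rw [div_le_iff₀ hC]
    have : γ * 1 ≤ γ * (L * C * (L * C)) := by gcongr
    nlinarith
  have hc0 : 0 < γ / C := div_pos hγpos hC
  have key : ∀ n, (∀ x, 0 < μ n x) → Integrable (μ n) → (∫ x, μ n x) = 1 →
      Integrable (fun x => μ n x * Real.log (μ n x / π x)) →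
      (∀ x, 0 < μ (n + 1) x) ∧ Integrable (μ (n + 1)) ∧ (∫ x, μ (n + 1) x) = 1 ∧
      Integrable (fun x => μ (n + 1) x * Real.log (μ (n + 1) x / π x)) ∧
      (∫ x, μ (n + 1) x * Real.log (μ (n + 1) x / π x)) ≤
        Real.exp (-(γ / C)) * (∫ x, μ n x * Real.log (μ n x / π x)) + 2 * γ ^ 2 * d * L ^ 2 := by
    intro n hpos hint h1 hKL
    set f : EuclideanSpace ℝ (Fin d) → ℝ := fun x => max 0 (hint.1.mk (μ n) x) with hf
    have hfm : Measurable f := measurable_const.max hint.1.stronglyMeasurable_mk.measurable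
    have hfe : μ n =ᵐ[volume] f := by
      filter_upwards [hint.1.ae_eq_mk] with x hx
      rw [hf]; simp only
      rw [← hx, max_eq_right (hpos x).le]
    have hfe2 : (fun x => μ n x * Real.log (μ n x / π x)) =ᵐ[volume]
        (fun x => f x * Real.log (f x / π x)) := by
      filter_upwards [hfe] with x hx
      rw [hx]
    have hh : ∀ x, μhalf n x = ∫ y, smcK γ (x - (y + γ • b y)) * f y := by
      intro x
      rw [hhalf, ← integral_const_mul]
      refine integral_congr_ae ?_
      filter_upwards [hfe] with y hy
      rw [hy, smcK, sub_sub]; ring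
    obtain ⟨a1, a2, a3, a4, a5⟩ := smc_ula hL hπlip hπpos hπint hπprob hU hC hLSI hγpos hγL hfm
      (fun y => le_max_left _ _) (hint.congr hfe) (by rw [← integral_congr_ae hfe, h1])
      (hKL.congr hfe2) hh
    rw [← integral_congr_ae hfe2] at a5
    obtain ⟨c1, c2, c3, c4, c5⟩ := smc_fr a1 a2 a3 a4 hπpos hπint hπprob (Real.exp_pos (-γ))
      (by rw [Real.exp_lt_one_iff]; linarith) (hZ n) (hstep n)
    exact ⟨c1, c2, c3, c4, c5.trans a5⟩
  have hexp : Real.exp (-(γ / C)) ≤ 1 - (γ / C) / 4 := by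
    have h1 := Real.add_one_le_exp (γ / C)
    have h2 := Real.exp_pos (-(γ / C))
    have h3 : Real.exp (-(γ / C)) * Real.exp (γ / C) = 1 := by
      rw [← Real.exp_add]; simp
    have h4 : Real.exp (-(γ / C)) * (γ / C + 1) ≤ 1 := by
      exact (mul_le_mul_of_nonneg_left h1 h2.le).trans h3.le
    nlinarith
  have all : ∀ n, (∀ x, 0 < μ n x) ∧ Integrable (μ n) ∧ (∫ x, μ n x) = 1 ∧
      Integrable (fun x => μ n x * Real.log (μ n x / π x)) ∧
      (∫ x, μ n x * Real.log (μ n x / π x)) ≤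
        Real.exp (-((n : ℝ) * γ) / C) * (∫ x, μ 0 x * Real.log (μ 0 x / π x)) +
          8 * γ * (d : ℝ) * L ^ 2 * C := by
    intro n
    induction n with
    | zero =>
      refine ⟨hμ₀pos, hμ₀int, hμ₀prob, hμ₀KL, ?_⟩
      have : 0 ≤ 8 * γ * (d : ℝ) * L ^ 2 * C := by positivity
      simpa using this
    | succ n ih =>
      obtain ⟨i1, i2, i3, i4, i5⟩ := ih
      obtain ⟨k1, k2, k3, k4, k5⟩ := key n i1 i2 i3 i4
      refine ⟨k1, k2, k3, k4, k5.trans ?_⟩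
      have e1 : Real.exp (-(((n + 1 : ℕ) : ℝ) * γ) / C) =
          Real.exp (-(γ / C)) * Real.exp (-((n : ℝ) * γ) / C) := by
        rw [← Real.exp_add]; congr 1; push_cast; ring
      rw [e1]
      have h6 := mul_le_mul_of_nonneg_left i5 (Real.exp_pos (-(γ / C))).le
      have hD : 0 ≤ 8 * γ * (d : ℝ) * L ^ 2 * C := by positivity
      have h7 := mul_le_mul_of_nonneg_right hexp hD
      have h8 : (1 - γ / C / 4) * (8 * γ * (d : ℝ) * L ^ 2 * C) =
          8 * γ * (d : ℝ) * L ^ 2 * C - 2 * γ ^ 2 * d * L ^ 2 := by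
        field_simp; ring
      rw [h8] at h7
      rw [mul_add, ← mul_assoc] at h6
      linarith
  exact fun n => (all n).2.2.2.2
end

section
/- Let d ≥ 1 and let V : ℝ^d → ℝ be continuously differentiable with ∇V L-Lipschitz and c-strongly monotone (⟨x−x', ∇V(x)−∇V(x')⟩ ≥ c‖x−x'‖² with c > 0). Assume e^{−V} is integrable with 0 < ∫ e^{−V(x)} dx < ∞ and let π = e^{−V}/∫e^{−V}. Then for every ε > 1/(2c), writing a = c − 1/(2ε) and b = ε‖∇V(0)‖²/2, the second moment of π is finite and satisfies ∫ ‖x‖² π(x) dx ≤ (d + b)/a. -/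
open MeasureTheory
open scoped RealInnerProductSpace

theorem aux_lower {d : ℕ} (V : EuclideanSpace ℝ (Fin d) → ℝ) (hV : ContDiff ℝ 1 V) (c : ℝ)
    (hmono : ∀ x x', c * ‖x - x'‖ ^ 2 ≤ ⟪x - x', gradient V x - gradient V x'⟫)
    (x : EuclideanSpace ℝ (Fin d)) :
    V 0 + ⟪gradient V 0, x⟫ + c / 2 * ‖x‖ ^ 2 ≤ V x := by
  have hVd : Differentiable ℝ V := hV.differentiable (by norm_num)
  let g : ℝ → ℝ := fun t => V (t • x) - t * ⟪gradient V 0, x⟫ - c / 2 * t ^ 2 * ‖x‖ ^ 2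
  have hg : ∀ t, HasDerivAt g
      (⟪gradient V (t • x), x⟫ - ⟪gradient V 0, x⟫ - c * t * ‖x‖ ^ 2) t := by
    intro t
    have h1 : HasDerivAt (fun t : ℝ => t • x) x t := by
      simpa using (hasDerivAt_id t).smul_const x
    have h2 := (hVd (t • x)).hasFDerivAt.comp_hasDerivAt t h1
    rw [← inner_gradient_left] at h2
    have h3 := (hasDerivAt_id t).mul_const (⟪gradient V 0, x⟫)
    have h4 := (((hasDerivAt_id t).pow 2).const_mul (c / 2)).mul_const (‖x‖ ^ 2)
    refine ((h2.sub h3).sub h4).congr_deriv ?_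
    simp only [id, Nat.cast_ofNat, Nat.add_one_sub_one, pow_one, mul_one, one_mul]
    ring
  have hm : MonotoneOn g (Set.Ici 0) := by
    refine monotoneOn_of_deriv_nonneg (convex_Ici 0)
      (fun t _ => (hg t).continuousAt.continuousWithinAt)
      (fun t _ => (hg t).differentiableAt.differentiableWithinAt) ?_
    intro t ht
    rw [interior_Ici] at ht
    have ht : 0 < t := ht
    rw [(hg t).deriv]
    have h := hmono (t • x) 0
    rw [sub_zero, norm_smul, Real.norm_of_nonneg ht.le, inner_smul_left, inner_sub_right,
      real_inner_comm, real_inner_comm (gradient V 0)] at h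
    simp only [conj_trivial] at h
    have h' : t * (c * t * ‖x‖ ^ 2) ≤
        t * (⟪gradient V (t • x), x⟫ - ⟪gradient V 0, x⟫) := by
      calc _ = c * (t * ‖x‖) ^ 2 := by ring
        _ ≤ _ := h
    have := le_of_mul_le_mul_left h' ht
    linarith
  have := hm (Set.mem_Ici.2 le_rfl) (Set.mem_Ici.2 zero_le_one) zero_le_one
  simp only [g, zero_smul, one_smul] at this
  linarith

theorem aux_integrable {d : ℕ} (V : EuclideanSpace ℝ (Fin d) → ℝ) (hV : ContDiff ℝ 1 V) (c : ℝ)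
    (hc : 0 < c)
    (hmono : ∀ x x', c * ‖x - x'‖ ^ 2 ≤ ⟪x - x', gradient V x - gradient V x'⟫) :
    Integrable (fun x => ‖x‖ ^ 2 * Real.exp (-V x)) := by
  have hG := (GaussianFourier.integrable_cexp_neg_mul_sq_norm_add (b := ((c / 4 : ℝ) : ℂ))
    (by simpa using hc) (-1) (gradient V 0)).norm.const_mul (4 / c * Real.exp (-V 0))
  have hcont := hV.continuous
  refine hG.mono' (by fun_prop) (Filter.Eventually.of_forall fun x => ?_)
  rw [Real.norm_of_nonneg (by positivity), Complex.norm_exp]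
  have hre : (-((c / 4 : ℝ) : ℂ) * (‖x‖ : ℂ) ^ 2 + -1 * ((⟪gradient V 0, x⟫ : ℝ) : ℂ)).re
      = -(c / 4) * ‖x‖ ^ 2 - ⟪gradient V 0, x⟫ := by
    have : (-((c / 4 : ℝ) : ℂ) * (‖x‖ : ℂ) ^ 2 + -1 * ((⟪gradient V 0, x⟫ : ℝ) : ℂ))
      = ((-(c / 4) * ‖x‖ ^ 2 - ⟪gradient V 0, x⟫ : ℝ) : ℂ) := by
      push_cast
      ring
    rw [this, Complex.ofReal_re]
  rw [hre]
  have h1 := aux_lower V hV c hmono x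
  have h2 : ‖x‖ ^ 2 ≤ 4 / c * Real.exp (c / 4 * ‖x‖ ^ 2) := by
    have := Real.add_one_le_exp (c / 4 * ‖x‖ ^ 2)
    calc ‖x‖ ^ 2 = 4 / c * (c / 4 * ‖x‖ ^ 2) := by field_simp
      _ ≤ _ := by gcongr; linarith
  calc ‖x‖ ^ 2 * Real.exp (-V x)
      ≤ (4 / c * Real.exp (c / 4 * ‖x‖ ^ 2)) *
        Real.exp (-V 0 - ⟪gradient V 0, x⟫ - c / 2 * ‖x‖ ^ 2) := by
        gcongr
        linarith
    _ = _ := by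
      rw [mul_assoc, mul_assoc, ← Real.exp_add, ← Real.exp_add]
      congr 2
      ring

theorem aux_ibp {d : ℕ} (V : EuclideanSpace ℝ (Fin d) → ℝ) (hV : ContDiff ℝ 1 V)
    (L : ℝ) (hL : 0 < L)
    (hlip : ∀ x x', ‖gradient V x - gradient V x'‖ ≤ L * ‖x - x'‖)
    (hint : Integrable (fun x => Real.exp (-V x)))
    (h2 : Integrable (fun x => ‖x‖ ^ 2 * Real.exp (-V x))) :
    Integrable (fun x => ⟪x, gradient V x⟫ * Real.exp (-V x)) ∧
    ∫ x, ⟪x, gradient V x⟫ * Real.exp (-V x) = d * ∫ x, Real.exp (-V x) := by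
  have hVd : Differentiable ℝ V := hV.differentiable (by norm_num)
  have hcont := hV.continuous
  have hfc : Continuous (fderiv ℝ V) := hV.continuous_fderiv (by norm_num)
  have hgc : Continuous (gradient V) :=
    (InnerProductSpace.toDual ℝ (EuclideanSpace ℝ (Fin d))).symm.continuous.comp hfc
  have hgb : ∀ x, ‖gradient V x‖ ≤ ‖gradient V 0‖ + L * ‖x‖ := by
    intro x
    have h1 := hlip x 0
    rw [sub_zero] at h1
    have h2 := norm_sub_norm_le (gradient V x) (gradient V 0)
    linarith
  have hdom := (hint.const_mul ‖gradient V 0‖).add (h2.const_mul (‖gradient V 0‖ + L))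
  have hx1 : Integrable (fun x : EuclideanSpace ℝ (Fin d) => ‖x‖ * Real.exp (-V x)) := by
    refine (hint.add h2).mono' (by fun_prop) (Filter.Eventually.of_forall fun x => ?_)
    rw [Real.norm_of_nonneg (by positivity)]
    simp only [Pi.add_apply]
    nlinarith [Real.exp_pos (-V x), sq_nonneg (‖x‖ - 1),
      mul_nonneg (Real.exp_pos (-V x)).le (sq_nonneg (‖x‖ - 1)),
      mul_nonneg (Real.exp_pos (-V x)).le (sq_nonneg (‖x‖))]
  have hfe : ∀ x v, fderiv ℝ (fun x => Real.exp (-V x)) x v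
      = -(Real.exp (-V x) * ⟪gradient V x, v⟫) := by
    intro x v
    have h : HasFDerivAt (fun x => Real.exp (-V x)) _ x := (hVd x).hasFDerivAt.neg.exp
    rw [h.fderiv, inner_gradient_left]
    simp
  have hi : ∀ i : Fin d, Integrable (fun x => x i * gradient V x i * Real.exp (-V x)) ∧
      ∫ x, x i * gradient V x i * Real.exp (-V x) = ∫ x, Real.exp (-V x) := by
    intro i
    have hI : Integrable (fun x => x i * gradient V x i * Real.exp (-V x)) := by
      refine hdom.mono' (by fun_prop) (Filter.Eventually.of_forall fun x => ?_)
      rw [norm_mul, norm_mul, Real.norm_of_nonneg (Real.exp_pos _).le]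
      simp only [Pi.add_apply]
      have ha := PiLp.norm_apply_le x i
      have hb := (PiLp.norm_apply_le (gradient V x) i).trans (hgb x)
      have hab : ‖x i‖ * ‖gradient V x i‖ ≤ ‖gradient V 0‖ + (‖gradient V 0‖ + L) * ‖x‖ ^ 2 := by
        calc _ ≤ ‖x‖ * (‖gradient V 0‖ + L * ‖x‖) := by gcongr
          _ ≤ _ := by
            nlinarith [norm_nonneg (gradient V 0), norm_nonneg x,
              mul_nonneg (norm_nonneg (gradient V 0)) (sq_nonneg (‖x‖ - 1)),
              mul_nonneg (norm_nonneg (gradient V 0)) (sq_nonneg ‖x‖)]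
      calc _ ≤ (‖gradient V 0‖ + (‖gradient V 0‖ + L) * ‖x‖ ^ 2) * Real.exp (-V x) := by gcongr
        _ = _ := by ring
    refine ⟨hI, ?_⟩
    have hge : ∀ x, fderiv ℝ (fun x : EuclideanSpace ℝ (Fin d) => x i) x
        (EuclideanSpace.single i 1) = 1 := by
      intro x
      have : HasFDerivAt (fun x : EuclideanSpace ℝ (Fin d) => x i)
        (EuclideanSpace.proj i : EuclideanSpace ℝ (Fin d) →L[ℝ] ℝ) x :=
        (EuclideanSpace.proj i : EuclideanSpace ℝ (Fin d) →L[ℝ] ℝ).hasFDerivAt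
      rw [this.fderiv]
      simp
    have hterm : ∀ x, fderiv ℝ (fun x => Real.exp (-V x)) x (EuclideanSpace.single i 1) * x i
        = -(x i * gradient V x i * Real.exp (-V x)) := by
      intro x
      rw [hfe, EuclideanSpace.inner_single_right]
      simp
      ring
    have key := integral_mul_fderiv_eq_neg_fderiv_mul_of_integrable (μ := volume)
      (f := fun x => Real.exp (-V x)) (g := fun x : EuclideanSpace ℝ (Fin d) => x i)
      (v := EuclideanSpace.single i 1)
      (by simp only [hterm]; exact hI.neg)
      (by simpa only [hge, mul_one] using hint)
      (by
        refine hx1.mono' (by fun_prop) (Filter.Eventually.of_forall fun x => ?_)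
        rw [norm_mul, Real.norm_of_nonneg (Real.exp_pos _).le, mul_comm]
        have ha := PiLp.norm_apply_le x i
        gcongr)
      (fun x _ => (hVd x).neg.exp)
      (fun x _ => (EuclideanSpace.proj i :
        EuclideanSpace ℝ (Fin d) →L[ℝ] ℝ).differentiableAt)
    simp only [hterm, hge, mul_one, integral_neg, neg_neg] at key
    exact key.symm
  have hsum : (fun x => ⟪x, gradient V x⟫ * Real.exp (-V x))
      = fun x => ∑ i, x i * gradient V x i * Real.exp (-V x) := by
    funext x
    rw [PiLp.inner_apply, Finset.sum_mul]
    refine Finset.sum_congr rfl fun i _ => ?_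
    simp
    ring
  rw [hsum]
  refine ⟨integrable_finsetSum _ fun i _ => (hi i).1, ?_⟩
  rw [integral_finsetSum _ fun i _ => (hi i).1]
  simp [(hi _).2]

/-- Second-moment bound (display eq:pi_finite2moment) for a target density
`π ∝ exp(-V)` with Lipschitz and strongly monotone gradient. -/
theorem target_second_moment_bound
    {d : ℕ} (hd : 1 ≤ d)
    (V : EuclideanSpace ℝ (Fin d) → ℝ) (hV : ContDiff ℝ 1 V)
    (L c : ℝ) (hL : 0 < L) (hc : 0 < c)
    (hlip : ∀ x x', ‖gradient V x - gradient V x'‖ ≤ L * ‖x - x'‖)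
    (hmono : ∀ x x', c * ‖x - x'‖ ^ 2 ≤ ⟪x - x', gradient V x - gradient V x'⟫)
    (hint : Integrable (fun x => Real.exp (-V x)))
    (hZpos : 0 < ∫ x, Real.exp (-V x))
    (ε : ℝ) (hε : 1 / (2 * c) < ε) :
    Integrable (fun x => ‖x‖ ^ 2 * (Real.exp (-V x) / ∫ y, Real.exp (-V y))) ∧
      (∫ x, ‖x‖ ^ 2 * (Real.exp (-V x) / ∫ y, Real.exp (-V y))) ≤
        ((d : ℝ) + ε * ‖gradient V 0‖ ^ 2 / 2) / (c - 1 / (2 * ε)) := by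
  have h2 := aux_integrable V hV c hc hmono
  obtain ⟨hI, hE⟩ := aux_ibp V hV L hL hlip hint h2
  set Z := ∫ y, Real.exp (-V y) with hZ
  have hεpos : 0 < ε := lt_trans (by positivity) hε
  have ha : 0 < c - 1 / (2 * ε) := by
    rw [div_lt_iff₀ (by positivity)] at hε
    rw [sub_pos, div_lt_iff₀ (by positivity)]
    linarith
  have hfun : (fun x => ‖x‖ ^ 2 * (Real.exp (-V x) / Z))
      = fun x => (‖x‖ ^ 2 * Real.exp (-V x)) / Z := by
    funext x; ring
  rw [hfun]
  refine ⟨h2.div_const Z, ?_⟩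
  rw [integral_div, div_le_div_iff₀ hZpos ha]
  have hpt : ∀ x, (c - 1 / (2 * ε)) * (‖x‖ ^ 2 * Real.exp (-V x))
      ≤ ⟪x, gradient V x⟫ * Real.exp (-V x)
        + ε * ‖gradient V 0‖ ^ 2 / 2 * Real.exp (-V x) := by
    intro x
    rw [← mul_assoc, ← add_mul]
    refine mul_le_mul_of_nonneg_right ?_ (Real.exp_pos _).le
    have h := hmono x 0
    rw [sub_zero, inner_sub_right] at h
    have h3 := (abs_le.1 (abs_real_inner_le_norm x (gradient V 0))).1
    have h4 : ‖x‖ * ‖gradient V 0‖ ≤ 1 / (2 * ε) * ‖x‖ ^ 2 + ε * ‖gradient V 0‖ ^ 2 / 2 := by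
      have : 1 / (2 * ε) * ‖x‖ ^ 2 + ε * ‖gradient V 0‖ ^ 2 / 2 - ‖x‖ * ‖gradient V 0‖
          = 1 / (2 * ε) * (‖x‖ - ε * ‖gradient V 0‖) ^ 2 := by
        field_simp
        ring
      have h5 : 0 ≤ 1 / (2 * ε) * (‖x‖ - ε * ‖gradient V 0‖) ^ 2 := by positivity
      linarith
    linarith
  have hle := integral_mono (h2.const_mul (c - 1 / (2 * ε)))
    (hI.add (hint.const_mul (ε * ‖gradient V 0‖ ^ 2 / 2))) hpt
  rw [integral_const_mul, integral_add' hI (hint.const_mul _), integral_const_mul, hE] at hle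
  linarith
end

section
/- Let d ≥ 1 and let V : ℝ^d → ℝ be continuously differentiable with ∇V L-Lipschitz (L > 0), and suppose the dissipativity condition ⟨x, ∇V(x)⟩ ≥ a‖x‖² − b holds for all x ∈ ℝ^d, with constants a, b > 0. Then V attains its global minimum at some point z₀ with ‖z₀‖² ≤ b/a and ∇V(z₀) = 0, and consequently for every z ∈ ℝ^d: ‖∇V(z)‖² ≤ 2L²(‖z‖² + b/a). -/
open MeasureTheory
open scoped RealInnerProductSpace

/-- Gradient-growth bound (display eq:pi_locallybounded): dissipativity forces a global
minimiser of `V` into the ball of squared radius `b/a`, and the Lipschitz property of the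
gradient then yields the quadratic bound `‖∇V(z)‖² ≤ 2L²(‖z‖² + b/a)`. -/
theorem gradient_growth_of_dissipativity
    {d : ℕ} (hd : 1 ≤ d)
    (V : EuclideanSpace ℝ (Fin d) → ℝ) (hV : ContDiff ℝ 1 V)
    (L a b : ℝ) (hL : 0 < L) (ha : 0 < a) (hb : 0 < b)
    (hlip : ∀ x x', ‖gradient V x - gradient V x'‖ ≤ L * ‖x - x'‖)
    (hdiss : ∀ x, a * ‖x‖ ^ 2 - b ≤ ⟪x, gradient V x⟫) :
    (∃ z₀ : EuclideanSpace ℝ (Fin d),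
        ‖z₀‖ ^ 2 ≤ b / a ∧ gradient V z₀ = 0 ∧ ∀ z, V z₀ ≤ V z) ∧
      ∀ z, ‖gradient V z‖ ^ 2 ≤ 2 * L ^ 2 * (‖z‖ ^ 2 + b / a) := by
  have hVd : Differentiable ℝ V := hV.differentiable (by norm_num)
  have hba : 0 < b / a := div_pos hb ha
  set R := Real.sqrt (b / a) with hR
  have hRpos : 0 < R := Real.sqrt_pos.mpr hba
  have hR2 : R ^ 2 = b / a := Real.sq_sqrt hba.le
  have haR : a * R ^ 2 = b := by rw [hR2]; field_simp
  obtain ⟨z₀, hz₀, hmin⟩ := (isCompact_closedBall (0 : EuclideanSpace ℝ (Fin d)) R).exists_isMinOn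
    ⟨0, by simp [hRpos.le]⟩ hV.continuous.continuousOn
  have hz₀R : ‖z₀‖ ≤ R := by simpa using hz₀
  have hz₀2 : ‖z₀‖ ^ 2 ≤ b / a := by
    rw [← hR2]; exact pow_le_pow_left₀ (norm_nonneg _) hz₀R 2
  have hglob : ∀ z, V z₀ ≤ V z := by
    intro z
    by_cases hz : ‖z‖ ≤ R
    · exact hmin (by simpa using hz)
    push Not at hz
    have hzpos : 0 < ‖z‖ := hRpos.trans hz
    have hs0 : 0 < R / ‖z‖ := div_pos hRpos hzpos
    have hs1 : R / ‖z‖ ≤ 1 := (div_le_one hzpos).mpr hz.le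
    have hder : ∀ t : ℝ, HasDerivAt (fun t : ℝ => V (t • z)) (fderiv ℝ V (t • z) z) t := by
      intro t
      have h1 : HasDerivAt (fun t : ℝ => t • z) z t := by
        simpa using (hasDerivAt_id t).smul_const z
      exact (hVd (t • z)).hasFDerivAt.comp_hasDerivAt t h1
    have hmono : MonotoneOn (fun t : ℝ => V (t • z)) (Set.Icc (R / ‖z‖) 1) := by
      apply monotoneOn_of_deriv_nonneg (convex_Icc _ _)
      · exact fun t _ => (hder t).continuousAt.continuousWithinAt
      · exact fun t _ => (hder t).differentiableAt.differentiableWithinAt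
      · intro t ht
        rw [interior_Icc] at ht
        rw [(hder t).deriv]
        have ht0 : 0 < t := hs0.trans ht.1
        have h1 := hdiss (t • z)
        rw [real_inner_comm, inner_gradient_left, map_smul, smul_eq_mul, norm_smul,
          Real.norm_of_nonneg ht0.le] at h1
        have h2 : R ≤ t * ‖z‖ := ((div_lt_iff₀ hzpos).mp ht.1).le
        have h3 : R ^ 2 ≤ (t * ‖z‖) ^ 2 := pow_le_pow_left₀ hRpos.le h2 2
        have h4 := mul_le_mul_of_nonneg_left h3 ha.le
        exact nonneg_of_mul_nonneg_right (by linarith) ht0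
    have h5 := hmono (Set.left_mem_Icc.mpr hs1) (Set.right_mem_Icc.mpr hs1) hs1
    simp only [one_smul] at h5
    refine le_trans (hmin ?_) h5
    rw [mem_closedBall_zero_iff, norm_smul, Real.norm_of_nonneg hs0.le,
      div_mul_cancel₀ _ hzpos.ne']
  have hgrad : gradient V z₀ = 0 := by
    have h : IsLocalMin V z₀ := Filter.Eventually.of_forall hglob
    simp [gradient, h.fderiv_eq_zero]
  refine ⟨⟨z₀, hz₀2, hgrad, hglob⟩, fun z => ?_⟩
  have h1 := hlip z z₀
  rw [hgrad, sub_zero] at h1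
  have h2 : ‖gradient V z‖ ^ 2 ≤ (L * (‖z‖ + ‖z₀‖)) ^ 2 :=
    pow_le_pow_left₀ (norm_nonneg _)
      (h1.trans (mul_le_mul_of_nonneg_left (norm_sub_le _ _) hL.le)) 2
  have h3 : (‖z‖ + ‖z₀‖) ^ 2 ≤ 2 * (‖z‖ ^ 2 + b / a) := by
    nlinarith [sq_nonneg (‖z‖ - ‖z₀‖)]
  have h4 := mul_le_mul_of_nonneg_left h3 (sq_nonneg L)
  rw [mul_pow] at h2
  linarith
end

section
/- Let d ≥ 1, let π and p be strictly positive probability densities on ℝ^d, and let δ ∈ (0,1]. Set Z = ∫ p(x)^{1−δ}π(x)^δ dx (which satisfies 0 < Z ≤ 1) and q = p^{1−δ}π^δ/Z. Assume log(p/π) is integrable with respect to both p and q. Then ∫ q(x) log(q(x)/π(x)) dx ≤ ∫ p(x) log(p(x)/π(x)) dx. -/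
open MeasureTheory

/-- Monotonicity of the KL divergence along one mirror-descent (exact Fisher–Rao)
step `q ∝ p^{1-δ} π^δ` (display eq:kl_decreasing). -/
theorem mirror_descent_step_KL_nonincreasing
    {d : ℕ} (hd : 1 ≤ d)
    (π p : EuclideanSpace ℝ (Fin d) → ℝ)
    (hπmeas : Measurable π) (hpmeas : Measurable p)
    (hπpos : ∀ x, 0 < π x) (hppos : ∀ x, 0 < p x)
    (hπint : Integrable π) (hpint : Integrable p)
    (hπprob : (∫ x, π x) = 1) (hpprob : (∫ x, p x) = 1)
    (δ : ℝ) (hδpos : 0 < δ) (hδle : δ ≤ 1)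
    (Z : ℝ) (hZ : Z = ∫ x, p x ^ (1 - δ) * π x ^ δ)
    (q : EuclideanSpace ℝ (Fin d) → ℝ)
    (hq : ∀ x, q x = p x ^ (1 - δ) * π x ^ δ / Z)
    (hp_logint : Integrable (fun x => p x * Real.log (p x / π x)))
    (hq_logint : Integrable (fun x => q x * Real.log (p x / π x))) :
    (∫ x, q x * Real.log (q x / π x)) ≤ ∫ x, p x * Real.log (p x / π x) := by
  have hGpos : ∀ x, 0 < p x ^ (1 - δ) * π x ^ δ := fun x =>
    mul_pos (Real.rpow_pos_of_pos (hppos x) _) (Real.rpow_pos_of_pos (hπpos x) _)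
  have hGint : Integrable (fun x => p x ^ (1 - δ) * π x ^ δ) := by
    refine Integrable.mono' ((hpint.const_mul (1 - δ)).add (hπint.const_mul δ)) ?_ ?_
    · exact ((hpmeas.pow_const _).mul (hπmeas.pow_const _)).aestronglyMeasurable
    · refine Filter.Eventually.of_forall fun x => ?_
      rw [Real.norm_of_nonneg (hGpos x).le]
      exact Real.geom_mean_le_arith_mean2_weighted (by linarith) hδpos.le
        (hppos x).le (hπpos x).le (by ring)
  have hZpos : 0 < Z := by
    rw [hZ, integral_pos_iff_support_of_nonneg (fun x => (hGpos x).le) hGint]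
    have : Function.support (fun x => p x ^ (1 - δ) * π x ^ δ) = Set.univ :=
      Set.eq_univ_of_forall fun x => (hGpos x).ne'
    rw [this]
    exact Measure.measure_univ_pos.2 (NeZero.ne _)
  have hqpos : ∀ x, 0 < q x := fun x => by
    rw [hq]; exact div_pos (hGpos x) hZpos
  have hqe : q = fun x => p x ^ (1 - δ) * π x ^ δ / Z := funext hq
  have hqint : Integrable q := by
    rw [hqe]; exact hGint.div_const Z
  have hqprob : (∫ x, q x) = 1 := by
    rw [hqe, integral_div, ← hZ, div_self hZpos.ne']
  have hlogq : ∀ x, Real.log (q x) =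
      (1 - δ) * Real.log (p x) + δ * Real.log (π x) - Real.log Z := fun x => by
    rw [hq, Real.log_div (hGpos x).ne' hZpos.ne',
      Real.log_mul (Real.rpow_pos_of_pos (hppos x) _).ne' (Real.rpow_pos_of_pos (hπpos x) _).ne',
      Real.log_rpow (hppos x), Real.log_rpow (hπpos x)]
  have hL : ∀ x, Real.log (p x / π x) = Real.log (p x) - Real.log (π x) := fun x =>
    Real.log_div (hppos x).ne' (hπpos x).ne'
  have gibbs : ∀ a b : ℝ, 0 < a → 0 < b → a - b ≤ a * (Real.log a - Real.log b) := by
    intro a b ha hb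
    have h := Real.log_le_sub_one_of_pos (div_pos hb ha)
    rw [Real.log_div hb.ne' ha.ne'] at h
    have h2 := mul_le_mul_of_nonneg_left h ha.le
    have h3 : a * (b / a - 1) = b - a := by field_simp
    linarith
  have e1 : (∫ x, q x * Real.log (q x / π x)) =
      (1 - δ) * (∫ x, q x * Real.log (p x / π x)) - Real.log Z := by
    have : (fun x => q x * Real.log (q x / π x)) = fun x =>
        (1 - δ) * (q x * Real.log (p x / π x)) - Real.log Z * q x := by
      funext x
      rw [hL, Real.log_div (hqpos x).ne' (hπpos x).ne', hlogq]
      ring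
    rw [this, integral_sub (hq_logint.const_mul _) (hqint.const_mul _),
      integral_const_mul, integral_const_mul, hqprob, mul_one]
  have g1 : δ * (∫ x, q x * Real.log (p x / π x)) + Real.log Z ≤ 0 := by
    have h : (∫ x, (δ * (q x * Real.log (p x / π x)) + Real.log Z * q x)) ≤
        ∫ x, (p x - q x) := by
      refine integral_mono ((hq_logint.const_mul _).add (hqint.const_mul _))
        (hpint.sub hqint) fun x => ?_
      have := gibbs (q x) (p x) (hqpos x) (hppos x)
      rw [hlogq] at this
      simp only [hL]
      linarith
    rw [integral_add (hq_logint.const_mul _) (hqint.const_mul _), integral_sub hpint hqint,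
      integral_const_mul, integral_const_mul, hqprob, hpprob] at h
    linarith
  have g2 : 0 ≤ δ * (∫ x, p x * Real.log (p x / π x)) + Real.log Z := by
    have h : (∫ x, (p x - q x)) ≤
        ∫ x, (δ * (p x * Real.log (p x / π x)) + Real.log Z * p x) := by
      refine integral_mono (hpint.sub hqint)
        ((hp_logint.const_mul _).add (hpint.const_mul _)) fun x => ?_
      have := gibbs (p x) (q x) (hppos x) (hqpos x)
      rw [hlogq] at this
      simp only [hL]
      linarith
    rw [integral_add (hp_logint.const_mul _) (hpint.const_mul _), integral_sub hpint hqint,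
      integral_const_mul, integral_const_mul, hqprob, hpprob] at h
    linarith
  rw [e1]
  refine le_of_mul_le_mul_left ?_ hδpos
  have := mul_le_mul_of_nonneg_left g1 (sub_nonneg.2 hδle)
  linarith
end

section
/- Let d ≥ 1 and let π, ρ₀ : ℝ^d → ℝ be strictly positive. Define ρ*(τ,x) = π(x)^{1−exp(−τ)} ρ₀(x)^{exp(−τ)}. Then ρ*(0,x) = ρ₀(x), and for every τ ∈ ℝ and every x ∈ ℝ^d, the map σ ↦ ρ*(σ,x) has derivative at σ = τ equal to ρ*(τ,x)·( log π(x) − log ρ*(τ,x) ). Equivalently, the deterministic time change τ = −log(1−t) transforms the geometric interpolation π^t ρ₀^{1−t} (the solution of the unnormalized unit-time Fisher–Rao PDE) into a solution of the unnormalized infinite-time Fisher–Rao PDE ∂_τ ρ_τ = ρ_τ log(π/ρ_τ) with initial condition ρ₀. -/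
open MeasureTheory

/-- Lemma A.2 (core computation): the time change `τ = -log(1-t)` turns the geometric
interpolation into `ρ*(τ,x) = π(x)^{1-e^{-τ}} ρ₀(x)^{e^{-τ}}`, which solves the
unnormalized infinite-time Fisher–Rao PDE `∂_τ ρ_τ = ρ_τ log(π/ρ_τ)` with initial
condition `ρ₀`. -/
theorem time_rescaling_unit_to_infinite_time_FR
    {d : ℕ} (hd : 1 ≤ d)
    (π ρ₀ : EuclideanSpace ℝ (Fin d) → ℝ)
    (hπpos : ∀ x, 0 < π x) (hρ₀pos : ∀ x, 0 < ρ₀ x)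
    (ρstar : ℝ → EuclideanSpace ℝ (Fin d) → ℝ)
    (hρstar : ∀ τ x, ρstar τ x = π x ^ (1 - Real.exp (-τ)) * ρ₀ x ^ Real.exp (-τ)) :
    (∀ x, ρstar 0 x = ρ₀ x) ∧
      ∀ τ x, HasDerivAt (fun σ => ρstar σ x)
        (ρstar τ x * (Real.log (π x) - Real.log (ρstar τ x))) τ := by
  refine ⟨fun x => by simp [hρstar], fun τ x => ?_⟩
  have key : ∀ σ, ρstar σ x = Real.exp (Real.log (π x) * (1 - Real.exp (-σ))
      + Real.log (ρ₀ x) * Real.exp (-σ)) := by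
    intro σ
    rw [hρstar, Real.rpow_def_of_pos (hπpos x), Real.rpow_def_of_pos (hρ₀pos x), Real.exp_add]
  simp only [key, Real.log_exp]
  have he : HasDerivAt (fun σ : ℝ => Real.exp (-σ)) (Real.exp (-τ) * (-1)) τ :=
    (hasDerivAt_neg τ).exp
  have h := (((he.const_sub 1).const_mul (Real.log (π x))).add
    (he.const_mul (Real.log (ρ₀ x)))).exp
  refine h.congr_deriv ?_
  simp only [Pi.add_apply]
  ring
end

section
/- Let d ≥ 1 and let π, μ₀ be strictly positive probability densities on ℝ^d. For t ≥ 0 define ρ(t,x) = π(x)^{1−exp(−t)} μ₀(x)^{exp(−t)} and Z(t) = ∫ ρ(t,x) dx (finite and positive, with Z(t) ≤ 1 by Hölder's inequality). Assume that for every t ≥ 0 the function x ↦ ρ(t,x)·log(π(x)/ρ(t,x)) is integrable and that Z has derivative at t equal to ∫ ρ(t,x) log(π(x)/ρ(t,x)) dx (differentiation under the integral sign). Define μ(t,x) = ρ(t,x)/Z(t). Then μ(0,·) = μ₀, and for every t ≥ 0 and every x ∈ ℝ^d, the map s ↦ μ(s,x) has derivative at s = t equal to μ(t,x)·( log(π(x)/μ(t,x))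 − ∫ μ(t,y) log(π(y)/μ(t,y)) dy ). -/
open MeasureTheory

/-- The normalized geometric path `μ_t ∝ π^{1-e^{-t}} μ₀^{e^{-t}}` solves the
(normalized) infinite-time Fisher–Rao gradient flow of the KL divergence,
`∂_t μ_t = μ_t (log(π/μ_t) - E_{μ_t}[log(π/μ_t)])`, with initial condition `μ₀`. -/
theorem normalized_infinite_time_FR_flow
    {d : ℕ} (hd : 1 ≤ d)
    (π μ₀ : EuclideanSpace ℝ (Fin d) → ℝ)
    (hπmeas : Measurable π) (hμ₀meas : Measurable μ₀)
    (hπpos : ∀ x, 0 < π x) (hμ₀pos : ∀ x, 0 < μ₀ x)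
    (hπint : Integrable π) (hμ₀int : Integrable μ₀)
    (hπprob : (∫ x, π x) = 1) (hμ₀prob : (∫ x, μ₀ x) = 1)
    (ρ : ℝ → EuclideanSpace ℝ (Fin d) → ℝ) (Z : ℝ → ℝ)
    (hρ : ∀ t x, ρ t x = π x ^ (1 - Real.exp (-t)) * μ₀ x ^ Real.exp (-t))
    (hZ : ∀ t, Z t = ∫ x, ρ t x)
    (hint : ∀ t, 0 ≤ t → Integrable (fun x => ρ t x * Real.log (π x / ρ t x)))
    (hZderiv : ∀ t, 0 ≤ t → HasDerivAt Z (∫ x, ρ t x * Real.log (π x / ρ t x)) t)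
    (μ : ℝ → EuclideanSpace ℝ (Fin d) → ℝ)
    (hμ : ∀ t x, μ t x = ρ t x / Z t) :
    (∀ x, μ 0 x = μ₀ x) ∧
      ∀ t, 0 ≤ t → ∀ x,
        HasDerivAt (fun s => μ s x)
          (μ t x * (Real.log (π x / μ t x) - ∫ y, μ t y * Real.log (π y / μ t y))) t := by
  have hρe : ∀ t x, ρ t x = Real.exp (Real.log (π x) * (1 - Real.exp (-t))
      + Real.log (μ₀ x) * Real.exp (-t)) := by
    intro t x
    rw [hρ, Real.rpow_def_of_pos (hπpos x), Real.rpow_def_of_pos (hμ₀pos x), Real.exp_add]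
  have hρpos : ∀ t x, 0 < ρ t x := fun t x => by rw [hρe]; exact Real.exp_pos _
  have hlog : ∀ t x, Real.log (π x / ρ t x)
      = Real.exp (-t) * (Real.log (π x) - Real.log (μ₀ x)) := by
    intro t x
    rw [Real.log_div (hπpos x).ne' (hρpos t x).ne', hρe, Real.log_exp]
    ring
  have hρint : ∀ t, 0 ≤ t → Integrable (ρ t) := by
    intro t ht
    have he0 : 0 ≤ Real.exp (-t) := (Real.exp_pos _).le
    have he1 : Real.exp (-t) ≤ 1 := Real.exp_le_one_iff.mpr (by linarith)
    have hdom : Integrable (fun x => (1 - Real.exp (-t)) * π x + Real.exp (-t) * μ₀ x) :=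
      (hπint.const_mul _).add (hμ₀int.const_mul _)
    refine hdom.mono' ?_ ?_
    · have : ρ t = fun x => π x ^ (1 - Real.exp (-t)) * μ₀ x ^ Real.exp (-t) := funext (hρ t)
      rw [this]
      exact ((hπmeas.pow_const _).mul (hμ₀meas.pow_const _)).aestronglyMeasurable
    · refine Filter.Eventually.of_forall fun x => ?_
      rw [Real.norm_of_nonneg (hρpos t x).le, hρ]
      exact Real.geom_mean_le_arith_mean2_weighted (by linarith) he0 (hπpos x).le (hμ₀pos x).le
        (by ring)
  have hZpos : ∀ t, 0 ≤ t → 0 < Z t := by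
    intro t ht
    rw [hZ, integral_pos_iff_support_of_nonneg (fun x => (hρpos t x).le) (hρint t ht)]
    have : Function.support (ρ t) = Set.univ := by
      ext x; simp [(hρpos t x).ne']
    rw [this]
    exact Measure.measure_univ_pos.mpr (NeZero.ne _)
  have hρ0 : ∀ x, ρ 0 x = μ₀ x := by intro x; simp [hρ]
  refine ⟨fun x => ?_, fun t ht x => ?_⟩
  · have : Z 0 = 1 := by rw [hZ]; simp only [hρ0]; exact hμ₀prob
    rw [hμ, this, hρ0, div_one]
  have hZt := hZpos t ht
  have hlogμ : ∀ y, Real.log (π y / μ t y) = Real.log (π y / ρ t y) + Real.log (Z t) := by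
    intro y
    rw [hμ, ← Real.log_mul (div_pos (hπpos y) (hρpos t y)).ne' hZt.ne', div_div_eq_mul_div,
      div_mul_eq_mul_div]
  have hI : (∫ y, μ t y * Real.log (π y / μ t y))
      = (∫ y, ρ t y * Real.log (π y / ρ t y)) / Z t + Real.log (Z t) := by
    have h1 : (fun y => μ t y * Real.log (π y / μ t y)) = fun y =>
        (Z t)⁻¹ * (ρ t y * Real.log (π y / ρ t y)) + (Real.log (Z t) / Z t) * ρ t y := by
      funext y
      rw [hlogμ, hμ]
      ring
    rw [h1, integral_add ((hint t ht).const_mul _) ((hρint t ht).const_mul _),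
      integral_const_mul, integral_const_mul, ← hZ]
    field_simp
  have hexp : HasDerivAt (fun s : ℝ => Real.exp (-s)) (-Real.exp (-t)) t := by
    simpa using (hasDerivAt_neg t).exp
  have hρd : HasDerivAt (fun s => ρ s x) (ρ t x * Real.log (π x / ρ t x)) t := by
    have h := (((hexp.const_sub 1).const_mul (Real.log (π x))).add
      (hexp.const_mul (Real.log (μ₀ x)))).exp
    have h2 : (fun s => ρ s x) = fun s => Real.exp (Real.log (π x) * (1 - Real.exp (-s))
      + Real.log (μ₀ x) * Real.exp (-s)) := funext fun s => hρe s x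
    rw [h2]
    refine h.congr_deriv ?_
    rw [hlog, hρe]
    simp only [Pi.add_apply]
    ring
  have h3 : (fun s => μ s x) = fun s => ρ s x / Z s := funext fun s => hμ s x
  rw [hI, hlogμ, h3, hμ]
  refine (hρd.div (hZderiv t ht) hZt.ne').congr_deriv ?_
  field_simp
  ring
end

section
/- Let d ≥ 1 and let π, μ₀ be strictly positive probability densities on ℝ^d. For t ∈ [0,1] define ρ(t,x) = π(x)^t μ₀(x)^{1−t} and Z(t) = ∫ ρ(t,x) dx (finite and positive, with Z(t) ≤ 1 by Hölder's inequality). Assume that for every t ∈ [0,1] the function x ↦ ρ(t,x)·log(π(x)/μ₀(x)) is integrable and that Z has derivative at t equal to ∫ ρ(t,x) log(π(x)/μ₀(x)) dx (differentiation under the integral sign). Define μ(t,x) = ρ(t,x)/Z(t). Then μ(0,·) = μ₀, μ(1,·) = π, and for every t ∈ [0,1] and every x ∈ ℝ^d, the map s ↦ μ(s,x) has derivative at s = t equal to μ(t,x)·( log(π(x)/μ₀(x)) − ∫ μ(t,y) log(π(y)/μ₀(y)) dy ). -/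
open MeasureTheory

/-- The normalized geometric interpolation `μ_t ∝ π^t μ₀^{1-t}` solves the unit-time
Fisher–Rao PDE `∂_t μ_t = μ_t (log(π/μ₀) - E_{μ_t}[log(π/μ₀)])` on `[0,1]`,
with `μ_0 = μ₀` and `μ_1 = π` (display eq:unitFR). -/
theorem normalized_geometric_path_solves_unit_time_FR
    {d : ℕ} (hd : 1 ≤ d)
    (π μ₀ : EuclideanSpace ℝ (Fin d) → ℝ)
    (hπmeas : Measurable π) (hμ₀meas : Measurable μ₀)
    (hπpos : ∀ x, 0 < π x) (hμ₀pos : ∀ x, 0 < μ₀ x)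
    (hπint : Integrable π) (hμ₀int : Integrable μ₀)
    (hπprob : (∫ x, π x) = 1) (hμ₀prob : (∫ x, μ₀ x) = 1)
    (ρ : ℝ → EuclideanSpace ℝ (Fin d) → ℝ) (Z : ℝ → ℝ)
    (hρ : ∀ t x, ρ t x = π x ^ t * μ₀ x ^ (1 - t))
    (hZ : ∀ t, Z t = ∫ x, ρ t x)
    (hint : ∀ t, t ∈ Set.Icc (0 : ℝ) 1 →
      Integrable (fun x => ρ t x * Real.log (π x / μ₀ x)))
    (hZderiv : ∀ t, t ∈ Set.Icc (0 : ℝ) 1 →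
      HasDerivAt Z (∫ x, ρ t x * Real.log (π x / μ₀ x)) t)
    (μ : ℝ → EuclideanSpace ℝ (Fin d) → ℝ)
    (hμ : ∀ t x, μ t x = ρ t x / Z t) :
    (∀ x, μ 0 x = μ₀ x) ∧ (∀ x, μ 1 x = π x) ∧
      ∀ t, t ∈ Set.Icc (0 : ℝ) 1 → ∀ x,
        HasDerivAt (fun s => μ s x)
          (μ t x * (Real.log (π x / μ₀ x) - ∫ y, μ t y * Real.log (π y / μ₀ y))) t := by
  have hρpos : ∀ t x, 0 < ρ t x := fun t x => by
    rw [hρ]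
    exact mul_pos (Real.rpow_pos_of_pos (hπpos x) _) (Real.rpow_pos_of_pos (hμ₀pos x) _)
  have hZpos : ∀ t, t ∈ Set.Icc (0 : ℝ) 1 → 0 < Z t := by
    intro t ht
    have hi : Integrable (ρ t) := by
      refine Integrable.mono' ((hπint.const_mul t).add (hμ₀int.const_mul (1 - t))) ?_ ?_
      · have : ρ t = fun x => π x ^ t * μ₀ x ^ (1 - t) := funext (hρ t)
        rw [this]
        exact ((hπmeas.pow_const t).mul (hμ₀meas.pow_const (1 - t))).aestronglyMeasurable
      · refine Filter.Eventually.of_forall fun x => ?_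
        rw [Real.norm_of_nonneg (hρpos t x).le, hρ]
        exact Real.geom_mean_le_arith_mean2_weighted ht.1 (by linarith [ht.2]) (hπpos x).le
          (hμ₀pos x).le (by ring)
    rw [hZ, integral_pos_iff_support_of_nonneg (fun x => (hρpos t x).le) hi]
    have : Function.support (ρ t) = Set.univ :=
      Set.eq_univ_of_forall fun x => (hρpos t x).ne'
    rw [this]
    exact Measure.measure_univ_pos.2 (NeZero.ne _)
  refine ⟨fun x => ?_, fun x => ?_, fun t ht x => ?_⟩
  · rw [hμ, hZ]
    simp [hρ, hμ₀prob]
  · rw [hμ, hZ]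
    simp [hρ, hπprob]
  · have hz := (hZpos t ht).ne'
    have hI : ∫ y, μ t y * Real.log (π y / μ₀ y)
        = (∫ y, ρ t y * Real.log (π y / μ₀ y)) / Z t := by
      rw [← integral_div]
      congr 1
      funext y
      rw [hμ]
      ring
    have h1 : HasDerivAt (fun s => ρ s x) (ρ t x * Real.log (π x / μ₀ x)) t := by
      have a := (hasDerivAt_id t).const_rpow (hπpos x)
      have b := ((hasDerivAt_id t).const_sub 1).const_rpow (hμ₀pos x)
      have c := a.mul b
      have e : (fun s => ρ s x) = fun s => π x ^ s * μ₀ x ^ (1 - s) := funext fun s => hρ s x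
      rw [e, hρ, Real.log_div (hπpos x).ne' (hμ₀pos x).ne']
      refine HasDerivAt.congr_deriv c ?_
      simp only [id]
      ring
    have h2 := h1.div (hZderiv t ht) hz
    have e : (fun s => μ s x) = fun s => ρ s x / Z s := funext fun s => hμ s x
    rw [e, hI, hμ]
    refine HasDerivAt.congr_deriv h2 ?_
    field_simp
end

section
/- Let C_π > 0, C₀ > 0 with C₀ ≠ C_π, and m₀, m_π ∈ ℝ. Set κ = 1 + 2/C_π and define, for t ≥ 0, D(t) = (1/(C₀ − C_π) + 1/(C_π + 2))·e^{κt} − 1/(C_π + 2), C(t) = C_π + 1/D(t), and m(t) = m_π + (m₀ − m_π)·e^{t/C_π}·(C(t) − C_π)/(C₀ − C_π). Then for every t ≥ 0: D(t) ≠ 0, C(0) = C₀, m(0) = m₀, the map C has derivative at t equal to −C(t)²/C_π + C(t) − 2C(t)/C_π + 2, and the map m has derivative at t equal to −(C(t) + 1)·(m(t) − m_π)/C_π. -/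
open MeasureTheory

/-- Explicit solution (Appendix C of the paper) of the 1D Gaussian moment ODEs of the
Wasserstein–Fisher–Rao gradient flow of `D_KL(·‖π)` with target `π = N(m_π, C_π)` and
initial condition `N(m₀, C₀)`: `Ċ = -C²/C_π + C - 2C/C_π + 2` and
`ṁ = -(C+1)(m - m_π)/C_π`. -/
theorem gaussian_WFR_explicit_solution
    (Cπ C₀ m₀ mπ : ℝ) (hCπ : 0 < Cπ) (hC₀ : 0 < C₀) (hne : C₀ ≠ Cπ)
    (κ : ℝ) (hκ : κ = 1 + 2 / Cπ)
    (D Cf mf : ℝ → ℝ)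
    (hD : ∀ t, D t = (1 / (C₀ - Cπ) + 1 / (Cπ + 2)) * Real.exp (κ * t) - 1 / (Cπ + 2))
    (hCf : ∀ t, Cf t = Cπ + 1 / D t)
    (hmf : ∀ t, mf t = mπ + (m₀ - mπ) * Real.exp (t / Cπ) * (Cf t - Cπ) / (C₀ - Cπ)) :
    Cf 0 = C₀ ∧ mf 0 = m₀ ∧
      ∀ t, 0 ≤ t →
        D t ≠ 0 ∧
        HasDerivAt Cf (-(Cf t) ^ 2 / Cπ + Cf t - 2 * Cf t / Cπ + 2) t ∧
        HasDerivAt mf (-((Cf t + 1) * (mf t - mπ)) / Cπ) t := by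
  have hs : C₀ - Cπ ≠ 0 := sub_ne_zero.mpr hne
  have hp : Cπ + 2 ≠ 0 := by positivity
  have hc : Cπ ≠ 0 := hCπ.ne'
  have hD0 : D 0 = 1 / (C₀ - Cπ) := by rw [hD]; simp
  have hC0 : Cf 0 = C₀ := by rw [hCf, hD0]; simp
  refine ⟨hC0, ?_, ?_⟩
  · rw [hmf, hC0, mul_div_assoc, div_self hs]; simp
  intro t ht
  have hκ0 : 0 < κ := by rw [hκ]; positivity
  have hDt : D t ≠ 0 := by
    intro h
    rw [hD] at h
    have he : 1 ≤ Real.exp (κ * t) := Real.one_le_exp (by positivity)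
    have h2 : (C₀ + 2) * Real.exp (κ * t) = C₀ - Cπ := by
      have h3 : ((1 / (C₀ - Cπ) + 1 / (Cπ + 2)) * Real.exp (κ * t) - 1 / (Cπ + 2))
          * ((C₀ - Cπ) * (Cπ + 2)) = (C₀ + 2) * Real.exp (κ * t) - (C₀ - Cπ) := by
        field_simp
        ring
      rw [h, zero_mul] at h3
      linarith
    nlinarith
  have hDd : HasDerivAt D (κ * D t + 1 / Cπ) t := by
    have h1 : HasDerivAt (fun s : ℝ => κ * s) κ t := by
      simpa using (hasDerivAt_id t).const_mul κ
    have h2 := (h1.exp.const_mul (1 / (C₀ - Cπ) + 1 / (Cπ + 2))).sub_const (1 / (Cπ + 2))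
    rw [hD t, funext hD]
    refine h2.congr_deriv ?_
    have h4 : κ * (1 / (Cπ + 2)) = 1 / Cπ := by
      rw [hκ]; field_simp
    linear_combination h4
  have hCd' : HasDerivAt Cf (-(κ * D t + 1 / Cπ) / D t ^ 2) t := by
    have h1 := (hDd.inv hDt).const_add Cπ
    have h2 : Cf = fun s => Cπ + (D s)⁻¹ := by
      funext s; rw [hCf, one_div]
    rw [h2]
    exact h1
  refine ⟨hDt, ?_, ?_⟩
  · refine hCd'.congr_deriv ?_
    symm
    rw [hCf, hκ]
    field_simp
    ring
  · have h1 : HasDerivAt (fun s : ℝ => s / Cπ) (1 / Cπ) t := (hasDerivAt_id t).div_const Cπ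
    have h2 := (((h1.exp.const_mul (m₀ - mπ)).mul (hCd'.sub_const Cπ)).div_const
      (C₀ - Cπ)).const_add mπ
    have h3 : mf = fun s => mπ + (m₀ - mπ) * Real.exp (s / Cπ) * (Cf s - Cπ) / (C₀ - Cπ) :=
      funext hmf
    have h4 := hmf t
    have h5 := hCf t
    generalize mf t = M at *
    rw [h3]
    refine h2.congr_deriv ?_
    symm
    rw [h4, h5, hκ]
    generalize Real.exp (t / Cπ) = E
    field_simp
    ring
end
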